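/- arXiv:0704.1217 — 3 statements merged into one kernel-verified Lean document; each statement's English description precedes it below -/
import Mathlib

section
/- Let F(s) = Σ_{n=1}^∞ a_n n^{−s} be a Dirichlet series with complex coefficients whose abscissa of absolute convergence is σ_a. Suppose x > 0 with x ∉ ℤ, and let c > max(0, σ_a). Then for any T ≥ 1, Σ_{n ≤ x} a_n = (1/2πi) ∫_{c−iT}^{c+iT} F(s) x^s/s ds + O( (x^c/T) · Σ_{n=1}^∞ |a_n| n^{−c} / |log(x/n)| ), with an absolute implied constant. -/
open Real

/-- Bound for the integral of `exp (s L) / s` along a horizontal segment. -/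
theorem norm_integral_exp_mul_div_le {a b τ L : ℝ} (hab : a ≤ b) (hτ : τ ≠ 0) (hL : L ≠ 0) :
    ‖∫ σ in a..b, Complex.exp ((σ + τ * Complex.I) * L) / (σ + τ * Complex.I)‖ ≤
      (rexp (b * L) - rexp (a * L)) / (L * |τ|) := by
  have key : ∫ σ in a..b, rexp (σ * L) / |τ| = (rexp (b * L) - rexp (a * L)) / (L * |τ|) := by
    have hderiv (σ : ℝ) : HasDerivAt (fun σ : ℝ ↦ rexp (σ * L) / (L * |τ|))
        (rexp (σ * L) / |τ|) σ := by
      have := (((hasDerivAt_id σ).mul_const L).exp).div_const (L * |τ|)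
      refine this.congr_deriv ?_
      simp only [id]
      field_simp
    rw [intervalIntegral.integral_eq_sub_of_hasDerivAt (fun σ _ ↦ hderiv σ)
      (Continuous.intervalIntegrable (by fun_prop) _ _)]
    ring
  rw [← key]
  refine intervalIntegral.norm_integral_le_of_norm_le hab (.of_forall fun σ _ ↦ ?_)
    (Continuous.intervalIntegrable (by fun_prop) _ _)
  rw [norm_div, Complex.norm_exp]
  have h1 : |τ| ≤ ‖(σ + τ * Complex.I : ℂ)‖ := by
    simpa using Complex.abs_im_le_norm (σ + τ * Complex.I : ℂ)
  have h2 : ((σ + τ * Complex.I : ℂ) * L).re = σ * L := by simp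
  rw [h2]
  have := abs_pos.2 hτ
  gcongr

/-- The integral of `s⁻¹` along the boundary of a rectangle centred at `0` is `2 π i`. -/
theorem integral_boundary_rect_inv {c T : ℝ} (hc : 0 < c) (hT : 0 < T) :
    (∫ σ in (-c)..c, ((σ : ℂ) + (-T : ℝ) * Complex.I)⁻¹) -
        (∫ σ in (-c)..c, ((σ : ℂ) + T * Complex.I)⁻¹) +
        Complex.I * (∫ t in (-T)..T, ((c : ℂ) + t * Complex.I)⁻¹) -
        Complex.I * (∫ t in (-T)..T, (((-c : ℝ) : ℂ) + t * Complex.I)⁻¹) =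
      2 * π * Complex.I := by
  have horiz (τ : ℝ) (hτ : τ ≠ 0) : ∫ σ in (-c)..c, ((σ : ℂ) + τ * Complex.I)⁻¹ =
      Complex.log (c + τ * Complex.I) - Complex.log (-c + τ * Complex.I) := by
    have hne (σ : ℝ) : (σ : ℂ) + τ * Complex.I ∈ Complex.slitPlane := by
      simp [Complex.mem_slitPlane_iff, hτ]
    rw [intervalIntegral.integral_eq_sub_of_hasDerivAt
      (f := fun σ : ℝ ↦ Complex.log (σ + τ * Complex.I))]
    · simp
    · intro σ _
      have := ((Complex.ofRealCLM.hasDerivAt (x := σ)).add_const (τ * Complex.I)).clog_real (hne σ)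
      simpa using this
    · refine Continuous.intervalIntegrable (Continuous.inv₀ (by fun_prop) fun σ ↦ ?_) _ _
      exact Complex.slitPlane_ne_zero (hne σ)
  have vert : ∫ t in (-T)..T, ((c : ℂ) + t * Complex.I)⁻¹ = -Complex.I *
      (Complex.log (c + T * Complex.I) - Complex.log (c - T * Complex.I)) := by
    have hne (t : ℝ) : (c : ℂ) + t * Complex.I ∈ Complex.slitPlane := by
      simp [Complex.mem_slitPlane_iff, hc]
    rw [intervalIntegral.integral_eq_sub_of_hasDerivAt
      (f := fun t : ℝ ↦ -Complex.I * Complex.log (c + t * Complex.I))]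
    · simp; ring_nf
    · intro t _
      have := ((((Complex.ofRealCLM.hasDerivAt (x := t)).mul_const Complex.I).const_add
        (c : ℂ)).clog_real (hne t)).const_mul (-Complex.I)
      refine this.congr_deriv ?_
      simp [← mul_div_assoc]
    · refine Continuous.intervalIntegrable (Continuous.inv₀ (by fun_prop) fun t ↦ ?_) _ _
      exact Complex.slitPlane_ne_zero (hne t)
  have vert' : ∫ t in (-T)..T, (((-c : ℝ) : ℂ) + t * Complex.I)⁻¹ =
      -∫ t in (-T)..T, ((c : ℂ) + t * Complex.I)⁻¹ := by
    rw [← intervalIntegral.integral_neg]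
    have := intervalIntegral.integral_comp_neg (a := -T) (b := T)
      (fun t : ℝ ↦ (((-c : ℝ) : ℂ) + t * Complex.I)⁻¹)
    rw [neg_neg] at this
    rw [← this]
    congr 1 with t
    rw [← inv_neg]
    congr 1
    push_cast
    ring
  have log_neg {z : ℂ} (hz : 0 < z.im) : Complex.log (-z) = Complex.log z - π * Complex.I := by
    simp only [Complex.log, norm_neg, Complex.arg_neg_eq_arg_sub_pi_of_im_pos hz]
    push_cast; ring
  have l1 := log_neg (z := c + T * Complex.I) (by simpa using hT)
  have l2 := log_neg (z := -c + T * Complex.I) (by simpa using hT)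
  have e1 : -(c + T * Complex.I) = -(c : ℂ) + (-T : ℝ) * Complex.I := by push_cast; ring
  have e2 : -(-c + T * Complex.I) = (c : ℂ) + (-T : ℝ) * Complex.I := by push_cast; ring
  have e3 : (c : ℂ) - T * Complex.I = (c : ℂ) + (-T : ℝ) * Complex.I := by push_cast; ring
  rw [e1] at l1
  rw [e2] at l2
  rw [vert', vert, horiz _ (neg_ne_zero.2 hT.ne'), horiz _ hT.ne', e3, l1, l2]
  linear_combination (-2 * (Complex.log (c + T * Complex.I) -
    (Complex.log (-c + T * Complex.I) - π * Complex.I))) * Complex.I_sq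

/-- Perron's integral over `[c - i T, c + i T]` for `y = exp L < 1`. -/
theorem norm_integral_exp_mul_div_le_of_neg {c T L : ℝ} (hc : 0 < c) (hT : 0 < T) (hL : L < 0) :
    ‖∫ t in (-T)..T, Complex.exp ((c + t * Complex.I) * L) / (c + t * Complex.I)‖ ≤
      2 * rexp (c * L) / (T * |L|) := by
  rw [abs_of_neg hL]
  set V : ℝ → ℂ := fun σ ↦
    ∫ t in (-T)..T, Complex.exp ((σ + t * Complex.I) * L) / (σ + t * Complex.I)
  have bound (R : ℝ) (hR : c < R) : ‖V c‖ ≤ 2 * rexp (c * L) / (T * -L) + 2 * T / R := by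
    have hrect := Complex.integral_boundary_rect_eq_zero_of_differentiableOn
      (fun s : ℂ ↦ Complex.exp (s * L) / s) ⟨c, -T⟩ ⟨R, T⟩ (by
        refine DifferentiableOn.div (by fun_prop) (by fun_prop) fun s hs h0 ↦ ?_
        have := hs.1
        simp [Set.uIcc_of_le hR.le, h0] at this
        linarith)
    simp only [smul_eq_mul] at hrect
    have h1 := norm_integral_exp_mul_div_le hR.le (neg_ne_zero.2 hT.ne') hL.ne
    have h2 := norm_integral_exp_mul_div_le hR.le hT.ne' hL.ne
    have h3 : ‖V R‖ ≤ 2 * T / R := by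
      have := intervalIntegral.norm_integral_le_of_norm_le_const (a := -T) (b := T) (C := 1 / R)
        (f := fun t : ℝ ↦ Complex.exp ((R + t * Complex.I) * L) / (R + t * Complex.I)) (by
          intro t _
          have hR0 : 0 < R := hc.trans hR
          have hre : ((R + t * Complex.I : ℂ) * L).re = R * L := by simp
          rw [norm_div, Complex.norm_exp, hre]
          have : R ≤ ‖(R + t * Complex.I : ℂ)‖ := by
            simpa using Complex.re_le_norm (R + t * Complex.I : ℂ)
          gcongr
          exact Real.exp_le_one_iff.2 (by nlinarith))
      rw [show |T - -T| = 2 * T by rw [abs_of_pos] <;> linarith] at this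
      refine this.trans_eq (by ring)
    have hb : (rexp (R * L) - rexp (c * L)) / (L * T) ≤ rexp (c * L) / (T * -L) := by
      rw [show L * T = -(T * -L) by ring, div_neg, ← neg_div]
      have : 0 < T * -L := by nlinarith
      gcongr
      linarith [exp_pos (R * L)]
    rw [abs_neg] at h1
    rw [abs_of_pos hT] at h1 h2
    set A := ∫ σ in c..R, Complex.exp ((σ + (-T : ℝ) * Complex.I) * L) / (σ + (-T : ℝ) * Complex.I)
    set B := ∫ σ in c..R, Complex.exp ((σ + T * Complex.I) * L) / (σ + T * Complex.I)
    have hVc : Complex.I * V c = A - B + Complex.I * V R := by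
      linear_combination -hrect
    calc ‖V c‖ = ‖Complex.I * V c‖ := by simp
      _ ≤ ‖A‖ + ‖B‖ + ‖Complex.I * V R‖ := by
        rw [hVc]; exact (norm_add_le _ _).trans (by gcongr; exact norm_sub_le _ _)
      _ ≤ rexp (c * L) / (T * -L) + rexp (c * L) / (T * -L) + 2 * T / R := by
        rw [norm_mul, Complex.norm_I, one_mul]
        exact add_le_add (add_le_add (h1.trans hb) (h2.trans hb)) h3
      _ = _ := by ring
  have hlim : Filter.Tendsto (fun R : ℝ ↦ 2 * rexp (c * L) / (T * -L) + 2 * T / R) Filter.atTop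
      (nhds (2 * rexp (c * L) / (T * -L) + 0)) :=
    (Filter.Tendsto.const_div_atTop Filter.tendsto_id _).const_add _
  rw [add_zero] at hlim
  exact ge_of_tendsto hlim ((Filter.eventually_gt_atTop c).mono bound)

/-- Perron's integral over `[c - i T, c + i T]` for `y = exp L > 1`. -/
theorem norm_two_pi_sub_integral_exp_mul_div_le {c T L : ℝ} (hc : 0 < c) (hT : 0 < T)
    (hL : 0 < L) :
    ‖2 * π - ∫ t in (-T)..T, Complex.exp ((c + t * Complex.I) * L) / (c + t * Complex.I)‖ ≤
      4 * rexp (c * L) / (T * |L|) := by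
  rw [abs_of_pos hL]
  have hrect := Complex.integral_boundary_rect_eq_zero_of_differentiableOn
    (dslope (fun s : ℂ ↦ Complex.exp (s * L)) 0) ⟨-c, -T⟩ ⟨c, T⟩
    (((Complex.differentiableOn_dslope (s := Set.univ) Filter.univ_mem).2
      (by fun_prop)).mono (Set.subset_univ _))
  simp only [smul_eq_mul] at hrect
  have hslope {s : ℂ} (hs : s ≠ 0) : dslope (fun s : ℂ ↦ Complex.exp (s * L)) 0 s =
      Complex.exp (s * L) / s - s⁻¹ := by
    rw [dslope_of_ne _ hs, slope_def_field]
    simp [sub_div]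
  have horiz (τ : ℝ) (hτ : τ ≠ 0) :
      ∫ σ in (-c)..c, dslope (fun s : ℂ ↦ Complex.exp (s * L)) 0 (σ + τ * Complex.I) =
      (∫ σ in (-c)..c, Complex.exp ((σ + τ * Complex.I) * L) / (σ + τ * Complex.I)) -
      ∫ σ in (-c)..c, ((σ : ℂ) + τ * Complex.I)⁻¹ := by
    have hne (σ : ℝ) : (σ : ℂ) + τ * Complex.I ≠ 0 := fun h ↦ hτ (by simpa using congrArg Complex.im h)
    rw [← intervalIntegral.integral_sub]
    · simp only [hslope (hne _)]
    · exact Continuous.intervalIntegrable (.div (by fun_prop) (by fun_prop) hne) _ _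
    · exact Continuous.intervalIntegrable (.inv₀ (by fun_prop) hne) _ _
  have vert (σ : ℝ) (hσ : σ ≠ 0) :
      ∫ t in (-T)..T, dslope (fun s : ℂ ↦ Complex.exp (s * L)) 0 (σ + t * Complex.I) =
      (∫ t in (-T)..T, Complex.exp ((σ + t * Complex.I) * L) / (σ + t * Complex.I)) -
      ∫ t in (-T)..T, ((σ : ℂ) + t * Complex.I)⁻¹ := by
    have hne (t : ℝ) : (σ : ℂ) + t * Complex.I ≠ 0 := fun h ↦ hσ (by simpa using congrArg Complex.re h)
    rw [← intervalIntegral.integral_sub]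
    · simp only [hslope (hne _)]
    · exact Continuous.intervalIntegrable (.div (by fun_prop) (by fun_prop) hne) _ _
    · exact Continuous.intervalIntegrable (.inv₀ (by fun_prop) hne) _ _
  rw [horiz _ (neg_ne_zero.2 hT.ne'), horiz _ hT.ne', vert _ hc.ne',
    vert _ (neg_ne_zero.2 hc.ne')] at hrect
  have hinv := integral_boundary_rect_inv hc hT
  have hreflect : ∫ t in (-T)..T,
      Complex.exp (((-c : ℝ) + t * Complex.I) * L) / ((-c : ℝ) + t * Complex.I) =
      -∫ t in (-T)..T, Complex.exp ((c + t * Complex.I) * (-L : ℝ)) / (c + t * Complex.I) := by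
    rw [← intervalIntegral.integral_neg]
    have := intervalIntegral.integral_comp_neg (a := -T) (b := T)
      (fun t : ℝ ↦ Complex.exp (((-c : ℝ) + t * Complex.I) * L) / ((-c : ℝ) + t * Complex.I))
    rw [neg_neg] at this
    rw [← this]
    congr 1 with t
    rw [← div_neg]
    congr 2 <;> push_cast <;> ring
  rw [hreflect] at hrect
  have hcc : -c ≤ c := by linarith
  have h1 := norm_integral_exp_mul_div_le hcc (neg_ne_zero.2 hT.ne') hL.ne'
  have h2 := norm_integral_exp_mul_div_le hcc hT.ne' hL.ne'
  have h3 := norm_integral_exp_mul_div_le_of_neg hc hT (neg_neg_of_pos hL)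
  rw [abs_neg] at h1 h3
  rw [abs_of_pos hT] at h1 h2
  rw [abs_of_pos hL] at h3
  have hTL : 0 < T * L := by positivity
  have hb : (rexp (c * L) - rexp (-c * L)) / (L * T) ≤ rexp (c * L) / (T * L) := by
    rw [mul_comm L T]
    gcongr
    linarith [exp_pos (-c * L)]
  have h4 : 2 * rexp (c * -L) / (T * L) ≤ 2 * rexp (c * L) / (T * L) := by
    gcongr
    linarith
  set A := ∫ σ in (-c)..c,
    Complex.exp ((σ + (-T : ℝ) * Complex.I) * L) / (σ + (-T : ℝ) * Complex.I)
  set B := ∫ σ in (-c)..c, Complex.exp ((σ + T * Complex.I) * L) / (σ + T * Complex.I)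
  set V := ∫ t in (-T)..T, Complex.exp ((c + t * Complex.I) * L) / (c + t * Complex.I)
  set W := ∫ t in (-T)..T, Complex.exp ((c + t * Complex.I) * (-L : ℝ)) / (c + t * Complex.I)
  have hVc : Complex.I * (2 * π - V) = A - B + Complex.I * W := by
    linear_combination -hrect - hinv
  calc ‖2 * π - V‖ = ‖Complex.I * (2 * π - V)‖ := by simp
    _ ≤ ‖A‖ + ‖B‖ + ‖Complex.I * W‖ := by
      rw [hVc]; exact (norm_add_le _ _).trans (by gcongr; exact norm_sub_le _ _)
    _ ≤ rexp (c * L) / (T * L) + rexp (c * L) / (T * L) + 2 * rexp (c * L) / (T * L) := by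
      rw [norm_mul, Complex.norm_I, one_mul]
      exact add_le_add (add_le_add (h1.trans hb) (h2.trans hb)) (h3.trans h4)
    _ = _ := by ring

/-- Truncated Perron formula for a single term. -/
theorem norm_indicator_sub_integral_le {c T L : ℝ} (hc : 0 < c) (hT : 0 < T) (hL : L ≠ 0) :
    ‖(if 0 < L then 1 else 0) - (2 * (π : ℂ))⁻¹ *
      ∫ t in (-T)..T, Complex.exp ((c + t * Complex.I) * L) / (c + t * Complex.I)‖ ≤
      rexp (c * L) / (T * |L|) := by
  have hTL : 0 < T * |L| := mul_pos hT (abs_pos.2 hL)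
  have hE : 0 ≤ rexp (c * L) / (T * |L|) := by positivity
  set V := ∫ t in (-T)..T, Complex.exp ((c + t * Complex.I) * L) / (c + t * Complex.I)
  have hV4 : ‖(if 0 < L then 2 * (π : ℂ) else 0) - V‖ ≤ 4 * (rexp (c * L) / (T * |L|)) := by
    split_ifs with h
    · rw [← mul_div_assoc]
      exact norm_two_pi_sub_integral_exp_mul_div_le hc hT h
    · have := norm_integral_exp_mul_div_le_of_neg hc hT (lt_of_le_of_ne (not_lt.1 h) hL)
      rw [zero_sub, norm_neg]
      rw [mul_div_assoc] at this
      linarith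
  have hfactor : (if 0 < L then 1 else 0) - (2 * (π : ℂ))⁻¹ * V =
      (2 * (π : ℂ))⁻¹ * ((if 0 < L then 2 * (π : ℂ) else 0) - V) := by
    split_ifs
    · field_simp
    · ring
  have hn : ‖(2 * (π : ℂ))⁻¹‖ = (2 * π)⁻¹ := by
    simp [abs_of_pos pi_pos]
  rw [hfactor, norm_mul, hn, inv_mul_le_iff₀ (by positivity)]
  nlinarith [pi_gt_three]

/-- Summability of the error terms in the truncated Perron formula. -/
theorem summable_div_abs_log {b : ℕ → ℝ} (hb : ∀ n, 0 ≤ b n) (hsum : Summable b) {x : ℝ}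
    (hx : 0 < x) : Summable fun n : ℕ ↦ b n / |Real.log (x / ((n : ℝ) + 1))| := by
  refine Summable.of_norm_bounded_eventually_nat hsum ?_
  have hlim : Filter.Tendsto (fun n : ℕ ↦ x⁻¹ * ((n : ℝ) + 1)) Filter.atTop Filter.atTop :=
    (Filter.tendsto_atTop_add_const_right _ _ tendsto_natCast_atTop_atTop).const_mul_atTop
      (inv_pos.2 hx)
  filter_upwards [(Real.tendsto_log_atTop.comp hlim).eventually_ge_atTop 1] with n hn
  have h : 1 ≤ |Real.log (x / ((n : ℝ) + 1))| := by
    rw [← inv_div, Real.log_inv, abs_neg, div_eq_inv_mul]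
    exact le_trans hn (le_abs_self _)
  rw [norm_of_nonneg (div_nonneg (hb n) (abs_nonneg _))]
  exact div_le_self (hb n) h

theorem stmt_4 :
    ∃ C : ℝ, ∀ (a : ℕ → ℂ) (c x T : ℝ),
      0 < x → (∀ m : ℤ, (m : ℝ) ≠ x) → 0 < c →
      (∃ σ : ℝ, σ < c ∧ Summable fun n : ℕ => ‖a (n + 1)‖ / ((n : ℝ) + 1) ^ σ) →
      1 ≤ T →
      ‖(∑ n ∈ Finset.Icc 1 ⌊x⌋₊, a n) -
          (2 * (π : ℂ))⁻¹ * ∫ t in (-T)..T,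
            (∑' n : ℕ, a (n + 1) / ((n : ℂ) + 1) ^ ((c : ℂ) + t * Complex.I)) *
              (x : ℂ) ^ ((c : ℂ) + t * Complex.I) / ((c : ℂ) + t * Complex.I)‖
        ≤ C * (x ^ c / T) *
            ∑' n : ℕ, (‖a (n + 1)‖ / ((n : ℝ) + 1) ^ c) / |Real.log (x / ((n : ℝ) + 1))| := by
  refine ⟨1, fun a c x T hx hxint hc ⟨σ, hσ, hsum⟩ hT1 ↦ ?_⟩
  have hT : 0 < T := by linarith
  have hsumc : Summable fun n : ℕ ↦ ‖a (n + 1)‖ / ((n : ℝ) + 1) ^ c := by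
    refine hsum.of_nonneg_of_le (fun n ↦ by positivity) fun n ↦ ?_
    gcongr
    linarith [(Nat.cast_nonneg n : (0 : ℝ) ≤ n)]
  set L : ℕ → ℝ := fun n ↦ Real.log (x / ((n : ℝ) + 1)) with hLdef
  have hexp (n : ℕ) : rexp (c * L n) = x ^ c / ((n : ℝ) + 1) ^ c := by
    rw [← Real.div_rpow hx.le (by positivity), Real.rpow_def_of_pos (by positivity), mul_comm]
  have hLne (n : ℕ) : L n ≠ 0 := by
    have h1 : x / ((n : ℝ) + 1) ≠ 1 := fun h ↦ by
      rw [div_eq_one_iff_eq (by positivity)] at h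
      exact hxint (n + 1) (by simp [h])
    exact Real.log_ne_zero_of_pos_of_ne_one (by positivity) h1
  have hLpos (n : ℕ) : 0 < L n ↔ n < ⌊x⌋₊ := by
    rw [Real.log_pos_iff (by positivity), one_lt_div (by positivity), ← Nat.succ_le_iff,
      Nat.le_floor_iff hx.le, Nat.cast_succ]
    refine ⟨le_of_lt, fun h ↦ lt_of_le_of_ne h fun h' ↦ hxint (n + 1) (by simp [h'])⟩
  have hterm (n : ℕ) (s : ℂ) : a (n + 1) / ((n : ℂ) + 1) ^ s * (x : ℂ) ^ s / s =
      a (n + 1) * (Complex.exp (s * L n) / s) := by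
    have hn : ((n : ℂ) + 1) ≠ 0 := by exact_mod_cast n.succ_ne_zero
    have hx0 : (x : ℂ) ≠ 0 := by exact_mod_cast hx.ne'
    have hLn : (L n : ℂ) = Complex.log x - Complex.log ((n : ℂ) + 1) := by
      rw [hLdef]
      simp only
      rw [Real.log_div hx.ne' (by positivity), Complex.ofReal_sub, Complex.ofReal_log hx.le,
        Complex.ofReal_log (by positivity)]
      push_cast
      rfl
    rw [hLn, Complex.cpow_def_of_ne_zero hn, Complex.cpow_def_of_ne_zero hx0, mul_sub,
      Complex.exp_sub, mul_comm s, mul_comm s]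
    ring
  have hre (t : ℝ) (n : ℕ) : ((c + t * Complex.I : ℂ) * L n).re = c * L n := by simp
  have hcs (t : ℝ) : c ≤ ‖(c + t * Complex.I : ℂ)‖ := by
    simpa using Complex.re_le_norm (c + t * Complex.I : ℂ)
  have hne (t : ℝ) : (c + t * Complex.I : ℂ) ≠ 0 := norm_pos_iff.1 (hc.trans_le (hcs t))
  have hbound (n : ℕ) (t : ℝ) :
      ‖a (n + 1) * (Complex.exp ((c + t * Complex.I) * L n) / (c + t * Complex.I))‖ ≤
        ‖a (n + 1)‖ / ((n : ℝ) + 1) ^ c * (x ^ c / c) := by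
    rw [norm_mul, norm_div, Complex.norm_exp, hre, hexp]
    calc _ ≤ ‖a (n + 1)‖ * (x ^ c / ((n : ℝ) + 1) ^ c / c) := by
          gcongr
          exact hcs t
      _ = _ := by ring
  have hbsum : Summable fun n : ℕ ↦ ‖a (n + 1)‖ / ((n : ℝ) + 1) ^ c * (x ^ c / c) :=
    hsumc.mul_right _
  have hint := intervalIntegral.hasSum_integral_of_dominated_convergence
    (μ := MeasureTheory.volume) (a := -T) (b := T)
    (F := fun (n : ℕ) (t : ℝ) ↦
      a (n + 1) * (Complex.exp ((c + t * Complex.I) * L n) / (c + t * Complex.I)))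
    (f := fun t : ℝ ↦ (∑' n : ℕ, a (n + 1) / ((n : ℂ) + 1) ^ ((c : ℂ) + t * Complex.I)) *
      (x : ℂ) ^ ((c : ℂ) + t * Complex.I) / ((c : ℂ) + t * Complex.I))
    (fun n _ ↦ ‖a (n + 1)‖ / ((n : ℝ) + 1) ^ c * (x ^ c / c))
    (fun n ↦ (Continuous.mul continuous_const
      (.div (by fun_prop) (by fun_prop) hne)).aestronglyMeasurable)
    (fun n ↦ .of_forall fun t _ ↦ hbound n t) (.of_forall fun _ _ ↦ hbsum)
    intervalIntegrable_const (.of_forall fun t _ ↦ by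
      rw [← tsum_mul_right, ← tsum_div_const]
      simp only [hterm]
      exact (Summable.of_norm_bounded hbsum fun n ↦ hbound n t).hasSum)
  simp only [intervalIntegral.integral_const_mul] at hint
  have hfin : HasSum (fun n : ℕ ↦ a (n + 1) * (if 0 < L n then 1 else 0))
      (∑ n ∈ Finset.Icc 1 ⌊x⌋₊, a n) := by
    have hIcc : ∑ n ∈ Finset.Icc 1 ⌊x⌋₊, a n = ∑ n ∈ Finset.range ⌊x⌋₊,
        a (n + 1) * (if 0 < L n then 1 else 0) := by
      rw [← Finset.Ico_add_one_right_eq_Icc, Finset.sum_Ico_eq_sum_range]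
      refine Finset.sum_congr (by simp) fun n hn ↦ ?_
      rw [if_pos ((hLpos n).2 (by simpa using hn)), mul_one, add_comm]
    rw [hIcc]
    refine hasSum_sum_of_ne_finset_zero fun n hn ↦ ?_
    rw [if_neg (by rwa [hLpos, ← Finset.mem_range]), mul_zero]
  have hdiff := hfin.sub (hint.mul_left (2 * (π : ℂ))⁻¹)
  have herr := (summable_div_abs_log (fun n ↦ by positivity) hsumc hx).mul_left (x ^ c / T)
  rw [← hdiff.tsum_eq, one_mul, ← tsum_mul_left]
  refine tsum_of_norm_bounded herr.hasSum fun n ↦ ?_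
  have hpt := norm_indicator_sub_integral_le hc hT (hLne n)
  rw [mul_left_comm, ← mul_sub, norm_mul]
  calc _ ≤ ‖a (n + 1)‖ * (rexp (c * L n) / (T * |L n|)) := by gcongr
    _ = _ := by rw [hexp]; ring
end

section
/- Let a ∈ ℤ^3 be a primitive vector with a_1a_2a_3 ≠ 0 and gcd(a_i, a_j) = 1 for all i ≠ j, and let B_1, B_2, B_3 > 0. Then the number of primitive vectors x ∈ ℤ^3 satisfying a_1x_1^2 + a_2x_2^2 + a_3x_3^2 = 0 and |x_i| ≤ B_i for i = 1,2,3 is O( (1 + B_1B_2B_3/|a_1a_2a_3|)^{1/3} · τ(|a_1a_2a_3|) ), with an absolute implied constant, where τ(n) denotes the number of positive divisors of n. -/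
theorem vandermonde_cubes_le_of_sorted {y₁ y₂ y₃ d : ℝ} (h₁ : 1 ≤ y₁) (h₁₂ : y₁ ≤ y₂)
    (h₂₃ : y₂ ≤ y₃) (hd : y₃ - y₁ ≤ d) :
    (y₂ ^ 3 - y₁ ^ 3) * (y₃ ^ 3 - y₂ ^ 3) * (y₃ ^ 3 - y₁ ^ 3) ≤
      343 * d ^ 3 * (y₁ ^ 3 * y₂ ^ 3 * y₃ ^ 3) := by
  have hy₁ : 0 < y₁ := by linarith
  have hy₂ : 0 < y₂ := by linarith
  have hy₃ : 0 < y₃ := by linarith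
  have hd0 : 0 ≤ d := by linarith
  have e₁₂ : 0 ≤ y₂ ^ 3 - y₁ ^ 3 := sub_nonneg.2 (by gcongr)
  have e₂₃ : 0 ≤ y₃ ^ 3 - y₂ ^ 3 := sub_nonneg.2 (by gcongr)
  have e₁₃ : 0 ≤ y₃ ^ 3 - y₁ ^ 3 := sub_nonneg.2 (by linarith)
  have hgrow : y₃ ^ 3 ≤ ((1 + d) * y₁) ^ 3 := by
    gcongr
    nlinarith
  rcases le_total d 1 with h | h
  · have hthird : y₃ ^ 3 - y₁ ^ 3 ≤ 7 * d * y₁ ^ 3 := by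
      have : (1 + d) ^ 3 ≤ 1 + 7 * d := by nlinarith [mul_nonneg hd0 hd0]
      nlinarith [mul_le_mul_of_nonneg_right this (pow_pos hy₁ 3).le]
    have hle₂ : y₁ ^ 3 ≤ y₂ ^ 3 := by gcongr
    have hle₃ : y₁ ^ 3 ≤ y₃ ^ 3 := pow_le_pow_left₀ hy₁.le (by linarith) 3
    have c₂ : y₂ ^ 3 - y₁ ^ 3 ≤ 7 * d * y₂ ^ 3 := by
      have : 7 * d * y₁ ^ 3 ≤ 7 * d * y₂ ^ 3 := by gcongr
      linarith
    have c₃ : y₃ ^ 3 - y₂ ^ 3 ≤ 7 * d * y₃ ^ 3 := by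
      have : 7 * d * y₁ ^ 3 ≤ 7 * d * y₃ ^ 3 := by gcongr
      linarith
    calc _ ≤ (7 * d * y₂ ^ 3) * (7 * d * y₃ ^ 3) * (7 * d * y₁ ^ 3) := by gcongr
      _ = _ := by ring
  · have hthird : y₃ ^ 3 - y₁ ^ 3 ≤ 8 * d ^ 3 * y₁ ^ 3 := by
      have : ((1 + d) * y₁) ^ 3 ≤ ((d + d) * y₁) ^ 3 := by gcongr
      nlinarith [pow_pos hy₁ 3]
    have c₂ : y₂ ^ 3 - y₁ ^ 3 ≤ y₂ ^ 3 := by linarith [pow_pos hy₁ 3]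
    have c₃ : y₃ ^ 3 - y₂ ^ 3 ≤ y₃ ^ 3 := by linarith [pow_pos hy₂ 3]
    calc _ ≤ y₂ ^ 3 * y₃ ^ 3 * (8 * d ^ 3 * y₁ ^ 3) := by gcongr
      _ = 8 * (d ^ 3 * (y₁ ^ 3 * y₂ ^ 3 * y₃ ^ 3)) := by ring
      _ ≤ 343 * (d ^ 3 * (y₁ ^ 3 * y₂ ^ 3 * y₃ ^ 3)) := by gcongr; norm_num
      _ = _ := by ring

theorem abs_vandermonde_cubes_le {y₁ y₂ y₃ d : ℝ} (h₁ : 1 ≤ y₁) (h₂ : 1 ≤ y₂) (h₃ : 1 ≤ y₃)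
    (d₁₂ : |y₁ - y₂| ≤ d) (d₂₃ : |y₂ - y₃| ≤ d) (d₁₃ : |y₁ - y₃| ≤ d) :
    |(y₂ ^ 3 - y₁ ^ 3) * (y₃ ^ 3 - y₂ ^ 3) * (y₃ ^ 3 - y₁ ^ 3)| ≤
      343 * d ^ 3 * (y₁ ^ 3 * y₂ ^ 3 * y₃ ^ 3) := by
  have key : ∀ {p q r : ℝ}, 1 ≤ p → p ≤ q → q ≤ r → r - p ≤ d →
      |(q ^ 3 - p ^ 3) * (r ^ 3 - q ^ 3) * (r ^ 3 - p ^ 3)| ≤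
        343 * d ^ 3 * (p ^ 3 * q ^ 3 * r ^ 3) := by
    intro p q r hp hpq hqr hd
    rw [abs_of_nonneg]
    · exact vandermonde_cubes_le_of_sorted hp hpq hqr hd
    · have := pow_le_pow_left₀ (by linarith) hpq 3
      have := pow_le_pow_left₀ (by linarith) hqr 3
      exact mul_nonneg (mul_nonneg (by linarith) (by linarith)) (by linarith)
  rw [abs_le] at d₁₂ d₂₃ d₁₃
  rcases le_total y₁ y₂ with h₁₂ | h₁₂ <;> rcases le_total y₂ y₃ with h₂₃ | h₂₃ <;>
    rcases le_total y₁ y₃ with h₁₃ | h₁₃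
  · exact key h₁ h₁₂ h₂₃ (by linarith)
  · exact key h₁ h₁₂ h₂₃ (by linarith)
  · convert key h₁ h₁₃ h₂₃ (by linarith) using 1
    · rw [← abs_neg]; congr 1; ring
    · ring
  · convert key h₃ h₁₃ h₁₂ (by linarith) using 1
    · congr 1; ring
    · ring
  · convert key h₂ h₁₂ h₁₃ (by linarith) using 1
    · rw [← abs_neg]; congr 1; ring
    · ring
  · convert key h₂ h₂₃ h₁₃ (by linarith) using 1
    · congr 1; ring
    · ring
  · convert key h₃ h₂₃ h₁₂ (by linarith) using 1
    · rw [← abs_neg]; congr 1; ring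
    · ring
  · convert key h₃ h₂₃ h₁₂ (by linarith) using 1
    · rw [← abs_neg]; congr 1; ring
    · ring

/-- The determinant of the matrix with rows `(x₁, y₁, z₁)`, `(x₂, y₂, z₂)`, `(x₃, y₃, z₃)`. -/
def rowDet {R : Type*} [CommRing R] (x₁ y₁ z₁ x₂ y₂ z₂ x₃ y₃ z₃ : R) : R :=
  x₁ * (y₂ * z₃ - y₃ * z₂) - y₁ * (x₂ * z₃ - x₃ * z₂) + z₁ * (x₂ * y₃ - x₃ * y₂)

/-- Coordinates on the cone `x² + y² = z²`. -/
theorem exists_cone_param {x y z : ℝ} (hx : 0 ≤ x) (hy : 0 ≤ y) (hz : 0 < z)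
    (h : x ^ 2 + y ^ 2 = z ^ 2) :
    ∃ r u : ℝ, 0 < r ∧ 0 ≤ u ∧ u ≤ 1 ∧ x = r * (1 - u ^ 2) ∧ y = 2 * (r * u) ∧
      z = r * (1 + u ^ 2) := by
  have hs : 0 < x + z := by linarith
  refine ⟨(x + z) / 2, y / (x + z), by positivity, by positivity, ?_, ?_, ?_, ?_⟩
  · rw [div_le_one hs]; nlinarith
  · field_simp; linear_combination h
  · field_simp
  · field_simp; linear_combination -h

theorem rowDet_cone (r₁ u₁ r₂ u₂ r₃ u₃ : ℝ) :
    rowDet (r₁ * (1 - u₁ ^ 2)) (2 * (r₁ * u₁)) (r₁ * (1 + u₁ ^ 2))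
      (r₂ * (1 - u₂ ^ 2)) (2 * (r₂ * u₂)) (r₂ * (1 + u₂ ^ 2))
      (r₃ * (1 - u₃ ^ 2)) (2 * (r₃ * u₃)) (r₃ * (1 + u₃ ^ 2)) =
    4 * (r₁ * r₂ * r₃) * ((u₂ - u₁) * (u₃ - u₂) * (u₃ - u₁)) := by
  unfold rowDet; ring

theorem rowDet_cone_ne_zero {x₁ y₁ z₁ x₂ y₂ z₂ x₃ y₃ z₃ : ℝ}
    (hx₁ : 0 ≤ x₁) (hy₁ : 0 ≤ y₁) (hz₁ : 0 < z₁) (h₁ : x₁ ^ 2 + y₁ ^ 2 = z₁ ^ 2)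
    (hx₂ : 0 ≤ x₂) (hy₂ : 0 ≤ y₂) (hz₂ : 0 < z₂) (h₂ : x₂ ^ 2 + y₂ ^ 2 = z₂ ^ 2)
    (hx₃ : 0 ≤ x₃) (hy₃ : 0 ≤ y₃) (hz₃ : 0 < z₃) (h₃ : x₃ ^ 2 + y₃ ^ 2 = z₃ ^ 2)
    (h₁₂ : ¬ (x₁ * z₂ = x₂ * z₁ ∧ y₁ * z₂ = y₂ * z₁))
    (h₂₃ : ¬ (x₂ * z₃ = x₃ * z₂ ∧ y₂ * z₃ = y₃ * z₂))
    (h₁₃ : ¬ (x₁ * z₃ = x₃ * z₁ ∧ y₁ * z₃ = y₃ * z₁)) :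
    rowDet x₁ y₁ z₁ x₂ y₂ z₂ x₃ y₃ z₃ ≠ 0 := by
  obtain ⟨r₁, u₁, hr₁, -, -, rfl, rfl, rfl⟩ := exists_cone_param hx₁ hy₁ hz₁ h₁
  obtain ⟨r₂, u₂, hr₂, -, -, rfl, rfl, rfl⟩ := exists_cone_param hx₂ hy₂ hz₂ h₂
  obtain ⟨r₃, u₃, hr₃, -, -, rfl, rfl, rfl⟩ := exists_cone_param hx₃ hy₃ hz₃ h₃
  have n₁₂ : u₂ ≠ u₁ := by rintro rfl; exact h₁₂ ⟨by ring, by ring⟩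
  have n₂₃ : u₃ ≠ u₂ := by rintro rfl; exact h₂₃ ⟨by ring, by ring⟩
  have n₁₃ : u₃ ≠ u₁ := by rintro rfl; exact h₁₃ ⟨by ring, by ring⟩
  rw [rowDet_cone]
  have := sub_ne_zero.2 n₁₂
  have := sub_ne_zero.2 n₂₃
  have := sub_ne_zero.2 n₁₃
  positivity

theorem card_cone_le_of_le {ι : Type*} (S : Finset ι) (x y z : ι → ℝ) {b₁ b₂ b₃ K : ℝ}
    (hb₁ : 0 < b₁) (hb₂ : 0 < b₂) (hb₃ : 0 < b₃) (hK : 0 < K) (hb : b₂ ≤ b₁)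
    (hx : ∀ i ∈ S, 0 ≤ x i ∧ x i ≤ b₁) (hy : ∀ i ∈ S, 0 ≤ y i ∧ y i ≤ b₂)
    (hz : ∀ i ∈ S, 0 < z i ∧ z i ≤ b₃) (hq : ∀ i ∈ S, x i ^ 2 + y i ^ 2 = z i ^ 2)
    (hdet : ∀ i ∈ S, ∀ j ∈ S, ∀ k ∈ S, i ≠ j → i ≠ k → j ≠ k →
      K ≤ |rowDet (x i) (y i) (z i) (x j) (y j) (z j) (x k) (y k) (z k)|) :
    (S.card : ℝ) ≤ 2 + 92 * (b₁ * b₂ * b₃ / K) ^ ((1 : ℝ) / 3) := by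
  have hparam : ∀ i, ∃ r u : ℝ, i ∈ S → 0 < r ∧ 0 ≤ u ∧ u ≤ 1 ∧ x i = r * (1 - u ^ 2) ∧
      y i = 2 * (r * u) ∧ z i = r * (1 + u ^ 2) := by
    intro i
    by_cases hi : i ∈ S
    · obtain ⟨r, u, h⟩ := exists_cone_param (hx i hi).1 (hy i hi).1 (hz i hi).1 (hq i hi)
      exact ⟨r, u, fun _ => h⟩
    · exact ⟨0, 0, fun h => absurd h hi⟩
  choose r u hru using hparam
  obtain ⟨ρ, hρ⟩ : ∃ ρ, ρ = 2 * min b₁ b₃ := ⟨_, rfl⟩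
  obtain ⟨β, hβ⟩ : ∃ β, β = min b₂ b₃ := ⟨_, rfl⟩
  have hm : 0 < min b₁ b₃ := lt_min hb₁ hb₃
  have hρ0 : 0 < ρ := by linarith
  have hβ0 : 0 < β := hβ ▸ lt_min hb₂ hb₃
  have hβm : β ≤ min b₁ b₃ := hβ ▸ min_le_min_right _ hb
  have hβρ : β ≤ ρ := by linarith
  have hprod : ρ * β ^ 2 ≤ 4 * (b₁ * b₂ * b₃) := by
    have h1 : min b₁ b₃ ≤ b₁ := min_le_left _ _
    have h2 : β ≤ b₂ := hβ ▸ min_le_left _ _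
    have h3 : β ≤ b₃ := hβ ▸ min_le_right _ _
    have h4 : min b₁ b₃ * (β * β) ≤ b₁ * (b₂ * b₃) := by gcongr
    nlinarith [mul_pos hm (mul_pos hβ0 hβ0)]
  have hrle : ∀ i ∈ S, r i ≤ ρ := by
    intro i hi
    obtain ⟨h0, hu0, hu1, ex, ey, ez⟩ := hru i hi
    have hz3 := (hz i hi).2
    have hx1 := (hx i hi).2
    have hy2 := (hy i hi).2
    have hrz : r i ≤ b₃ := by nlinarith [sq_nonneg (u i)]
    have hrx : r i ≤ 2 * b₁ := by
      have : r i * (u i) ^ 2 ≤ r i * u i := by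
        gcongr
        nlinarith
      nlinarith
    rw [hρ]
    rcases min_choice b₁ b₃ with h | h <;> rw [h] <;> linarith
  have hrule : ∀ i ∈ S, r i * u i ≤ β := by
    intro i hi
    obtain ⟨h0, hu0, hu1, ex, ey, ez⟩ := hru i hi
    have hz3 := (hz i hi).2
    have hy2 := (hy i hi).2
    have : 0 ≤ r i * u i := by positivity
    rw [hβ]
    refine le_min (by linarith) ?_
    nlinarith [sq_nonneg (u i - 1)]
  -- `w i` is the slope `u i`, rescaled so that `r i ≤ 2ρ / w i`.
  obtain ⟨w, hw⟩ : ∃ w : ι → ℝ, ∀ i, w i = 1 + u i * (ρ / β) := ⟨_, fun _ => rfl⟩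
  have hw1 : ∀ i ∈ S, 1 ≤ w i := by
    intro i hi
    have := (hru i hi).2.1
    rw [hw]
    have : 0 ≤ u i * (ρ / β) := by positivity
    linarith
  have hwle : ∀ i ∈ S, w i ≤ 2 * ρ / β := by
    intro i hi
    have := (hru i hi).2.2.1
    have h1 : u i * (ρ / β) ≤ 1 * (ρ / β) := by gcongr
    have h2 : 1 ≤ ρ / β := (one_le_div hβ0).2 hβρ
    rw [hw, mul_div_assoc]
    linarith
  have hrw : ∀ i ∈ S, r i * w i ≤ 2 * ρ := by
    intro i hi
    have h1 : r i * w i = r i + r i * u i * (ρ / β) := by rw [hw]; ring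
    have h2 : r i * u i * (ρ / β) ≤ β * (ρ / β) := by gcongr; exact hrule i hi
    rw [mul_div_cancel₀ _ hβ0.ne'] at h2
    linarith [hrle i hi]
  obtain ⟨t, ht⟩ : ∃ t : ι → ℝ, ∀ i, t i = w i ^ ((1 : ℝ) / 3) := ⟨_, fun _ => rfl⟩
  have hcube : ∀ {a : ℝ}, 0 ≤ a → (a ^ ((1 : ℝ) / 3)) ^ 3 = a := by
    intro a ha
    rw [← Real.rpow_natCast, ← Real.rpow_mul ha]; norm_num
  have ht3 : ∀ i ∈ S, t i ^ 3 = w i := fun i hi => by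
    rw [ht, hcube (by linarith [hw1 i hi])]
  have ht1 : ∀ i ∈ S, 1 ≤ t i := fun i hi => by
    rw [ht]; exact Real.one_le_rpow (hw1 i hi) (by norm_num)
  obtain ⟨κ, hκ⟩ : ∃ κ, κ = K ^ ((1 : ℝ) / 3) := ⟨_, rfl⟩
  have hκ3 : κ ^ 3 = K := by rw [hκ, hcube hK.le]
  have hκ0 : 0 < κ := hκ ▸ Real.rpow_pos_of_pos hK _
  obtain ⟨δ, hδ⟩ : ∃ δ, δ = κ / (23 * β) := ⟨_, rfl⟩
  have hδ0 : 0 < δ := by rw [hδ]; positivity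
  obtain ⟨T, hT⟩ : ∃ T, T = (2 * ρ / β) ^ ((1 : ℝ) / 3) := ⟨_, rfl⟩
  have hT0 : 0 ≤ T := by rw [hT]; positivity
  have htT : ∀ i ∈ S, t i ≤ T := fun i hi => by
    rw [ht, hT]
    exact Real.rpow_le_rpow (by linarith [hw1 i hi]) (hwle i hi) (by norm_num)
  have hcard : S.card ≤ 2 * (Finset.range (⌊T / δ⌋₊ + 1)).card := by
    refine Finset.card_le_mul_card_image_of_maps_to (f := fun i => ⌊t i / δ⌋₊) ?_ 2 ?_
    · intro i hi
      rw [Finset.mem_range, Nat.lt_succ_iff]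
      exact Nat.floor_le_floor (by gcongr; exact htT i hi)
    · intro n _
      by_contra! hlt
      obtain ⟨i, j, k, hi, hj, hk, hij, hik, hjk⟩ := Finset.two_lt_card_iff.1 hlt
      simp only [Finset.mem_filter] at hi hj hk
      have hclose : ∀ {i j}, i ∈ S ∧ ⌊t i / δ⌋₊ = n → j ∈ S ∧ ⌊t j / δ⌋₊ = n →
          |t i - t j| ≤ δ := by
        intro i j hi hj
        have bi := (Nat.floor_eq_iff (div_nonneg (by linarith [ht1 i hi.1]) hδ0.le)).1 hi.2
        have bj := (Nat.floor_eq_iff (div_nonneg (by linarith [ht1 j hj.1]) hδ0.le)).1 hj.2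
        rw [le_div_iff₀ hδ0, div_lt_iff₀ hδ0] at bi bj
        rw [abs_le]
        constructor <;> linarith
      have hV := abs_vandermonde_cubes_le (ht1 i hi.1) (ht1 j hj.1) (ht1 k hk.1)
        (hclose hi hj) (hclose hj hk) (hclose hi hk)
      rw [ht3 i hi.1, ht3 j hj.1, ht3 k hk.1] at hV
      have hD := hdet i hi.1 j hj.1 k hk.1 hij hik hjk
      obtain ⟨ri, -, -, xi, yi, zi⟩ := hru i hi.1
      obtain ⟨rj, -, -, xj, yj, zj⟩ := hru j hj.1
      obtain ⟨rk, -, -, xk, yk, zk⟩ := hru k hk.1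
      have wi := hw1 i hi.1
      have wj := hw1 j hj.1
      have wk := hw1 k hk.1
      rw [xi, yi, zi, xj, yj, zj, xk, yk, zk, rowDet_cone] at hD
      have hu : ∀ i, u i = (w i - 1) * (β / ρ) := fun i => by rw [hw]; field_simp; ring
      have hcontr : K ≤ 10976 / 12167 * K := by
        calc K ≤ _ := hD
          _ = 4 * (r i * r j * r k) * (β / ρ) ^ 3 *
              |(w j - w i) * (w k - w j) * (w k - w i)| := by
            rw [show 4 * (r i * r j * r k) * ((u j - u i) * (u k - u j) * (u k - u i)) =
              (4 * (r i * r j * r k) * (β / ρ) ^ 3) *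
                ((w j - w i) * (w k - w j) * (w k - w i)) by
              rw [hu i, hu j, hu k]; ring, abs_mul, abs_of_nonneg (by positivity)]
          _ ≤ 4 * (r i * r j * r k) * (β / ρ) ^ 3 * (343 * δ ^ 3 * (w i * w j * w k)) := by
            gcongr
          _ = 1372 * (β / ρ) ^ 3 * δ ^ 3 * ((r i * w i) * (r j * w j) * (r k * w k)) := by ring
          _ ≤ 1372 * (β / ρ) ^ 3 * δ ^ 3 * ((2 * ρ) * (2 * ρ) * (2 * ρ)) := by
            exact mul_le_mul_of_nonneg_left (mul_le_mul (mul_le_mul (hrw i hi.1) (hrw j hj.1)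
              (by positivity) (by positivity)) (hrw k hk.1) (by positivity) (by positivity))
              (by positivity)
          _ = 10976 / 12167 * K := by
            rw [hδ, ← hκ3]; field_simp; norm_num
      linarith
  have hTδ : T / δ ≤ 46 * (b₁ * b₂ * b₃ / K) ^ ((1 : ℝ) / 3) := by
    refine le_of_pow_le_pow_left₀ (n := 3) (by norm_num) (by positivity) ?_
    rw [mul_pow, hcube (by positivity), div_pow, hT, hcube (by positivity), hδ, div_pow, hκ3]
    have : 2 * ρ / β / (K / (23 * β) ^ 3) = 2 * 23 ^ 3 * (ρ * β ^ 2) / K := by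
      field_simp
    rw [this, mul_div_assoc' (46 ^ 3)]
    refine div_le_div_of_nonneg_right ?_ hK.le
    linarith
  have hfl : (⌊T / δ⌋₊ : ℝ) ≤ T / δ := Nat.floor_le (by positivity)
  have : (S.card : ℝ) ≤ 2 * (⌊T / δ⌋₊ + 1) := by
    rw [Finset.card_range] at hcard; exact_mod_cast hcard
  linarith

theorem card_cone_le {ι : Type*} (S : Finset ι) (x y z : ι → ℝ) {b₁ b₂ b₃ K : ℝ}
    (hb₁ : 0 < b₁) (hb₂ : 0 < b₂) (hb₃ : 0 < b₃) (hK : 0 < K)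
    (hx : ∀ i ∈ S, 0 ≤ x i ∧ x i ≤ b₁) (hy : ∀ i ∈ S, 0 ≤ y i ∧ y i ≤ b₂)
    (hz : ∀ i ∈ S, 0 < z i ∧ z i ≤ b₃) (hq : ∀ i ∈ S, x i ^ 2 + y i ^ 2 = z i ^ 2)
    (hdet : ∀ i ∈ S, ∀ j ∈ S, ∀ k ∈ S, i ≠ j → i ≠ k → j ≠ k →
      K ≤ |rowDet (x i) (y i) (z i) (x j) (y j) (z j) (x k) (y k) (z k)|) :
    (S.card : ℝ) ≤ 2 + 92 * (b₁ * b₂ * b₃ / K) ^ ((1 : ℝ) / 3) := by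
  rcases le_total b₂ b₁ with h | h
  · exact card_cone_le_of_le S x y z hb₁ hb₂ hb₃ hK h hx hy hz hq hdet
  · rw [mul_comm b₁ b₂]
    refine card_cone_le_of_le S y x z hb₂ hb₁ hb₃ hK h hy hx hz
      (fun i hi => by rw [add_comm]; exact hq i hi) ?_
    intro i hi j hj k hk hij hik hjk
    convert hdet i hi j hj k hk hij hik hjk using 1
    rw [← abs_neg]
    congr 1
    unfold rowDet
    ring

theorem isCoprime_of_dvd_quadratic {m b c y z : ℤ} (hm : m ≠ 0) (hc : IsCoprime c m)
    (hyz : IsCoprime y z) (h : m ∣ b * y ^ 2 + c * z ^ 2) : IsCoprime y m := by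
  refine isCoprime_of_prime_dvd (fun h0 => hm h0.2) fun p hp hpy hpm => ?_
  have h1 : p ∣ c * z ^ 2 :=
    (Int.dvd_add_right (Dvd.dvd.mul_left (dvd_pow hpy two_ne_zero) b)).1 (hpm.trans h)
  rcases hp.dvd_or_dvd h1 with h2 | h2
  · exact hp.not_isUnit (hc.isUnit_of_dvd' h2 hpm)
  · exact hp.not_isUnit (hyz.isUnit_of_dvd' hpy (hp.dvd_of_dvd_pow h2))

/-- If `m = u * v` and `u` is the gcd of `m` with the cross product of two coprime zeros of
`b * y ^ 2 + c * z ^ 2` modulo `m`, then `v` divides the conjugate cross product and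
`gcd u v ∣ 2`. -/
theorem dvd_conjugate_cross {m u v b c y z y₀ z₀ : ℤ} (hm : m ≠ 0) (hb : IsCoprime b m)
    (hc : IsCoprime c m) (hyz : IsCoprime y z) (h : m ∣ b * y ^ 2 + c * z ^ 2)
    (hyz₀ : IsCoprime y₀ z₀) (h₀ : m ∣ b * y₀ ^ 2 + c * z₀ ^ 2) (huv : m = u * v)
    (hu : u = Int.gcd m (y * z₀ - y₀ * z)) :
    v ∣ y * z₀ + y₀ * z ∧ Int.gcd u v ∣ 2 := by
  have hy : IsCoprime y m := isCoprime_of_dvd_quadratic hm hc hyz h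
  have hz₀ : IsCoprime z₀ m :=
    isCoprime_of_dvd_quadratic hm hb hyz₀.symm (by rwa [add_comm])
  have hu0 : u ≠ 0 := by rintro rfl; exact hm (by rw [huv, zero_mul])
  have huA : u ∣ y * z₀ - y₀ * z := hu ▸ Int.gcd_dvd_right _ _
  obtain ⟨A, hA⟩ := huA
  have hAB : m ∣ (y * z₀ - y₀ * z) * (y * z₀ + y₀ * z) := by
    refine hb.symm.dvd_of_dvd_mul_left ?_
    have := dvd_sub (Dvd.dvd.mul_left h (z₀ ^ 2)) (Dvd.dvd.mul_left h₀ (z ^ 2))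
    convert this using 1
    ring
  have hvA : IsCoprime v A := by
    rw [Int.isCoprime_iff_gcd_eq_one]
    rw [hA, huv, Int.gcd_mul_left] at hu
    have hpos : 0 < u.natAbs := Int.natAbs_pos.2 hu0
    have h1 : u.natAbs = u.natAbs * Int.gcd v A := by
      conv_lhs => rw [hu]
      exact Int.natAbs_natCast _
    exact (Nat.eq_of_mul_eq_mul_left hpos (by rw [mul_one]; exact h1)).symm
  have hv : v ∣ y * z₀ + y₀ * z := by
    rw [hA, huv, mul_assoc] at hAB
    exact hvA.dvd_of_dvd_mul_left (Int.dvd_of_mul_dvd_mul_left hu0 hAB)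
  refine ⟨hv, ?_⟩
  have hgu : (Int.gcd u v : ℤ) ∣ u := Int.gcd_dvd_left _ _
  have hgv : (Int.gcd u v : ℤ) ∣ v := Int.gcd_dvd_right _ _
  have hgm : (Int.gcd u v : ℤ) ∣ m := huv ▸ Dvd.dvd.mul_right hgu v
  have h2 : (Int.gcd u v : ℤ) ∣ 2 * (y * z₀) := by
    rw [show 2 * (y * z₀) = (y * z₀ - y₀ * z) + (y * z₀ + y₀ * z) by ring]
    exact dvd_add (hgu.trans ⟨A, hA⟩) (hgv.trans hv)
  exact_mod_cast ((hy.mul_left hz₀).of_isCoprime_of_dvd_right hgm).symm.dvd_of_dvd_mul_right h2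

theorem dvd_two_mul_cross {m u v b c y₀ z₀ y₁ z₁ y₂ z₂ : ℤ} (hm : m ≠ 0) (hb : IsCoprime b m)
    (hc : IsCoprime c m) (hyz₀ : IsCoprime y₀ z₀) (h₀ : m ∣ b * y₀ ^ 2 + c * z₀ ^ 2)
    (hyz₁ : IsCoprime y₁ z₁) (h₁ : m ∣ b * y₁ ^ 2 + c * z₁ ^ 2)
    (hyz₂ : IsCoprime y₂ z₂) (h₂ : m ∣ b * y₂ ^ 2 + c * z₂ ^ 2) (huv : m = u * v)
    (hu₁ : u = Int.gcd m (y₁ * z₀ - y₀ * z₁)) (hu₂ : u = Int.gcd m (y₂ * z₀ - y₀ * z₂)) :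
    m ∣ 2 * (y₁ * z₂ - y₂ * z₁) := by
  obtain ⟨hv₁, hg⟩ := dvd_conjugate_cross hm hb hc hyz₁ h₁ hyz₀ h₀ huv hu₁
  obtain ⟨hv₂, -⟩ := dvd_conjugate_cross hm hb hc hyz₂ h₂ hyz₀ h₀ huv hu₂
  have hA₁ : u ∣ y₁ * z₀ - y₀ * z₁ := hu₁ ▸ Int.gcd_dvd_right _ _
  have hA₂ : u ∣ y₂ * z₀ - y₀ * z₂ := hu₂ ▸ Int.gcd_dvd_right _ _
  have hz₀ : IsCoprime z₀ m :=
    isCoprime_of_dvd_quadratic hm hb hyz₀.symm (by rwa [add_comm])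
  have hum : u ∣ m := ⟨v, huv⟩
  have hvm : v ∣ m := ⟨u, by rw [huv, mul_comm]⟩
  have hu : u ∣ y₁ * z₂ - y₂ * z₁ := by
    refine (hz₀.of_isCoprime_of_dvd_right hum).symm.dvd_of_dvd_mul_left ?_
    convert dvd_sub (Dvd.dvd.mul_right hA₁ z₂) (Dvd.dvd.mul_right hA₂ z₁) using 1
    ring
  have hv : v ∣ y₁ * z₂ - y₂ * z₁ := by
    refine (hz₀.of_isCoprime_of_dvd_right hvm).symm.dvd_of_dvd_mul_left ?_
    convert dvd_sub (Dvd.dvd.mul_right hv₁ z₂) (Dvd.dvd.mul_right hv₂ z₁) using 1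
    ring
  have hgP : m ∣ (Int.gcd u v : ℤ) * (y₁ * z₂ - y₂ * z₁) := by
    rw [Int.gcd_eq_gcd_ab, huv, add_mul]
    refine dvd_add ?_ ?_
    · rw [mul_assoc]
      exact mul_dvd_mul_left u (Dvd.dvd.mul_left hv _)
    · rw [mul_assoc, mul_comm u v]
      exact mul_dvd_mul_left v (Dvd.dvd.mul_left hu _)
  have hg' : (Int.gcd u v : ℤ) ∣ 2 := by exact_mod_cast hg
  exact hgP.trans (mul_dvd_mul_right hg' _)

/-- The primitive zeros of `n * x ^ 2 + b * y ^ 2 + c * z ^ 2` fall into at most `2 * τ(n)` classes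
such that, within one class, the vectors `(y, z)` are proportional modulo `n` up to a factor `2`. -/
theorem exists_class_function {ι : Type*} (S : Set ι) (x y z : ι → ℤ) {n b c : ℤ} (hn : n ≠ 0)
    (hb : IsCoprime b n) (hc : IsCoprime c n)
    (hprim : ∀ i ∈ S, ∀ d, d ∣ x i → d ∣ y i → d ∣ z i → IsUnit d)
    (hsol : ∀ i ∈ S, n * x i ^ 2 + b * y i ^ 2 + c * z i ^ 2 = 0) :
    ∃ f : ι → ℕ × Bool, (∀ i ∈ S, f i ∈ n.natAbs.divisors ×ˢ (Finset.univ : Finset Bool)) ∧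
      ∀ i ∈ S, ∀ j ∈ S, f i = f j → n ∣ 2 * (y i * z j - y j * z i) := by
  have hreduce : ∀ i, ∃ (g : ℕ) (m y' z' : ℤ), i ∈ S → y i = g * y' ∧ z i = g * z' ∧
      n = g ^ 2 * m ∧ IsCoprime y' z' ∧ m ∣ b * y' ^ 2 + c * z' ^ 2 := by
    intro i
    by_cases hi : i ∈ S
    swap
    · exact ⟨0, 0, 0, 0, fun h => absurd h hi⟩
    obtain ⟨g, hg⟩ : ∃ g, g = Int.gcd (y i) (z i) := ⟨_, rfl⟩
    have hgy : (g : ℤ) ∣ y i := hg ▸ Int.gcd_dvd_left _ _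
    have hgz : (g : ℤ) ∣ z i := hg ▸ Int.gcd_dvd_right _ _
    have hgx : IsCoprime (g : ℤ) (x i) := IsRelPrime.isCoprime fun d hdg hdx =>
      hprim i hi d hdx (hdg.trans hgy) (hdg.trans hgz)
    obtain ⟨y', hy'⟩ := hgy
    obtain ⟨z', hz'⟩ := hgz
    have hsq : (g : ℤ) ^ 2 ∣ n := by
      refine (hgx.pow (m := 2) (n := 2)).dvd_of_dvd_mul_right ⟨-(b * y' ^ 2 + c * z' ^ 2), ?_⟩
      have := hsol i hi
      rw [hy', hz'] at this
      linear_combination this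
    obtain ⟨m, hm⟩ := hsq
    have hg0 : (g : ℤ) ≠ 0 := by
      intro h0
      exact hn (by rw [hm, h0]; ring)
    refine ⟨g, m, y', z', fun _ => ⟨hy', hz', hm, ?_, -x i ^ 2, ?_⟩⟩
    · rw [Int.isCoprime_iff_gcd_eq_one]
      rw [hy', hz', Int.gcd_mul_left, Int.natAbs_natCast] at hg
      exact (Nat.eq_of_mul_eq_mul_left (by exact_mod_cast Nat.pos_of_ne_zero (by exact_mod_cast hg0))
        (by rw [mul_one]; exact hg)).symm
    · have := hsol i hi
      rw [hy', hz', hm] at this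
      refine mul_left_cancel₀ (pow_ne_zero 2 hg0) ?_
      linear_combination this
  choose g m y' z' hred using hreduce
  have href : ∀ d : ℕ, ∃ k : ι → ι, ∀ i ∈ S, g i = d → k i ∈ S ∧ g (k i) = d ∧
      ∀ j, k i = k j := by
    intro d
    by_cases h : ∃ i ∈ S, g i = d
    · obtain ⟨i₀, hi₀, hd⟩ := h
      exact ⟨fun _ => i₀, fun _ _ _ => ⟨hi₀, hd, fun _ => rfl⟩⟩
    · exact ⟨id, fun i hi hd => absurd ⟨i, hi, hd⟩ h⟩
  choose k hk using href
  have hm0 : ∀ i ∈ S, m i ≠ 0 := fun i hi h0 => hn (by rw [(hred i hi).2.2.1, h0, mul_zero])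
  have hg0 : ∀ i ∈ S, g i ≠ 0 := fun i hi h0 => hn (by rw [(hred i hi).2.2.1, h0]; simp)
  have hmn : ∀ i ∈ S, m i ∣ n := fun i hi => ⟨g i ^ 2, by rw [(hred i hi).2.2.1]; ring⟩
  have hmeq : ∀ i ∈ S, ∀ j ∈ S, g i = g j → m i = m j := by
    intro i hi j hj hij
    have h1 := (hred i hi).2.2.1
    rw [(hred j hj).2.2.1, hij] at h1
    exact (mul_left_cancel₀ (pow_ne_zero 2 (by exact_mod_cast hg0 j hj)) h1).symm
  obtain ⟨u, hu⟩ : ∃ u : ι → ℕ, ∀ i, u i =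
      Int.gcd (m i) (y' i * z' (k (g i) i) - y' (k (g i) i) * z' i) := ⟨_, fun _ => rfl⟩
  have hquot : ∀ i, ∃ v : ℤ, m i = u i * v := fun i => by
    rw [hu]; exact Int.gcd_dvd_left _ _
  choose v hv using hquot
  have hε : ∀ i ∈ S, Int.gcd (u i) (v i) ∣ 2 := by
    intro i hi
    obtain ⟨hkS, hkg, -⟩ := hk (g i) i hi rfl
    obtain ⟨-, -, -, cop, dv⟩ := hred i hi
    obtain ⟨-, -, -, copk, dvk⟩ := hred _ hkS
    rw [hmeq _ hkS _ hi hkg] at dvk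
    exact (dvd_conjugate_cross (hm0 i hi) (hb.of_isCoprime_of_dvd_right (hmn i hi))
      (hc.of_isCoprime_of_dvd_right (hmn i hi)) cop dv copk dvk (hv i) (by rw [hu])).2
  have hn_eq : ∀ i ∈ S, n.natAbs = g i * u i * (g i * (v i).natAbs) := by
    intro i hi
    rw [(hred i hi).2.2.1, hv i]
    simp only [Int.natAbs_mul, Int.natAbs_pow, Int.natAbs_natCast]
    ring
  refine ⟨fun i => (g i * u i, decide (Int.gcd (u i) (v i) = 1)), ?_, ?_⟩
  · intro i hi
    simp only [Finset.mem_product, Finset.mem_univ, and_true, Nat.mem_divisors]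
    exact ⟨⟨_, hn_eq i hi⟩, Int.natAbs_ne_zero.2 hn⟩
  · intro i hi j hj hij
    simp only [Prod.mk.injEq, decide_eq_decide] at hij
    obtain ⟨hD, hbool⟩ := hij
    have hD0 : g i * u i ≠ 0 := by
      intro h0
      have := hn_eq i hi
      rw [h0, zero_mul] at this
      exact Int.natAbs_ne_zero.2 hn this
    have hcof : g i * (v i).natAbs = g j * (v j).natAbs := by
      have := hn_eq i hi
      rw [hn_eq j hj, ← hD] at this
      exact (Nat.eq_of_mul_eq_mul_left (Nat.pos_of_ne_zero hD0) this).symm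
    have hgcd : ∀ i, Nat.gcd (g i * u i) (g i * (v i).natAbs) = g i * Int.gcd (u i) (v i) := by
      intro i
      rw [Nat.gcd_mul_left, Int.gcd_def, Int.natAbs_natCast]
    have hgε : g i * Int.gcd (u i) (v i) = g j * Int.gcd (u j) (v j) := by
      rw [← hgcd, ← hgcd, hD, hcof]
    have hεeq : Int.gcd (u i) (v i) = Int.gcd (u j) (v j) := by
      rcases (Nat.dvd_prime Nat.prime_two).1 (hε i hi) with h | h <;>
        rcases (Nat.dvd_prime Nat.prime_two).1 (hε j hj) with h' | h' <;> omega
    have hεpos : 0 < Int.gcd (u j) (v j) := Nat.pos_of_dvd_of_pos (hε j hj) two_pos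
    have hgij : g i = g j := Nat.eq_of_mul_eq_mul_right hεpos (by rw [← hgε, hεeq])
    have huij : u i = u j := by
      rw [hgij] at hD
      exact Nat.eq_of_mul_eq_mul_left (Nat.pos_of_ne_zero (hg0 j hj)) hD
    have hmij := hmeq i hi j hj hgij
    obtain ⟨hkS, hkg, hkc⟩ := hk (g i) i hi rfl
    obtain ⟨yi, zi, ni, copi, dvi⟩ := hred i hi
    obtain ⟨yj, zj, -, copj, dvj⟩ := hred j hj
    obtain ⟨-, -, -, copk, dvk⟩ := hred _ hkS
    rw [hmeq _ hkS _ hi hkg] at dvk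
    rw [← hmij] at dvj
    have hkey := dvd_two_mul_cross (hm0 i hi) (hb.of_isCoprime_of_dvd_right (hmn i hi))
      (hc.of_isCoprime_of_dvd_right (hmn i hi)) copk dvk copi dvi copj dvj (hv i) (by rw [hu])
      (by rw [huij, hu, hmij, hkc j, hgij])
    rw [yi, zi, yj, zj, ← hgij, ni]
    rw [show 2 * (g i * y' i * (g i * z' j) - g i * y' j * (g i * z' i)) =
      (g i : ℤ) ^ 2 * (2 * (y' i * z' j - y' j * z' i)) by ring]
    exact mul_dvd_mul_left _ hkey

theorem natAbs_eq_of_proportional {x y z x' y' z' : ℤ}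
    (h : ∀ d, d ∣ x → d ∣ y → d ∣ z → IsUnit d) (h' : ∀ d, d ∣ x' → d ∣ y' → d ∣ z' → IsUnit d)
    (hz : z ≠ 0) (hxz : |x| * |z'| = |x'| * |z|) (hyz : |y| * |z'| = |y'| * |z|) :
    |x| = |x'| ∧ |y| = |y'| ∧ |z| = |z'| := by
  have hgcd : ∀ {x y z : ℤ}, (∀ d, d ∣ x → d ∣ y → d ∣ z → IsUnit d) →
      Nat.gcd (Nat.gcd x.natAbs y.natAbs) z.natAbs = 1 := by
    intro x y z h
    have hd := h (Nat.gcd (Nat.gcd x.natAbs y.natAbs) z.natAbs : ℕ)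
      (Int.natCast_dvd.2 ((Nat.gcd_dvd_left _ _).trans (Nat.gcd_dvd_left _ _)))
      (Int.natCast_dvd.2 ((Nat.gcd_dvd_left _ _).trans (Nat.gcd_dvd_right _ _)))
      (Int.natCast_dvd.2 (Nat.gcd_dvd_right _ _))
    exact Nat.isUnit_iff.1 (by simpa [Int.isUnit_iff_natAbs_eq] using hd)
  simp only [Int.abs_eq_natAbs] at hxz hyz ⊢
  norm_cast at hxz hyz ⊢
  have e : z'.natAbs = z.natAbs := by
    calc z'.natAbs = Nat.gcd (Nat.gcd x.natAbs y.natAbs) z.natAbs * z'.natAbs := by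
          rw [hgcd h, one_mul]
      _ = Nat.gcd (Nat.gcd x'.natAbs y'.natAbs) z'.natAbs * z.natAbs := by
          rw [← Nat.gcd_mul_right, ← Nat.gcd_mul_right, hxz, hyz, ← Nat.gcd_mul_right,
            ← Nat.gcd_mul_right, mul_comm z.natAbs]
      _ = z.natAbs := by rw [hgcd h', one_mul]
  have hz0 : 0 < z.natAbs := Int.natAbs_pos.2 hz
  rw [e] at hxz hyz
  exact ⟨Nat.eq_of_mul_eq_mul_right hz0 hxz, Nat.eq_of_mul_eq_mul_right hz0 hyz, e.symm⟩

/-- Primitive zeros in a box, of fixed sign pattern and lying in one lattice class. -/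
theorem card_class_le {ι : Type*} (S : Finset ι) (x y z : ι → ℤ) {a b c : ℤ} {A B C : ℝ}
    (hab : 0 < a * b) (hc : c ≠ 0) (hA : 0 < A) (hB : 0 < B) (hC : 0 < C)
    (hxA : ∀ i ∈ S, |(x i : ℝ)| ≤ A) (hyB : ∀ i ∈ S, |(y i : ℝ)| ≤ B)
    (hzC : ∀ i ∈ S, |(z i : ℝ)| ≤ C)
    (hsol : ∀ i ∈ S, a * x i ^ 2 + b * y i ^ 2 + c * z i ^ 2 = 0)
    (hprim : ∀ i ∈ S, ∀ d, d ∣ x i → d ∣ y i → d ∣ z i → IsUnit d)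
    (hinj : ∀ i ∈ S, ∀ j ∈ S, x i = x j → y i = y j → z i = z j → i = j)
    (hx : ∀ i ∈ S, ∀ j ∈ S, 0 ≤ x i ↔ 0 ≤ x j) (hy : ∀ i ∈ S, ∀ j ∈ S, 0 ≤ y i ↔ 0 ≤ y j)
    (hz : ∀ i ∈ S, ∀ j ∈ S, 0 ≤ z i ↔ 0 ≤ z j)
    (hdvd : ∀ i ∈ S, ∀ j ∈ S, ∀ k ∈ S,
      a * b * c ∣ 2 * rowDet (x i) (y i) (z i) (x j) (y j) (z j) (x k) (y k) (z k)) :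
    (S.card : ℝ) ≤ 2 + 92 * (2 * (A * B * C / |((a * b * c : ℤ) : ℝ)|)) ^ ((1 : ℝ) / 3) := by
  have ha : a ≠ 0 := by rintro rfl; simp at hab
  have hb : b ≠ 0 := by rintro rfl; simp at hab
  obtain ⟨p, hp⟩ : ∃ p, p = √|(a : ℝ)| := ⟨_, rfl⟩
  obtain ⟨q, hq⟩ : ∃ q, q = √|(b : ℝ)| := ⟨_, rfl⟩
  obtain ⟨r, hr⟩ : ∃ r, r = √|(c : ℝ)| := ⟨_, rfl⟩
  have hp2 : p ^ 2 = |(a : ℝ)| := by rw [hp]; exact Real.sq_sqrt (abs_nonneg _)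
  have hq2 : q ^ 2 = |(b : ℝ)| := by rw [hq]; exact Real.sq_sqrt (abs_nonneg _)
  have hr2 : r ^ 2 = |(c : ℝ)| := by rw [hr]; exact Real.sq_sqrt (abs_nonneg _)
  have hp0 : 0 < p := by rw [hp]; exact Real.sqrt_pos.2 (abs_pos.2 (by exact_mod_cast ha))
  have hq0 : 0 < q := by rw [hq]; exact Real.sqrt_pos.2 (abs_pos.2 (by exact_mod_cast hb))
  have hr0 : 0 < r := by rw [hr]; exact Real.sqrt_pos.2 (abs_pos.2 (by exact_mod_cast hc))
  have habs : |((a * b * c : ℤ) : ℝ)| = (p * q * r) ^ 2 := by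
    push_cast
    rw [abs_mul, abs_mul, ← hp2, ← hq2, ← hr2]
    ring
  have hz0 : ∀ i ∈ S, z i ≠ 0 := by
    intro i hi h0
    have h := hsol i hi
    rw [h0] at h
    have h1 : (a * x i) ^ 2 + a * b * y i ^ 2 = 0 := by linear_combination a * h
    have h2 : 0 ≤ a * b * y i ^ 2 := by positivity
    have h3 : a * b * y i ^ 2 = 0 := by nlinarith [sq_nonneg (a * x i)]
    have h4 : y i = 0 := by simpa [hab.ne', ha, hb] using h3
    have h5 : x i = 0 := by
      rw [h3, add_zero] at h1
      simpa [ha] using h1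
    exact not_isUnit_zero (hprim i hi 0 (by simp [h5]) (by simp [h4]) (by simp [h0]))
  have hcone : ∀ i ∈ S, (p * |(x i : ℝ)|) ^ 2 + (q * |(y i : ℝ)|) ^ 2 = (r * |(z i : ℝ)|) ^ 2 := by
    intro i hi
    simp only [mul_pow, sq_abs, hp2, hq2, hr2]
    have h : (a : ℝ) * (x i : ℝ) ^ 2 + b * (y i : ℝ) ^ 2 + c * (z i : ℝ) ^ 2 = 0 := by
      exact_mod_cast hsol i hi
    have hzpos : 0 < (z i : ℝ) ^ 2 := by
      have : (z i : ℝ) ≠ 0 := by exact_mod_cast hz0 i hi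
      positivity
    rcases pos_and_pos_or_neg_and_neg_of_mul_pos hab with ⟨ha', hb'⟩ | ⟨ha', hb'⟩
    · have ha'' : (0 : ℝ) < a := by exact_mod_cast ha'
      have hb'' : (0 : ℝ) < b := by exact_mod_cast hb'
      have hc'' : (c : ℝ) < 0 := by
        by_contra! hcn
        have h1 : (c : ℝ) ≠ 0 := by exact_mod_cast hc
        have h2 : 0 < (c : ℝ) := lt_of_le_of_ne hcn h1.symm
        have : 0 < (a : ℝ) * (x i : ℝ) ^ 2 + b * (y i : ℝ) ^ 2 + c * (z i : ℝ) ^ 2 := by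
          positivity
        linarith
      rw [abs_of_pos ha'', abs_of_pos hb'', abs_of_neg hc'']
      linarith
    · have ha'' : (a : ℝ) < 0 := by exact_mod_cast ha'
      have hb'' : (b : ℝ) < 0 := by exact_mod_cast hb'
      have hc'' : 0 < (c : ℝ) := by
        by_contra! hcn
        have h1 : (c : ℝ) ≠ 0 := by exact_mod_cast hc
        have h2 : (c : ℝ) < 0 := lt_of_le_of_ne hcn h1
        have := mul_neg_of_neg_of_pos h2 hzpos
        have := mul_nonpos_of_nonpos_of_nonneg ha''.le (sq_nonneg (x i : ℝ))
        have := mul_nonpos_of_nonpos_of_nonneg hb''.le (sq_nonneg (y i : ℝ))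
        linarith
      rw [abs_of_neg ha'', abs_of_neg hb'', abs_of_pos hc'']
      linarith
  have hsign : ∀ w : ι → ℤ, (∀ i ∈ S, ∀ j ∈ S, 0 ≤ w i ↔ 0 ≤ w j) →
      ∃ ε : ℝ, |ε| = 1 ∧ ∀ i ∈ S, |(w i : ℝ)| = ε * w i := by
    intro w hw
    by_cases h : ∀ i ∈ S, 0 ≤ w i
    · exact ⟨1, abs_one, fun i hi => by
        rw [one_mul, abs_of_nonneg (by exact_mod_cast h i hi)]⟩
    · push Not at h
      obtain ⟨i₀, hi₀, hneg⟩ := h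
      refine ⟨-1, by simp, fun i hi => ?_⟩
      have : w i < 0 := by
        by_contra! hge
        exact absurd ((hw i hi i₀ hi₀).1 hge) (not_le.2 hneg)
      rw [abs_of_neg (by exact_mod_cast this), neg_one_mul]
  obtain ⟨ε₁, hε₁, hxε⟩ := hsign x hx
  obtain ⟨ε₂, hε₂, hyε⟩ := hsign y hy
  obtain ⟨ε₃, hε₃, hzε⟩ := hsign z hz
  have hε0 : ∀ {ε : ℝ}, |ε| = 1 → ε ≠ 0 := by
    rintro ε h rfl
    simp at h
  have hprop : ∀ i ∈ S, ∀ j ∈ S, i ≠ j →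
      ¬ (p * |(x i : ℝ)| * (r * |(z j : ℝ)|) = p * |(x j : ℝ)| * (r * |(z i : ℝ)|) ∧
        q * |(y i : ℝ)| * (r * |(z j : ℝ)|) = q * |(y j : ℝ)| * (r * |(z i : ℝ)|)) := by
    rintro i hi j hj hij ⟨h1, h2⟩
    have e1 : |(x i : ℝ)| * |(z j : ℝ)| = |(x j : ℝ)| * |(z i : ℝ)| :=
      mul_left_cancel₀ (mul_pos hp0 hr0).ne' (by linear_combination h1)
    have e2 : |(y i : ℝ)| * |(z j : ℝ)| = |(y j : ℝ)| * |(z i : ℝ)| :=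
      mul_left_cancel₀ (mul_pos hq0 hr0).ne' (by linear_combination h2)
    obtain ⟨f1, f2, f3⟩ := natAbs_eq_of_proportional (hprim i hi) (hprim j hj) (hz0 i hi)
      (by exact_mod_cast e1) (by exact_mod_cast e2)
    have hback : ∀ {w : ι → ℤ} {ε : ℝ}, |ε| = 1 → (∀ i ∈ S, |(w i : ℝ)| = ε * w i) →
        |w i| = |w j| → w i = w j := by
      intro w ε hε hw h
      have h' : |(w i : ℝ)| = |(w j : ℝ)| := by exact_mod_cast h
      rw [hw i hi, hw j hj] at h'
      exact_mod_cast mul_left_cancel₀ (hε0 hε) h'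
    exact hij (hinj i hi j hj (hback hε₁ hxε f1) (hback hε₂ hyε f2) (hback hε₃ hzε f3))
  have hzpos : ∀ i ∈ S, 0 < r * |(z i : ℝ)| := fun i hi =>
    mul_pos hr0 (abs_pos.2 (by exact_mod_cast hz0 i hi))
  have hmain := card_cone_le S (fun i => p * |(x i : ℝ)|) (fun i => q * |(y i : ℝ)|)
    (fun i => r * |(z i : ℝ)|) (b₁ := p * A) (b₂ := q * B) (b₃ := r * C)
    (K := (p * q * r) ^ 3 / 2) (by positivity) (by positivity) (by positivity) (by positivity)
    (fun i hi => ⟨by positivity, by gcongr; exact hxA i hi⟩)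
    (fun i hi => ⟨by positivity, by gcongr; exact hyB i hi⟩)
    (fun i hi => ⟨hzpos i hi, by gcongr; exact hzC i hi⟩) hcone ?_
  · convert hmain using 4
    rw [habs]
    field_simp
  · intro i hi j hj k hk hij hik hjk
    have hne := rowDet_cone_ne_zero (by positivity) (by positivity) (hzpos i hi) (hcone i hi)
      (by positivity) (by positivity) (hzpos j hj) (hcone j hj)
      (by positivity) (by positivity) (hzpos k hk) (hcone k hk)
      (hprop i hi j hj hij) (hprop j hj k hk hjk) (hprop i hi k hk hik)
    obtain ⟨Δ, hΔ⟩ : ∃ Δ, Δ = rowDet (x i) (y i) (z i) (x j) (y j) (z j) (x k) (y k) (z k) :=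
      ⟨_, rfl⟩
    have heq : rowDet (p * |(x i : ℝ)|) (q * |(y i : ℝ)|) (r * |(z i : ℝ)|)
        (p * |(x j : ℝ)|) (q * |(y j : ℝ)|) (r * |(z j : ℝ)|)
        (p * |(x k : ℝ)|) (q * |(y k : ℝ)|) (r * |(z k : ℝ)|) =
        p * q * r * (ε₁ * ε₂ * ε₃) * (Δ : ℝ) := by
      rw [hxε i hi, hxε j hj, hxε k hk, hyε i hi, hyε j hj, hyε k hk, hzε i hi, hzε j hj,
        hzε k hk, hΔ]
      unfold rowDet
      push_cast
      ring
    rw [heq] at hne ⊢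
    have hΔ0 : Δ ≠ 0 := by
      rintro h0
      simp [h0] at hne
    have hdiv := hdvd i hi j hj k hk
    rw [← hΔ] at hdiv
    have hle : (p * q * r) ^ 2 ≤ 2 * |(Δ : ℝ)| := by
      have h1 : |a * b * c| ≤ |2 * Δ| := Int.le_of_dvd (by positivity) ((abs_dvd_abs _ _).2 hdiv)
      have h2 : |((a * b * c : ℤ) : ℝ)| ≤ |((2 * Δ : ℤ) : ℝ)| := by exact_mod_cast h1
      rw [habs] at h2
      push_cast at h2
      rwa [abs_mul, abs_two] at h2
    rw [abs_mul, abs_mul, abs_mul (ε₁ * ε₂), abs_mul ε₁, hε₁, hε₂, hε₃,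
      abs_of_pos (by positivity)]
    have : 0 < p * q * r := by positivity
    nlinarith

theorem exists_pos_mul {a b c : ℤ} (ha : a ≠ 0) (hb : b ≠ 0) (hc : c ≠ 0) :
    0 < a * b ∨ 0 < b * c ∨ 0 < a * c := by
  rcases lt_or_gt_of_ne ha with ha | ha <;> rcases lt_or_gt_of_ne hb with hb | hb <;>
    rcases lt_or_gt_of_ne hc with hc | hc <;>
    simp [mul_pos_of_neg_of_neg, ha, hb, hc]

theorem card_primitive_zeros_le (a : Fin 3 → ℤ) (ha : ∀ i, a i ≠ 0)
    (hcop : ∀ i j, i ≠ j → IsCoprime (a i) (a j)) (B : Fin 3 → ℝ) (hB : ∀ i, 0 < B i)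
    (S : Finset (Fin 3 → ℤ))
    (hprim : ∀ x ∈ S, ∀ d, d ∣ x 0 → d ∣ x 1 → d ∣ x 2 → IsUnit d)
    (hsol : ∀ x ∈ S, a 0 * x 0 ^ 2 + a 1 * x 1 ^ 2 + a 2 * x 2 ^ 2 = 0)
    (hbox : ∀ x ∈ S, ∀ i, |(x i : ℝ)| ≤ B i) :
    (S.card : ℝ) ≤ 64 * (a 0 * a 1 * a 2).natAbs.divisors.card *
      (2 + 92 * (2 * (B 0 * B 1 * B 2 / |((a 0 * a 1 * a 2 : ℤ) : ℝ)|)) ^ ((1 : ℝ) / 3)) := by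
  obtain ⟨f₀, hf₀, hd₀⟩ := exists_class_function (S : Set (Fin 3 → ℤ)) (fun x => x 0)
    (fun x => x 1) (fun x => x 2) (ha 0) (hcop 1 0 (by decide)) (hcop 2 0 (by decide)) hprim hsol
  obtain ⟨f₁, hf₁, hd₁⟩ := exists_class_function (S : Set (Fin 3 → ℤ)) (fun x => x 1)
    (fun x => x 0) (fun x => x 2) (ha 1) (hcop 0 1 (by decide)) (hcop 2 1 (by decide))
    (fun x hx d h1 h0 h2 => hprim x hx d h0 h1 h2)
    (fun x hx => by linear_combination hsol x hx)
  obtain ⟨f₂, hf₂, hd₂⟩ := exists_class_function (S : Set (Fin 3 → ℤ)) (fun x => x 2)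
    (fun x => x 0) (fun x => x 1) (ha 2) (hcop 0 2 (by decide)) (hcop 1 2 (by decide))
    (fun x hx d h2 h0 h1 => hprim x hx d h0 h1 h2)
    (fun x hx => by linear_combination hsol x hx)
  obtain ⟨M, hM⟩ : ∃ M, M = 2 + 92 * (2 * (B 0 * B 1 * B 2 /
    |((a 0 * a 1 * a 2 : ℤ) : ℝ)|)) ^ ((1 : ℝ) / 3) := ⟨_, rfl⟩
  have hpos : 0 < B 0 * B 1 * B 2 := mul_pos (mul_pos (hB 0) (hB 1)) (hB 2)
  have hM0 : 0 ≤ M := by rw [hM]; positivity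
  have hcard : S.card ≤ ⌊M⌋₊ * (((a 0).natAbs.divisors ×ˢ (Finset.univ : Finset Bool)) ×ˢ
      ((a 1).natAbs.divisors ×ˢ (Finset.univ : Finset Bool)) ×ˢ
      ((a 2).natAbs.divisors ×ˢ (Finset.univ : Finset Bool)) ×ˢ
      (Finset.univ : Finset (Bool × Bool × Bool))).card := by
    refine Finset.card_le_mul_card_image_of_maps_to (f := fun x => (f₀ x, f₁ x, f₂ x,
      (decide (0 ≤ x 0), decide (0 ≤ x 1), decide (0 ≤ x 2)))) ?_ _ ?_
    · intro x hx
      exact Finset.mk_mem_product (hf₀ x hx) (Finset.mk_mem_product (hf₁ x hx)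
        (Finset.mk_mem_product (hf₂ x hx) (Finset.mem_univ _)))
    · intro t _
      refine Nat.le_floor ?_
      rw [hM]
      generalize hF : S.filter (fun x => (f₀ x, f₁ x, f₂ x,
        (decide (0 ≤ x 0), decide (0 ≤ x 1), decide (0 ≤ x 2))) = t) = F
      have hFS : ∀ x ∈ F, x ∈ S := by
        intro x hx
        rw [← hF] at hx
        exact (Finset.mem_filter.1 hx).1
      have hFe : ∀ x ∈ F, ∀ y ∈ F, f₀ x = f₀ y ∧ f₁ x = f₁ y ∧ f₂ x = f₂ y ∧
          (0 ≤ x 0 ↔ 0 ≤ y 0) ∧ (0 ≤ x 1 ↔ 0 ≤ y 1) ∧ (0 ≤ x 2 ↔ 0 ≤ y 2) := by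
        intro x hx y hy
        rw [← hF] at hx hy
        have := (Finset.mem_filter.1 hx).2.trans (Finset.mem_filter.1 hy).2.symm
        simpa only [Prod.mk.injEq, decide_eq_decide] using this
      have hdvd : ∀ x ∈ F, ∀ y ∈ F, ∀ w ∈ F, a 0 * a 1 * a 2 ∣
          2 * rowDet (x 0) (x 1) (x 2) (y 0) (y 1) (y 2) (w 0) (w 1) (w 2) := by
        intro x hx y hy w hw
        refine IsCoprime.mul_dvd ((hcop 0 2 (by decide)).mul_left (hcop 1 2 (by decide)))
          (IsCoprime.mul_dvd (hcop 0 1 (by decide)) ?_ ?_) ?_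
        · have h1 := hd₀ y (hFS y hy) w (hFS w hw) (hFe y hy w hw).1
          have h2 := hd₀ x (hFS x hx) w (hFS w hw) (hFe x hx w hw).1
          have h3 := hd₀ x (hFS x hx) y (hFS y hy) (hFe x hx y hy).1
          convert dvd_add (dvd_sub (Dvd.dvd.mul_left h1 (x 0)) (Dvd.dvd.mul_left h2 (y 0)))
            (Dvd.dvd.mul_left h3 (w 0)) using 1
          unfold rowDet
          ring
        · have h1 := hd₁ y (hFS y hy) w (hFS w hw) (hFe y hy w hw).2.1
          have h2 := hd₁ x (hFS x hx) w (hFS w hw) (hFe x hx w hw).2.1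
          have h3 := hd₁ x (hFS x hx) y (hFS y hy) (hFe x hx y hy).2.1
          convert dvd_sub (dvd_sub (Dvd.dvd.mul_left h2 (y 1)) (Dvd.dvd.mul_left h1 (x 1)))
            (Dvd.dvd.mul_left h3 (w 1)) using 1
          unfold rowDet
          ring
        · have h1 := hd₂ y (hFS y hy) w (hFS w hw) (hFe y hy w hw).2.2.1
          have h2 := hd₂ x (hFS x hx) w (hFS w hw) (hFe x hx w hw).2.2.1
          have h3 := hd₂ x (hFS x hx) y (hFS y hy) (hFe x hx y hy).2.2.1
          convert dvd_add (dvd_sub (Dvd.dvd.mul_left h1 (x 2)) (Dvd.dvd.mul_left h2 (y 2)))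
            (Dvd.dvd.mul_left h3 (w 2)) using 1
          unfold rowDet
          ring
      have hext : ∀ x y : Fin 3 → ℤ, x 0 = y 0 → x 1 = y 1 → x 2 = y 2 → x = y := by
        intro x y h0 h1 h2
        ext i
        fin_cases i <;> assumption
      rcases exists_pos_mul (ha 0) (ha 1) (ha 2) with h | h | h
      · exact card_class_le F (fun x => x 0) (fun x => x 1) (fun x => x 2) h (ha 2)
          (hB 0) (hB 1) (hB 2) (fun x hx => hbox x (hFS x hx) 0)
          (fun x hx => hbox x (hFS x hx) 1) (fun x hx => hbox x (hFS x hx) 2)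
          (fun x hx => hsol x (hFS x hx)) (fun x hx => hprim x (hFS x hx))
          (fun x _ y _ => hext x y)
          (fun x hx y hy => (hFe x hx y hy).2.2.2.1)
          (fun x hx y hy => (hFe x hx y hy).2.2.2.2.1)
          (fun x hx y hy => (hFe x hx y hy).2.2.2.2.2) hdvd
      · rw [show a 0 * a 1 * a 2 = a 1 * a 2 * a 0 by ring,
          show B 0 * B 1 * B 2 = B 1 * B 2 * B 0 by ring]
        refine card_class_le F (fun x => x 1) (fun x => x 2) (fun x => x 0) h (ha 0)
          (hB 1) (hB 2) (hB 0) (fun x hx => hbox x (hFS x hx) 1)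
          (fun x hx => hbox x (hFS x hx) 2) (fun x hx => hbox x (hFS x hx) 0)
          (fun x hx => by linear_combination hsol x (hFS x hx))
          (fun x hx d h1 h2 h0 => hprim x (hFS x hx) d h0 h1 h2)
          (fun x _ y _ h1 h2 h0 => hext x y h0 h1 h2)
          (fun x hx y hy => (hFe x hx y hy).2.2.2.2.1)
          (fun x hx y hy => (hFe x hx y hy).2.2.2.2.2)
          (fun x hx y hy => (hFe x hx y hy).2.2.2.1) fun x hx y hy w hw => ?_
        convert hdvd x hx y hy w hw using 1
        · ring
        · unfold rowDet; ring
      · rw [show a 0 * a 1 * a 2 = a 0 * a 2 * a 1 by ring,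
          show B 0 * B 1 * B 2 = B 0 * B 2 * B 1 by ring]
        refine card_class_le F (fun x => x 0) (fun x => x 2) (fun x => x 1) h (ha 1)
          (hB 0) (hB 2) (hB 1) (fun x hx => hbox x (hFS x hx) 0)
          (fun x hx => hbox x (hFS x hx) 2) (fun x hx => hbox x (hFS x hx) 1)
          (fun x hx => by linear_combination hsol x (hFS x hx))
          (fun x hx d h0 h2 h1 => hprim x (hFS x hx) d h0 h1 h2)
          (fun x _ y _ h0 h2 h1 => hext x y h0 h1 h2)
          (fun x hx y hy => (hFe x hx y hy).2.2.2.1)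
          (fun x hx y hy => (hFe x hx y hy).2.2.2.2.2)
          (fun x hx y hy => (hFe x hx y hy).2.2.2.2.1) fun x hx y hy w hw => ?_
        have hswap : -(2 * rowDet (x 0) (x 1) (x 2) (y 0) (y 1) (y 2) (w 0) (w 1) (w 2)) =
            2 * rowDet (x 0) (x 2) (x 1) (y 0) (y 2) (y 1) (w 0) (w 2) (w 1) := by
          unfold rowDet; ring
        rw [mul_right_comm]
        exact (dvd_neg.2 (hdvd x hx y hy w hw)).trans (dvd_of_eq hswap)
  have hτ : (a 0 * a 1 * a 2).natAbs.divisors.card =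
      (a 0).natAbs.divisors.card * (a 1).natAbs.divisors.card * (a 2).natAbs.divisors.card := by
    have hnat : ∀ i j, i ≠ j → (a i).natAbs.Coprime (a j).natAbs := fun i j hij =>
      Int.isCoprime_iff_gcd_eq_one.1 (hcop i j hij)
    rw [Int.natAbs_mul, Int.natAbs_mul, Nat.Coprime.card_divisors_mul
      (Nat.Coprime.mul_left (hnat 0 2 (by decide)) (hnat 1 2 (by decide))),
      Nat.Coprime.card_divisors_mul (hnat 0 1 (by decide))]
  simp only [Finset.card_product, Finset.card_univ, Fintype.card_prod, Fintype.card_bool] at hcard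
  rw [← hM]
  calc (S.card : ℝ) ≤ (⌊M⌋₊ : ℝ) * (64 * (a 0 * a 1 * a 2).natAbs.divisors.card) := by
        rw [hτ]
        have := (Nat.cast_le (α := ℝ)).2 hcard
        push_cast at this ⊢
        linarith
    _ ≤ M * (64 * (a 0 * a 1 * a 2).natAbs.divisors.card) := by
        gcongr
        exact Nat.floor_le hM0
    _ = _ := by ring

theorem natCard_subtype_le {α : Type*} (p : α → Prop) {M : ℝ} (hM : 0 ≤ M)
    (h : ∀ S : Finset α, (∀ x ∈ S, p x) → (S.card : ℝ) ≤ M) :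
    (Nat.card {x // p x} : ℝ) ≤ M := by
  rcases finite_or_infinite {x // p x} with hfin | hinf
  · have hfin' : {x | p x}.Finite := hfin
    have := h hfin'.toFinset fun x hx => by simpa using hx
    rwa [← Set.ncard_eq_toFinset_card _ hfin', ← Nat.card_coe_set_eq] at this
  · simpa using hM

theorem stmt_11 :
    ∃ C : ℝ, ∀ (a : Fin 3 → ℤ),
      Finset.gcd Finset.univ (fun i => (a i).natAbs) = 1 →
      (∀ i, a i ≠ 0) →
      (∀ i j, i ≠ j → IsCoprime (a i) (a j)) →
      ∀ (B : Fin 3 → ℝ), (∀ i, 0 < B i) →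
      (Nat.card {x : Fin 3 → ℤ //
          Finset.gcd Finset.univ (fun i => (x i).natAbs) = 1 ∧
          (∑ i, a i * x i ^ 2 = 0) ∧ ∀ i, |(x i : ℝ)| ≤ B i} : ℝ)
        ≤ C * (1 + (B 0 * B 1 * B 2) / |((a 0 * a 1 * a 2 : ℤ) : ℝ)|) ^ ((1 : ℝ) / 3) *
            ((a 0 * a 1 * a 2).natAbs.divisors.card : ℝ) := by
  refine ⟨64 * 186, fun a _ ha hcop B hB => ?_⟩
  have hpos : 0 < B 0 * B 1 * B 2 := mul_pos (mul_pos (hB 0) (hB 1)) (hB 2)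
  obtain ⟨V, hV⟩ : ∃ V, V = B 0 * B 1 * B 2 / |((a 0 * a 1 * a 2 : ℤ) : ℝ)| := ⟨_, rfl⟩
  have hV0 : 0 ≤ V := by rw [hV]; positivity
  rw [← hV]
  refine natCard_subtype_le _ (by positivity) fun S hmem => ?_
  have hcard := card_primitive_zeros_le a ha hcop B hB S ?_ ?_
    (fun x hx => (hmem x hx).2.2)
  · rw [← hV] at hcard
    have h1 : (1 : ℝ) ≤ (1 + V) ^ ((1 : ℝ) / 3) := Real.one_le_rpow (by linarith) (by norm_num)
    have h2 : (2 * V) ^ ((1 : ℝ) / 3) ≤ 2 * (1 + V) ^ ((1 : ℝ) / 3) := by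
      have h8 : (8 : ℝ) ^ ((1 : ℝ) / 3) = 2 := by
        rw [show (8 : ℝ) = 2 ^ (3 : ℝ) by norm_num, ← Real.rpow_mul (by norm_num)]
        norm_num
      calc (2 * V) ^ ((1 : ℝ) / 3) ≤ (8 * (1 + V)) ^ ((1 : ℝ) / 3) :=
            Real.rpow_le_rpow (by positivity) (by linarith) (by norm_num)
        _ = _ := by rw [Real.mul_rpow (by norm_num) (by linarith), h8]
    calc _ ≤ _ := hcard
      _ ≤ 64 * ((a 0 * a 1 * a 2).natAbs.divisors.card : ℝ) *
          (186 * (1 + V) ^ ((1 : ℝ) / 3)) := by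
        gcongr
        linarith
      _ = _ := by ring
  · intro x hx d h0 h1 h2
    rw [Int.isUnit_iff_natAbs_eq, ← Nat.dvd_one, ← (hmem x hx).1]
    refine Finset.dvd_gcd fun i _ => Int.natAbs_dvd_natAbs.2 ?_
    fin_cases i <;> assumption
  · intro x hx
    have := (hmem x hx).2.1
    rwa [Fin.sum_univ_three] at this
end

section
/- For every ε > 0 there is a constant C_ε such that for all B ≥ 1, the number of primitive vectors x ∈ ℤ^4 satisfying x_1x_2(x_1+x_2) + x_4(x_1+x_2+x_3)^2 = 0, max_{1≤i≤4}|x_i| ≤ B, and x_4·(x_1+x_2+x_3) ≠ 0 is at most C_ε · B^{1+ε}. -/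
theorem add_one_le_mul_two_rpow {ε : ℝ} (hε : 0 < ε) (v : ℕ) :
    (v : ℝ) + 1 ≤ (1 + 1 / (ε * Real.log 2)) * (2 : ℝ) ^ (ε * v) := by
  have hl : 0 < ε * Real.log 2 := mul_pos hε (Real.log_pos (by norm_num))
  have h1 : 1 + ε * Real.log 2 * v ≤ (2 : ℝ) ^ (ε * v) := by
    rw [Real.rpow_def_of_pos (by norm_num)]
    have := Real.add_one_le_exp (Real.log 2 * (ε * v))
    linarith
  calc (v : ℝ) + 1 ≤ (1 + 1 / (ε * Real.log 2)) * (1 + ε * Real.log 2 * v) := by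
        have : (1 + 1 / (ε * Real.log 2)) * (1 + ε * Real.log 2 * v)
            = 1 + v + (ε * Real.log 2 * v + 1 / (ε * Real.log 2)) := by
          field_simp; ring
        have : 0 ≤ ε * Real.log 2 * v + 1 / (ε * Real.log 2) := by positivity
        linarith
    _ ≤ _ := by gcongr

theorem exists_card_divisors_le {ε : ℝ} (hε : 0 < ε) :
    ∃ C : ℝ, 1 ≤ C ∧ ∀ n : ℕ, n ≠ 0 → (n.divisors.card : ℝ) ≤ C * (n : ℝ) ^ ε := by
  set K : ℝ := 1 + 1 / (ε * Real.log 2) with hK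
  have hl : 0 < ε * Real.log 2 := mul_pos hε (Real.log_pos (by norm_num))
  have hK1 : 1 ≤ K := by rw [hK]; have := one_div_pos.2 hl; linarith
  set R : ℕ := ⌈(2 : ℝ) ^ (1 / ε)⌉₊ with hR
  refine ⟨K ^ R, one_le_pow₀ hK1, fun n hn => ?_⟩
  have hpr : (n : ℝ) ^ ε = ∏ p ∈ n.primeFactors, (p : ℝ) ^ (ε * n.factorization p) := by
    conv_lhs => rw [← Nat.prod_factorization_pow_eq_self hn]
    rw [Finsupp.prod, Nat.cast_prod, ← Real.finsetProd_rpow _ _ (fun i _ => by positivity)]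
    refine Finset.prod_congr rfl fun p _ => ?_
    rw [Nat.cast_pow, ← Real.rpow_natCast, ← Real.rpow_mul (by positivity), mul_comm]
  have hfac : ∀ p ∈ n.primeFactors, ((n.factorization p + 1 : ℕ) : ℝ)
      ≤ (if p < R then K else 1) * (p : ℝ) ^ (ε * n.factorization p) := by
    intro p hp
    have h2 : (2 : ℝ) ≤ p := by exact_mod_cast (Nat.prime_of_mem_primeFactors hp).two_le
    push_cast
    split_ifs with h
    · refine (add_one_le_mul_two_rpow hε _).trans ?_
      gcongr
    · have h3 : (2 : ℝ) ≤ (p : ℝ) ^ ε := by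
        have h4 : (2 : ℝ) ^ (1 / ε) ≤ p :=
          (Nat.le_ceil _).trans (by exact_mod_cast not_lt.1 h)
        calc (2 : ℝ) = ((2 : ℝ) ^ (1 / ε)) ^ ε := by
              rw [← Real.rpow_mul (by norm_num), one_div_mul_cancel hε.ne', Real.rpow_one]
          _ ≤ _ := by gcongr
      rw [one_mul, Real.rpow_mul (by positivity), Real.rpow_natCast]
      calc ((n.factorization p : ℕ) : ℝ) + 1 ≤ (2 : ℝ) ^ (n.factorization p) := by
            exact_mod_cast Nat.lt_two_pow_self
        _ ≤ _ := by gcongr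
  rw [Nat.card_divisors hn, Nat.cast_prod, hpr]
  refine (Finset.prod_le_prod (fun _ _ => by positivity) hfac).trans ?_
  rw [Finset.prod_mul_distrib]
  gcongr
  rw [Finset.prod_ite, Finset.prod_const, Finset.prod_const_one, mul_one]
  refine pow_le_pow_right₀ hK1 ?_
  calc _ ≤ (Finset.range R).card := Finset.card_le_card fun p hp => by
        simpa using (Finset.mem_filter.1 hp).2
    _ = R := Finset.card_range R

/-- Logarithms are bounded by arbitrarily small powers. -/
theorem exists_one_add_log_pow_le (k : ℕ) {ε : ℝ} (hε : 0 < ε) :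
    ∃ C : ℝ, 1 ≤ C ∧ ∀ x : ℝ, 1 ≤ x → (1 + Real.log x) ^ k ≤ C * x ^ ε := by
  set δ : ℝ := ε / (k + 1) with hδ
  have hδ0 : 0 < δ := by positivity
  have hC : 1 ≤ 1 + 1 / δ := by have := one_div_pos.2 hδ0; linarith
  refine ⟨(1 + 1 / δ) ^ k, one_le_pow₀ hC, fun x hx => ?_⟩
  have h1 : 1 ≤ x ^ δ := Real.one_le_rpow hx hδ0.le
  have h2 : 1 + Real.log x ≤ (1 + 1 / δ) * x ^ δ := by
    have := Real.log_le_rpow_div (zero_le_one.trans hx) hδ0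
    have h3 : (1 + 1 / δ) * x ^ δ = x ^ δ + x ^ δ / δ := by ring
    linarith
  calc (1 + Real.log x) ^ k ≤ ((1 + 1 / δ) * x ^ δ) ^ k :=
        pow_le_pow_left₀ (by have := Real.log_nonneg hx; linarith) h2 k
    _ = (1 + 1 / δ) ^ k * x ^ (δ * k) := by
        rw [mul_pow, Real.rpow_mul (by positivity), Real.rpow_natCast]
    _ ≤ _ := by
        gcongr
        rw [hδ, div_mul_eq_mul_div, div_le_iff₀ (by positivity)]
        nlinarith

/-- The torsor coordinates of a positive solution of `U + V = W`, `U * V * W = x * s ^ 2`. -/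
structure IsFactorization (U V W x s d α β γ e y₁ y₂ y₃ a b c : ℕ) : Prop where
  left : U = d * (α * β * γ) * e ^ 2 * (α * y₁ * a ^ 2)
  right : V = d * (α * β * γ) * e ^ 2 * (β * y₂ * b ^ 2)
  sum : W = d * (α * β * γ) * e ^ 2 * (γ * y₃ * c ^ 2)
  cubic : x = d ^ 3 * (y₁ * y₂ * y₃)
  square : s = (α * β * γ) ^ 2 * e ^ 3 * (a * b * c)
  add_eq : α * y₁ * a ^ 2 + β * y₂ * b ^ 2 = γ * y₃ * c ^ 2
  coprime₁₂ : (α * y₁ * a ^ 2).Coprime (β * y₂ * b ^ 2)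
  coprime₁₃ : (α * y₁ * a ^ 2).Coprime (γ * y₃ * c ^ 2)
  coprime₂₃ : (β * y₂ * b ^ 2).Coprime (γ * y₃ * c ^ 2)

theorem exists_eq_mul_of_cube_eq {d x s n : ℕ} (hd : 0 < d) (h : d ^ 3 * n = x * s ^ 2)
    (hg : d.Coprime (x.gcd s)) :
    ∃ d₁ d₂ y t : ℕ, d = d₁ * d₂ ∧ x = d₁ ^ 3 * y ∧ s = d₂ * t ∧ d₂.Coprime y ∧
      y * t ^ 2 = d₂ * n := by
  have hg' : Nat.Coprime (d.gcd x) s := by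
    rw [Nat.coprime_iff_gcd_eq_one, Nat.gcd_assoc]; exact hg
  obtain ⟨d₂, hd₂⟩ := Nat.gcd_dvd_left d x
  set d₁ := d.gcd x with hd₁
  have hd₁0 : 0 < d₁ := Nat.gcd_pos_of_pos_left _ hd
  have hd₂0 : 0 < d₂ := Nat.pos_of_ne_zero fun h0 => by simp [h0] at hd₂; omega
  obtain ⟨y, hy⟩ : d₁ ^ 3 ∣ x := by
    refine (Nat.Coprime.pow 3 2 hg').dvd_of_dvd_mul_right ?_
    rw [← h, hd₂]; exact ⟨d₂ ^ 3 * n, by ring⟩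
  have hmain : d₂ ^ 3 * n = y * s ^ 2 := by
    have h0 : 0 < d₁ ^ 3 := by positivity
    apply Nat.eq_of_mul_eq_mul_left h0
    calc d₁ ^ 3 * (d₂ ^ 3 * n) = (d₁ * d₂) ^ 3 * n := by ring
      _ = _ := by rw [← hd₂, h, hy]; ring
  have hcop : d₂.Coprime y := by
    refine Nat.Coprime.symm (Nat.coprime_of_dvd fun p hp hpy hpd => ?_)
    have hps : ¬ p ∣ d₁ ∨ Nat.Coprime p s := by
      by_cases hpd₁ : p ∣ d₁
      · exact Or.inr (hg'.coprime_dvd_left hpd₁)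
      · exact Or.inl hpd₁
    have hpd₁ : p ∣ d₁ := Nat.dvd_gcd (hd₂ ▸ hpd.mul_left _) (hy ▸ hpy.mul_left _)
    have hps : Nat.Coprime p s := hps.resolve_left (not_not.2 hpd₁)
    have h3 : p * d₁ ∣ x := by
      obtain ⟨k, rfl⟩ := hpy
      exact ⟨d₁ ^ 2 * k, by rw [hy]; ring⟩
    have h4 : p * d₁ ∣ d := by rw [hd₂, mul_comm]; exact mul_dvd_mul_left _ hpd
    have h5 : p * d₁ ∣ 1 * d₁ := by rw [one_mul]; exact Nat.dvd_gcd h4 h3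
    exact hp.one_lt.ne' (Nat.dvd_one.1 (Nat.dvd_of_mul_dvd_mul_right hd₁0 h5))
  obtain ⟨t, ht⟩ : d₂ ∣ s := by
    have h6 : d₂ ^ 3 ∣ s ^ 2 := (Nat.Coprime.pow_left 3 hcop).dvd_of_dvd_mul_left ⟨n, hmain.symm⟩
    exact (Nat.pow_dvd_pow_iff two_ne_zero).1 ((pow_dvd_pow d₂ (by norm_num)).trans h6)
  refine ⟨d₁, d₂, y, t, hd₂, hy, ht, hcop, ?_⟩
  have h0 : 0 < d₂ ^ 2 := by positivity
  apply Nat.eq_of_mul_eq_mul_left h0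
  calc d₂ ^ 2 * (y * t ^ 2) = y * (d₂ * t) ^ 2 := by ring
    _ = _ := by rw [← ht, ← hmain]; ring

theorem exists_isFactorization {U V W x s : ℕ} (hU : 0 < U) (hV : 0 < V) (hx : 0 < x)
    (hW : U + V = W) (h : U * V * W = x * s ^ 2)
    (hg : (U.gcd V).Coprime (x.gcd s)) :
    ∃ d α β γ e y₁ y₂ y₃ a b c : ℕ, IsFactorization U V W x s d α β γ e y₁ y₂ y₃ a b c := by
  obtain ⟨d, u, v, hd, huv, hUd, hVd⟩ := Nat.exists_coprime' (Nat.gcd_pos_of_pos_left V hU)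
  have hWd : W = (u + v) * d := by rw [← hW, hUd, hVd]; ring
  have hdg : d = U.gcd V := by rw [hUd, hVd, Nat.gcd_mul_right, huv, one_mul]
  obtain ⟨d₁, d₂, y, t, rfl, hxy, hst, hd₂y, hyt⟩ :=
    exists_eq_mul_of_cube_eq (n := u * v * (u + v)) hd
      (by rw [← h, hWd, hUd, hVd]; ring) (hdg ▸ hg)
  have huw : u.Coprime (u + v) := by simpa using huv
  have hvw : v.Coprime (u + v) := by simpa using huv.symm
  have hydvd : y ∣ u * v * (u + v) := by
    refine (hd₂y.symm).dvd_of_dvd_mul_left (m := d₂) ⟨t ^ 2, ?_⟩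
    rw [hyt]
  have hy : y = y.gcd u * y.gcd v * y.gcd (u + v) := by
    rw [← Nat.Coprime.gcd_mul y huv, ← Nat.Coprime.gcd_mul y (huw.mul_left hvw)]
    exact (Nat.gcd_eq_left hydvd).symm
  obtain ⟨u', hu⟩ := Nat.gcd_dvd_right y u
  obtain ⟨v', hv⟩ := Nat.gcd_dvd_right y v
  obtain ⟨w', hw⟩ := Nat.gcd_dvd_right y (u + v)
  set y₁ := y.gcd u
  set y₂ := y.gcd v
  set y₃ := y.gcd (u + v)
  obtain ⟨α, a, hα, hαs⟩ := Nat.sq_mul_squarefree u'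
  obtain ⟨β, b, hβ, hβs⟩ := Nat.sq_mul_squarefree v'
  obtain ⟨γ, c, hγ, hγs⟩ := Nat.sq_mul_squarefree w'
  have hu' : u = α * y₁ * a ^ 2 := by rw [hu, ← hα]; ring
  have hv' : v = β * y₂ * b ^ 2 := by rw [hv, ← hβ]; ring
  have hw' : u + v = γ * y₃ * c ^ 2 := by rw [hw, ← hγ]; ring
  have hu0 : 0 < u := Nat.pos_of_ne_zero fun h0 => by simp [h0] at hUd; omega
  have hv0 : 0 < v := Nat.pos_of_ne_zero fun h0 => by simp [h0] at hVd; omega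
  have hy0 : 0 < y := Nat.pos_of_ne_zero fun h0 => by simp [h0] at hxy; omega
  have hab : 0 < a * b * c := by
    refine Nat.pos_of_ne_zero fun h0 => ?_
    rcases Nat.mul_eq_zero.1 h0 with h0 | h0
    · rcases Nat.mul_eq_zero.1 h0 with h0 | h0
      · simp [h0] at hu'; omega
      · simp [h0] at hv'; omega
    · simp [h0] at hw'; omega
  have hsq : t ^ 2 = d₂ * (α * β * γ) * (a * b * c) ^ 2 := by
    apply Nat.eq_of_mul_eq_mul_left hy0
    rw [hyt]
    calc d₂ * (u * v * (u + v)) = d₂ * (α * y₁ * a ^ 2 * (β * y₂ * b ^ 2) * (γ * y₃ * c ^ 2)) := by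
          rw [← hu', ← hv', ← hw']
      _ = y₁ * y₂ * y₃ * (d₂ * (α * β * γ) * (a * b * c) ^ 2) := by ring
      _ = _ := by rw [← hy]
  obtain ⟨m, hm⟩ : a * b * c ∣ t :=
    (Nat.pow_dvd_pow_iff two_ne_zero).1 (hsq ▸ dvd_mul_left _ _)
  have hm2 : m ^ 2 = d₂ * (α * β * γ) := by
    have h0 : 0 < (a * b * c) ^ 2 := by positivity
    apply Nat.eq_of_mul_eq_mul_right h0
    rw [← hsq, hm]; ring
  have hαu : α ∣ u := hu' ▸ ⟨y₁ * a ^ 2, by ring⟩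
  have hβv : β ∣ v := hv' ▸ ⟨y₂ * b ^ 2, by ring⟩
  have hγw : γ ∣ u + v := hw' ▸ ⟨y₃ * c ^ 2, by ring⟩
  have hGs : Squarefree (α * β * γ) := by
    have h1 := (huv.coprime_dvd_left hαu).coprime_dvd_right hβv
    have h2 := (huw.coprime_dvd_left hαu).coprime_dvd_right hγw
    have h3 := (hvw.coprime_dvd_left hβv).coprime_dvd_right hγw
    rw [Nat.squarefree_mul (h2.mul_left h3), Nat.squarefree_mul h1]
    exact ⟨⟨hαs, hβs⟩, hγs⟩
  obtain ⟨e, he⟩ : α * β * γ ∣ m :=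
    (hGs.dvd_pow_iff_dvd two_ne_zero).1 (hm2 ▸ dvd_mul_left _ _)
  have hd₂ : d₂ = α * β * γ * e ^ 2 := by
    apply Nat.eq_of_mul_eq_mul_right (Nat.pos_of_ne_zero hGs.ne_zero)
    rw [← hm2, he]; ring
  refine ⟨d₁, α, β, γ, e, y₁, y₂, y₃, a, b, c, ?_, ?_, ?_, ?_, ?_, ?_, ?_, ?_, ?_⟩
  · rw [hUd, ← hu', hd₂]; ring
  · rw [hVd, ← hv', hd₂]; ring
  · rw [hWd, hw', hd₂]; ring
  · rw [hxy, ← hy]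
  · rw [hst, hm, he, hd₂]; ring
  · rw [← hu', ← hv', hw']
  · rwa [← hu', ← hv']
  · rwa [← hu', ← hw']
  · rwa [← hv', ← hw']

theorem card_le_mul_of_close {ι : Type*} (T : Finset ι) (f : ι → ℝ) {K : ℕ} (hK : 0 < K) (m : ℕ)
    (hf : ∀ x ∈ T, 0 ≤ f x ∧ f x < 1)
    (h : ∀ S ⊆ T, (∀ x ∈ S, ∀ y ∈ S, |f x - f y| < 1 / K) → S.card ≤ m) :
    T.card ≤ m * K := by
  have hK' : (0 : ℝ) < K := by exact_mod_cast hK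
  have key := Finset.card_le_mul_card_image_of_maps_to (s := T) (t := Finset.range K)
    (f := fun x => ⌊f x * K⌋₊) (fun x hx => ?_) m (fun n _ => ?_)
  · simpa using key
  · obtain ⟨h0, h1⟩ := hf x hx
    rw [Finset.mem_range, Nat.floor_lt (by positivity)]
    nlinarith
  · refine h _ (Finset.filter_subset _ _) fun x hx y hy => ?_
    rw [Finset.mem_filter] at hx hy
    have hx0 : 0 ≤ f x * K := mul_nonneg (hf x hx.1).1 hK'.le
    have hy0 : 0 ≤ f y * K := mul_nonneg (hf y hy.1).1 hK'.le
    have h1 := Nat.floor_le hx0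
    have h2 := Nat.lt_floor_add_one (f x * K)
    have h3 := Nat.floor_le hy0
    have h4 := Nat.lt_floor_add_one (f y * K)
    rw [hx.2] at h1 h2
    rw [hy.2] at h3 h4
    rw [abs_lt, lt_div_iff₀ hK', ← neg_div, div_lt_iff₀ hK']
    constructor <;> linarith

theorem eq_of_mul_eq_mul_of_coprime {a b a' b' : ℕ} (h : a.Coprime b) (h' : a'.Coprime b')
    (heq : a * b' = a' * b) : a = a' ∧ b = b' := by
  constructor
  · exact Nat.dvd_antisymm (h.dvd_of_dvd_mul_right ⟨b', heq.symm⟩)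
      (h'.dvd_of_dvd_mul_right ⟨b, heq⟩)
  · exact Nat.dvd_antisymm (h.symm.dvd_of_dvd_mul_left ⟨a', by rw [heq]; ring⟩)
      (h'.symm.dvd_of_dvd_mul_left ⟨a, by rw [← heq]; ring⟩)

/-- Coprime solutions of a linear equation in a dyadic box. -/
theorem card_linear_cell_le {p q r : ℕ} (hr : 0 < r) (hpr : p.Coprime r)
    (k₁ k₂ : ℕ) (T : Finset (ℕ × ℕ × ℕ))
    (hT : ∀ y ∈ T, p * y.1 + q * y.2.1 = r * y.2.2 ∧ y.1.Coprime y.2.1 ∧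
      (2 ^ k₁ ≤ y.1 ∧ y.1 < 2 ^ (k₁ + 1)) ∧ 2 ^ k₂ ≤ y.2.1 ∧ y.2.1 < 2 ^ (k₂ + 1))
    {z : ℕ × ℕ × ℕ} (hz : z ∈ T) :
    (T.card : ℝ) ≤ 8 * (z.1 * z.2.1) / r + 1 := by
  have hr' : (0 : ℝ) < r := by exact_mod_cast hr
  have hz1 : (2 : ℝ) ^ k₁ ≤ z.1 := by exact_mod_cast (hT z hz).2.2.1.1
  have hz2 : (2 : ℝ) ^ k₂ ≤ z.2.1 := by exact_mod_cast (hT z hz).2.2.2.1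
  have hq : (0 : ℝ) < 2 ^ k₁ := by positivity
  have hq' : (0 : ℝ) < 2 ^ k₂ := by positivity
  have hz0 : (0 : ℝ) < 8 * (z.1 * z.2.1) / r := by
    have := hq.trans_le hz1
    have := hq'.trans_le hz2
    positivity
  set K : ℕ := ⌈8 * ((z.1 : ℝ) * z.2.1) / r⌉₊ with hK
  have hK0 : 0 < K := Nat.ceil_pos.2 hz0
  have hK0' : (0 : ℝ) < K := by exact_mod_cast hK0
  have hKle : 8 * ((z.1 : ℝ) * z.2.1) ≤ r * K := by
    rw [← div_le_iff₀' hr']; exact Nat.le_ceil _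
  have key : T.card ≤ 1 * K := by
    refine card_le_mul_of_close T (fun y => (y.1 / y.2.1 : ℝ) * (2 ^ k₂ / 2 ^ (k₁ + 1))) hK0 1 ?_ ?_
    · intro y hy
      obtain ⟨-, -, ⟨-, h1⟩, h2, -⟩ := hT y hy
      have h1' : (y.1 : ℝ) < 2 ^ (k₁ + 1) := by exact_mod_cast h1
      have h2' : (2 : ℝ) ^ k₂ ≤ y.2.1 := by exact_mod_cast h2
      have h3 : (0 : ℝ) < y.2.1 := hq'.trans_le h2'
      refine ⟨by positivity, ?_⟩
      rw [div_mul_div_comm, div_lt_one (by positivity), mul_comm]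
      exact mul_lt_mul_of_le_of_lt_of_pos_of_nonneg h2' h1' hq' (by positivity)
    · intro S hS hclose
      rw [Finset.card_le_one]
      intro y hy y' hy'
      obtain ⟨e1, c1, ⟨-, -⟩, l1, u1⟩ := hT y (hS hy)
      obtain ⟨e2, c2, ⟨-, -⟩, l2, u2⟩ := hT y' (hS hy')
      have hd : ((y.1 * y'.2.1 - y'.1 * y.2.1 : ℤ)) = 0 := by
        have hdvd : (r : ℤ) ∣ y.1 * y'.2.1 - y'.1 * y.2.1 := by
          have hc : IsCoprime (r : ℤ) p := (Nat.isCoprime_iff_coprime.2 hpr).symm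
          refine hc.dvd_of_dvd_mul_left ⟨y.2.2 * y'.2.1 - y'.2.2 * y.2.1, ?_⟩
          have e1' : (p * y.1 + q * y.2.1 : ℤ) = r * y.2.2 := by exact_mod_cast e1
          have e2' : (p * y'.1 + q * y'.2.1 : ℤ) = r * y'.2.2 := by exact_mod_cast e2
          linear_combination (y'.2.1 : ℤ) * e1' - (y.2.1 : ℤ) * e2'
        refine Int.eq_zero_of_abs_lt_dvd hdvd ?_
        have l1' : (2 : ℝ) ^ k₂ ≤ y.2.1 := by exact_mod_cast l1
        have l2' : (2 : ℝ) ^ k₂ ≤ y'.2.1 := by exact_mod_cast l2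
        have u1' : (y.2.1 : ℝ) < 2 ^ (k₂ + 1) := by exact_mod_cast u1
        have u2' : (y'.2.1 : ℝ) < 2 ^ (k₂ + 1) := by exact_mod_cast u2
        have p1 := hq'.trans_le l1'
        have p2 := hq'.trans_le l2'
        have hR : |((y.1 : ℝ) * y'.2.1 - y'.1 * y.2.1)| < r := by
          have hcl := hclose y hy y' hy'
          have heq : (y.1 : ℝ) * y'.2.1 - y'.1 * y.2.1
              = ((y.1 / y.2.1 : ℝ) * (2 ^ k₂ / 2 ^ (k₁ + 1))
                - (y'.1 / y'.2.1 : ℝ) * (2 ^ k₂ / 2 ^ (k₁ + 1)))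
                * ((y.2.1 * y'.2.1) * (2 ^ (k₁ + 1) / 2 ^ k₂)) := by
            field_simp
          rw [heq, abs_mul, abs_of_pos (a := (y.2.1 * y'.2.1 : ℝ) * _) (by positivity)]
          calc _ < 1 / (K : ℝ) * ((y.2.1 * y'.2.1) * (2 ^ (k₁ + 1) / 2 ^ k₂)) := by gcongr
            _ ≤ 1 / (K : ℝ) * ((2 ^ (k₂ + 1) * 2 ^ (k₂ + 1)) * (2 ^ (k₁ + 1) / 2 ^ k₂)) := by gcongr
            _ = 8 * (2 ^ k₁ * 2 ^ k₂) / K := by rw [pow_succ, pow_succ]; field_simp; ring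
            _ ≤ 8 * (z.1 * z.2.1) / K := by gcongr
            _ ≤ r := by rwa [div_le_iff₀ hK0']
        exact_mod_cast hR
      have hd' : y.1 * y'.2.1 = y'.1 * y.2.1 := by
        have := sub_eq_zero.1 hd; exact_mod_cast this
      obtain ⟨h1, h2⟩ := eq_of_mul_eq_mul_of_coprime c1 c2 hd'
      refine Prod.ext h1 (Prod.ext h2 ?_)
      apply Nat.eq_of_mul_eq_mul_left hr
      rw [← e1, ← e2, h1, h2]
  rw [one_mul] at key
  calc (T.card : ℝ) ≤ K := by exact_mod_cast key
    _ ≤ _ := (Nat.ceil_lt_add_one hz0.le).le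

theorem dvd_two_mul_minor {m x y x₁ y₁ x₂ y₂ : ℤ} (hm : m ≠ 0)
    (hy : IsCoprime m y) (hx₁ : IsCoprime m x₁)
    (h₁ : m ∣ x₁ ^ 2 * y ^ 2 - x ^ 2 * y₁ ^ 2) (h₂ : m ∣ x₂ ^ 2 * y ^ 2 - x ^ 2 * y₂ ^ 2)
    (hg : Int.gcd m (x₁ * y - x * y₁) = Int.gcd m (x₂ * y - x * y₂)) :
    m ∣ 2 * (x₁ * y₂ - x₂ * y₁) := by
  have aux : ∀ z w : ℤ, m ∣ z ^ 2 * y ^ 2 - x ^ 2 * w ^ 2 →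
      m / Int.gcd m (z * y - x * w) ∣ z * y + x * w := by
    intro z w h
    have hpos : 0 < Int.gcd m (z * y - x * w) := Int.gcd_pos_of_ne_zero_left _ hm
    obtain ⟨m', n', hc, hm', hn'⟩ := Int.exists_gcd_one hpos
    set g := Int.gcd m (z * y - x * w)
    have hg0 : (g : ℤ) ≠ 0 := by exact_mod_cast hpos.ne'
    have : m / g = m' := by
      conv_lhs => rw [hm']
      exact Int.mul_ediv_cancel _ hg0
    rw [this]
    refine (Int.isCoprime_iff_gcd_eq_one.2 hc).dvd_of_dvd_mul_left ?_
    obtain ⟨k, hk⟩ := h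
    refine ⟨k, mul_right_cancel₀ hg0 ?_⟩
    calc n' * (z * y + x * w) * g = (n' * g) * (z * y + x * w) := by ring
      _ = m * k := by rw [← hn', ← hk]; ring
      _ = _ := by conv_lhs => rw [hm']
                  ring
  have a₁ := aux x₁ y₁ h₁
  have a₂ := aux x₂ y₂ h₂
  rw [← hg] at a₂
  have b₁ : (Int.gcd m (x₁ * y - x * y₁) : ℤ) ∣ x₁ * y - x * y₁ := Int.gcd_dvd_right ..
  have b₂ : (Int.gcd m (x₁ * y - x * y₁) : ℤ) ∣ x₂ * y - x * y₂ := hg ▸ Int.gcd_dvd_right ..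
  have hgm : (Int.gcd m (x₁ * y - x * y₁) : ℤ) ∣ m := Int.gcd_dvd_left ..
  set g : ℤ := (Int.gcd m (x₁ * y - x * y₁) : ℤ)
  have hgh : g * (m / g) = m := Int.mul_ediv_cancel' hgm
  set h := m / g
  have hhm : h ∣ m := ⟨g, by rw [← hgh]; ring⟩
  have hyg : IsCoprime g y := hy.of_isCoprime_of_dvd_left hgm
  have hyh : IsCoprime h y := hy.of_isCoprime_of_dvd_left hhm
  have dg : g ∣ x₁ * y₂ - x₂ * y₁ := by
    refine hyg.dvd_of_dvd_mul_left ?_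
    have : y * (x₁ * y₂ - x₂ * y₁) = (x₁ * y - x * y₁) * y₂ - (x₂ * y - x * y₂) * y₁ := by ring
    rw [this]; exact dvd_sub (b₁.mul_right _) (b₂.mul_right _)
  have dh : h ∣ x₁ * y₂ - x₂ * y₁ := by
    refine hyh.dvd_of_dvd_mul_left ?_
    have : y * (x₁ * y₂ - x₂ * y₁) = (x₁ * y + x * y₁) * y₂ - (x₂ * y + x * y₂) * y₁ := by ring
    rw [this]; exact dvd_sub (a₁.mul_right _) (a₂.mul_right _)
  have d2 : (Int.gcd g h : ℤ) ∣ 2 := by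
    have e1 : (Int.gcd g h : ℤ) ∣ y * (x₁ * 2) := by
      have : y * (x₁ * 2) = (x₁ * y - x * y₁) + (x₁ * y + x * y₁) := by ring
      rw [this]
      exact dvd_add ((Int.gcd_dvd_left ..).trans b₁) ((Int.gcd_dvd_right ..).trans a₁)
    have hd : (Int.gcd g h : ℤ) ∣ m := (Int.gcd_dvd_left ..).trans hgm
    exact (hx₁.of_isCoprime_of_dvd_left hd).dvd_of_dvd_mul_left
      ((hy.of_isCoprime_of_dvd_left hd).dvd_of_dvd_mul_left e1)
  obtain ⟨i, hi⟩ := dg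
  obtain ⟨j, hj⟩ := dh
  obtain ⟨k, hk⟩ := d2
  have hb := Int.gcd_eq_gcd_ab g h
  refine ⟨k * (Int.gcdA g h * j + Int.gcdB g h * i), ?_⟩
  rw [hk, hb, ← hgh]
  linear_combination k * g * Int.gcdA g h * hj + k * h * Int.gcdB g h * hi

/-- The rational parametrization of the circle turns a determinant into a Vandermonde. -/
theorem det_circle (u v w : Fin 3 → ℝ) (h₀ : ∀ i, 0 < w i + u i)
    (hc : ∀ i, u i ^ 2 + v i ^ 2 = w i ^ 2) :
    u 0 * (v 1 * w 2 - v 2 * w 1) - v 0 * (u 1 * w 2 - u 2 * w 1)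
      + w 0 * (u 1 * v 2 - u 2 * v 1)
      = -(((w 0 + u 0) * (w 1 + u 1) * (w 2 + u 2)) / 2 *
        ((v 0 / (w 0 + u 0) - v 1 / (w 1 + u 1)) * (v 1 / (w 1 + u 1) - v 2 / (w 2 + u 2)) *
          (v 0 / (w 0 + u 0) - v 2 / (w 2 + u 2)))) := by
  set t : Fin 3 → ℝ := fun i => v i / (w i + u i) with ht
  have hv : ∀ i, v i = (w i + u i) * t i := fun i => by
    have := (h₀ i).ne'
    simp only [ht]; field_simp
  have hw : ∀ i, w i - u i = (w i + u i) * t i ^ 2 := fun i => by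
    have := (h₀ i).ne'
    simp only [ht]; field_simp; linear_combination - hc i
  change _ = -(((w 0 + u 0) * (w 1 + u 1) * (w 2 + u 2)) / 2 *
    ((t 0 - t 1) * (t 1 - t 2) * (t 0 - t 2)))
  set l : Fin 3 → ℝ := fun i => w i + u i with hl
  have hut : ∀ i, u i = l i * (1 - t i ^ 2) / 2 := fun i => by
    simp only [hl]; linear_combination - hw i / 2
  have hwt : ∀ i, w i = l i * (1 + t i ^ 2) / 2 := fun i => by
    simp only [hl]; linear_combination hw i / 2
  have hvt : ∀ i, v i = l i * t i := hv
  change _ = -((l 0 * l 1 * l 2) / 2 * ((t 0 - t 1) * (t 1 - t 2) * (t 0 - t 2)))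
  rw [hut 0, hut 1, hut 2, hvt 0, hvt 1, hvt 2, hwt 0, hwt 1, hwt 2]
  ring

theorem mul_eq_mul_of_circle {u v w u' v' w' : ℝ} (h : 0 < w + u) (h' : 0 < w' + u')
    (hc : u ^ 2 + v ^ 2 = w ^ 2) (hc' : u' ^ 2 + v' ^ 2 = w' ^ 2)
    (ht : v / (w + u) = v' / (w' + u')) : u * v' = u' * v := by
  rw [div_eq_div_iff h.ne' h'.ne'] at ht
  have h1 : (w - u) * (w' + u') = (w' - u') * (w + u) := by
    have h0 : (w + u) * (w' + u') ≠ 0 := (mul_pos h h').ne'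
    apply mul_left_cancel₀ h0
    linear_combination (v * (w' + u') + v' * (w + u)) * ht
      - (w' + u') ^ 2 * hc + (w + u) ^ 2 * hc'
  apply mul_left_cancel₀ h.ne'
  linear_combination - u * ht - v / 2 * h1

theorem sq_det_circle_lt {M κ : ℝ} (hκ : 0 < κ) (u v w : Fin 3 → ℝ)
    (hu : ∀ i, 0 < u i) (hw : ∀ i, 0 < w i)
    (hc : ∀ i, u i ^ 2 + v i ^ 2 = w i ^ 2) (hM : ∀ i, w i ^ 2 ≤ M)
    (hclose : ∀ i j, |v i / (w i + u i) - v j / (w j + u j)| < 1 / κ) :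
    (u 0 * (v 1 * w 2 - v 2 * w 1) - v 0 * (u 1 * w 2 - u 2 * w 1)
      + w 0 * (u 1 * v 2 - u 2 * v 1)) ^ 2 < 16 * M ^ 3 / κ ^ 6 := by
  have h0 : ∀ i, 0 < w i + u i := fun i => add_pos (hw i) (hu i)
  have hlw : ∀ i, (w i + u i) ^ 2 ≤ 4 * M := fun i => by
    have h1 : u i ≤ w i := by
      refine le_of_sq_le_sq ?_ (hw i).le
      have := hc i; nlinarith [sq_nonneg (v i)]
    calc (w i + u i) ^ 2 ≤ (w i + w i) ^ 2 := by gcongr; exact (h0 i).le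
      _ = 4 * w i ^ 2 := by ring
      _ ≤ _ := by have := hM i; gcongr
  have hts : ∀ i j, (v i / (w i + u i) - v j / (w j + u j)) ^ 2 < (1 / κ) ^ 2 := fun i j => by
    rw [← sq_abs]; exact pow_lt_pow_left₀ (hclose i j) (abs_nonneg _) two_ne_zero
  have hM0 : 0 < M := (pow_pos (hw 0) 2).trans_le (hM 0)
  rw [det_circle u v w h0 hc]
  calc _ = (1 / 4) * ((w 0 + u 0) ^ 2 * (w 1 + u 1) ^ 2 * (w 2 + u 2) ^ 2) *
        ((v 0 / (w 0 + u 0) - v 1 / (w 1 + u 1)) ^ 2 * (v 1 / (w 1 + u 1) - v 2 / (w 2 + u 2)) ^ 2 *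
          (v 0 / (w 0 + u 0) - v 2 / (w 2 + u 2)) ^ 2) := by ring
    _ ≤ (1 / 4) * ((4 * M) * (4 * M) * (4 * M)) *
        ((v 0 / (w 0 + u 0) - v 1 / (w 1 + u 1)) ^ 2 * (v 1 / (w 1 + u 1) - v 2 / (w 2 + u 2)) ^ 2 *
          (v 0 / (w 0 + u 0) - v 2 / (w 2 + u 2)) ^ 2) := by
        gcongr <;> apply hlw
    _ < (1 / 4) * ((4 * M) * (4 * M) * (4 * M)) * ((1 / κ) ^ 2 * (1 / κ) ^ 2 * (1 / κ) ^ 2) := by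
        have := hts 0 1
        have := hts 1 2
        have := hts 0 2
        gcongr
    _ = _ := by field_simp; norm_num

theorem card_conic_le {A B C : ℕ} (hA : 0 < A) (hB : 0 < B) (hC : 0 < C) {M : ℝ}
    (T : Finset (ℕ × ℕ × ℕ))
    (hT : ∀ z ∈ T, (0 < z.1 ∧ 0 < z.2.1 ∧ 0 < z.2.2) ∧
      A * z.1 ^ 2 + B * z.2.1 ^ 2 = C * z.2.2 ^ 2 ∧
      (A * z.1 ^ 2).Coprime (B * z.2.1 ^ 2) ∧ (A * z.1 ^ 2).Coprime (C * z.2.2 ^ 2) ∧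
      (B * z.2.1 ^ 2).Coprime (C * z.2.2 ^ 2) ∧ ((C * z.2.2 ^ 2 : ℕ) : ℝ) ≤ M) :
    (T.card : ℝ) ≤ 2 * (A.divisors.card * B.divisors.card * C.divisors.card) *
      (2 * √(M / (A * B * C)) + 1) := by
  rcases T.eq_empty_or_nonempty with rfl | ⟨o, ho⟩
  · simp only [Finset.card_empty, Nat.cast_zero]; positivity
  have hA' : (0 : ℝ) < A := by exact_mod_cast hA
  have hB' : (0 : ℝ) < B := by exact_mod_cast hB
  have hC' : (0 : ℝ) < C := by exact_mod_cast hC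
  have hM0 : 0 < M := by
    obtain ⟨⟨-, -, h⟩, -, -, -, -, h1⟩ := hT o ho
    refine lt_of_lt_of_le ?_ h1
    positivity
  set K : ℕ := ⌊2 * √(M / (A * B * C))⌋₊ + 1 with hK
  have hKlt : 2 * √(M / (A * B * C)) < K := by rw [hK]; push_cast; exact Nat.lt_floor_add_one _
  have hKle : (K : ℝ) ≤ 2 * √(M / (A * B * C)) + 1 := by
    rw [hK]; push_cast; gcongr; exact Nat.floor_le (by positivity)
  have hK0 : (0 : ℝ) < K := lt_of_le_of_lt (by positivity) hKlt
  have hK6 : 64 * M ^ 3 / (K : ℝ) ^ 6 < (A * B * C : ℝ) ^ 3 := by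
    have h1 : 4 * (M / (A * B * C)) < (K : ℝ) ^ 2 := by
      calc 4 * (M / (A * B * C)) = (2 * √(M / (A * B * C))) ^ 2 := by
            rw [mul_pow, Real.sq_sqrt (by positivity)]; norm_num
        _ < _ := by gcongr
    have h2 : 4 * M < (K : ℝ) ^ 2 * (A * B * C) := by
      rwa [mul_div_assoc', div_lt_iff₀ (by positivity)] at h1
    rw [div_lt_iff₀ (by positivity)]
    calc 64 * M ^ 3 = (4 * M) ^ 3 := by ring
      _ < ((K : ℝ) ^ 2 * (A * B * C)) ^ 3 := by gcongr
      _ = _ := by ring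
  let cls : ℕ × ℕ × ℕ → ℕ × ℕ × ℕ := fun z =>
    (Int.gcd A (z.2.1 * o.2.2 - o.2.1 * z.2.2), Int.gcd B (z.1 * o.2.2 - o.1 * z.2.2),
      Int.gcd C (z.1 * o.2.1 - o.1 * z.2.1))
  have hdvdcls : ∀ (m : ℕ) (k : ℤ), 0 < m → Int.gcd m k ∈ m.divisors := fun m k hm =>
    Nat.mem_divisors.2 ⟨by exact_mod_cast Int.gcd_dvd_left (a := (m : ℤ)) (b := k), hm.ne'⟩
  have key := Finset.card_le_mul_card_image_of_maps_to (s := T)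
    (t := A.divisors ×ˢ B.divisors ×ˢ C.divisors) (f := cls)
    (fun z _ => by
      simp only [Finset.mem_product, cls]
      exact ⟨hdvdcls _ _ hA, hdvdcls _ _ hB, hdvdcls _ _ hC⟩)
    (2 * K) (fun g _ => ?_)
  · rw [Finset.card_product, Finset.card_product] at key
    calc (T.card : ℝ)
        ≤ ((2 * K * (A.divisors.card * (B.divisors.card * C.divisors.card)) : ℕ) : ℝ) := by
          exact_mod_cast key
      _ = 2 * (A.divisors.card * B.divisors.card * C.divisors.card) * K := by push_cast; ring
      _ ≤ _ := by gcongr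
  set S := {z ∈ T | cls z = g} with hS
  have hST : ∀ z ∈ S, z ∈ T := fun z hz => (Finset.mem_filter.1 hz).1
  have hSc : ∀ z ∈ S, ∀ z' ∈ S, cls z = cls z' := fun z hz z' hz' =>
    ((Finset.mem_filter.1 hz).2).trans ((Finset.mem_filter.1 hz').2).symm
  let u : ℕ × ℕ × ℕ → ℝ := fun z => √A * z.1
  let v : ℕ × ℕ × ℕ → ℝ := fun z => √B * z.2.1
  let w : ℕ × ℕ × ℕ → ℝ := fun z => √C * z.2.2
  have hu : ∀ z ∈ T, 0 < u z := fun z hz => by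
    have := (hT z hz).1.1; simp only [u]; positivity
  have hv : ∀ z ∈ T, 0 < v z := fun z hz => by
    have := (hT z hz).1.2.1; simp only [v]; positivity
  have hw : ∀ z ∈ T, 0 < w z := fun z hz => by
    have := (hT z hz).1.2.2; simp only [w]; positivity
  have hc : ∀ z ∈ T, u z ^ 2 + v z ^ 2 = w z ^ 2 := fun z hz => by
    simp only [u, v, w, mul_pow, Real.sq_sqrt hA'.le, Real.sq_sqrt hB'.le, Real.sq_sqrt hC'.le]
    exact_mod_cast (hT z hz).2.1
  have hM : ∀ z ∈ T, w z ^ 2 ≤ M := fun z hz => by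
    simp only [w, mul_pow, Real.sq_sqrt hC'.le]
    exact_mod_cast (hT z hz).2.2.2.2.2
  have hvw : ∀ z ∈ T, v z < w z := fun z hz => by
    refine lt_of_pow_lt_pow_left₀ 2 (hw z hz).le ?_
    rw [← hc z hz]; have := hu z hz; simp only [lt_add_iff_pos_left]; positivity
  refine card_le_mul_of_close S (fun z => v z / (w z + u z)) (Nat.succ_pos _) 2 (fun z hz => ?_)
    fun R hR hclose => ?_
  · have h1 := hu z (hST z hz)
    have h2 := hv z (hST z hz)
    have h3 := hvw z (hST z hz)
    exact ⟨by have := hw z (hST z hz); positivity, (div_lt_one (by linarith)).2 (by linarith)⟩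
  by_contra hcard
  rw [not_le, Finset.two_lt_card_iff] at hcard
  obtain ⟨z₀, z₁, z₂, m₀, m₁, m₂, n₀₁, n₀₂, n₁₂⟩ := hcard
  have hRT : ∀ z ∈ R, z ∈ T := fun z hz => hST z (hR hz)
  -- the three points span a lattice of index divisible by `A * B * C`, up to a factor `2`
  set D : ℤ := z₀.1 * (z₁.2.1 * z₂.2.2 - z₂.2.1 * z₁.2.2)
    - z₀.2.1 * (z₁.1 * z₂.2.2 - z₂.1 * z₁.2.2) + z₀.2.2 * (z₁.1 * z₂.2.1 - z₂.1 * z₁.2.1) with hD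
  have hlt := sq_det_circle_lt (M := M) hK0 (fun i => u (![z₀, z₁, z₂] i))
    (fun i => v (![z₀, z₁, z₂] i)) (fun i => w (![z₀, z₁, z₂] i))
    (by simp [Fin.forall_fin_succ, hu, hRT, m₀, m₁, m₂])
    (by simp [Fin.forall_fin_succ, hw, hRT, m₀, m₁, m₂])
    (by simp [Fin.forall_fin_succ, hc, hRT, m₀, m₁, m₂])
    (by simp [Fin.forall_fin_succ, hM, hRT, m₀, m₁, m₂])
    (fun i j => hclose _ (by fin_cases i <;> simp [m₀, m₁, m₂]) _
      (by fin_cases j <;> simp [m₀, m₁, m₂]))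
  have hdet : (A * B * C : ℝ) * D ^ 2 < 16 * M ^ 3 / (K : ℝ) ^ 6 := by
    refine lt_of_eq_of_lt ?_ hlt
    simp only [u, v, w, hD, Matrix.cons_val]
    conv_lhs => rw [← Real.sq_sqrt hA'.le, ← Real.sq_sqrt hB'.le, ← Real.sq_sqrt hC'.le]
    push_cast
    ring
  have hne : D ≠ 0 := by
    intro hD0
    have hwu : ∀ z ∈ T, 0 < w z + u z := fun z hz => add_pos (hw z hz) (hu z hz)
    have hdet0 := det_circle (fun i => u (![z₀, z₁, z₂] i))
      (fun i => v (![z₀, z₁, z₂] i)) (fun i => w (![z₀, z₁, z₂] i))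
      (by simp [Fin.forall_fin_succ, hwu, hRT, m₀, m₁, m₂])
      (by simp [Fin.forall_fin_succ, hc, hRT, m₀, m₁, m₂])
    have hzero : √(A : ℝ) * √B * √C * D = 0 := by rw [hD0]; simp
    have hsep : ∀ z ∈ R, ∀ z' ∈ R, z ≠ z' → v z / (w z + u z) - v z' / (w z' + u z') ≠ 0 := by
      intro z hz z' hz' hn h
      have hz := hRT z hz
      have hz' := hRT z' hz'
      have h1 := mul_eq_mul_of_circle (hwu z hz) (hwu z' hz') (hc z hz) (hc z' hz')
        (sub_eq_zero.1 h)
      have h2 : (z.1 * z'.2.1 : ℝ) = z'.1 * z.2.1 := by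
        apply mul_left_cancel₀ (mul_pos (Real.sqrt_pos.2 hA') (Real.sqrt_pos.2 hB')).ne'
        simp only [u, v] at h1
        linear_combination h1
      obtain ⟨-, e1, c1, -, -, -⟩ := hT z hz
      obtain ⟨-, e2, c2, -, -, -⟩ := hT z' hz'
      have cop : ∀ {x y : ℕ}, (A * x ^ 2).Coprime (B * y ^ 2) → x.Coprime y := fun h =>
        (h.coprime_dvd_left ⟨_, by rw [sq, mul_left_comm]⟩).coprime_dvd_right
          ⟨_, by rw [sq, mul_left_comm]⟩
      obtain ⟨h3, h4⟩ := eq_of_mul_eq_mul_of_coprime (cop c1) (cop c2) (by exact_mod_cast h2)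
      refine hn (Prod.ext h3 (Prod.ext h4 ?_))
      rw [h3, h4, e2] at e1
      exact (Nat.pow_left_injective two_ne_zero (Nat.eq_of_mul_eq_mul_left hC e1)).symm
    have hpos : ∀ z ∈ R, w z + u z ≠ 0 := fun z hz =>
      (hwu z (hRT z hz)).ne'
    refine (?_ : _ ≠ (0 : ℝ)) (hdet0.symm.trans (Eq.trans ?_ hzero))
    · simp only [Matrix.cons_val]
      exact neg_ne_zero.2 (mul_ne_zero (div_ne_zero (mul_ne_zero (mul_ne_zero (hpos _ m₀)
        (hpos _ m₁)) (hpos _ m₂)) two_ne_zero) (mul_ne_zero (mul_ne_zero (hsep _ m₀ _ m₁ n₀₁)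
        (hsep _ m₁ _ m₂ n₁₂)) (hsep _ m₀ _ m₂ n₀₂)))
    · simp only [u, v, w, hD, Matrix.cons_val]
      push_cast
      ring
  have hdvd : ((A * B * C : ℕ) : ℤ) ∣ 2 * D := by
    have hEq : ∀ z ∈ T, (A * z.1 ^ 2 + B * z.2.1 ^ 2 : ℤ) = C * z.2.2 ^ 2 := fun z hz => by
      exact_mod_cast (hT z hz).2.1
    have cop : ∀ {m x n y : ℕ}, (m * x ^ 2).Coprime (n * y ^ 2) →
        IsCoprime (m : ℤ) n ∧ IsCoprime (m : ℤ) y ∧ IsCoprime (n : ℤ) x := fun h =>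
      ⟨Nat.isCoprime_iff_coprime.2 (h.coprime_mul_right.coprime_mul_right_right),
        Nat.isCoprime_iff_coprime.2 (h.coprime_mul_right.coprime_dvd_right
          ⟨_, by rw [sq, mul_left_comm]⟩),
        Nat.isCoprime_iff_coprime.2 (h.symm.coprime_mul_right.coprime_dvd_right
          ⟨_, by rw [sq, mul_left_comm]⟩)⟩
    obtain ⟨-, -, hAB, hAC, hBC, -⟩ := hT o ho
    have dA : ∀ z ∈ R, ∀ z' ∈ R, (A : ℤ) ∣ 2 * (z.2.1 * z'.2.2 - z'.2.1 * z.2.2) := by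
      intro z hz z' hz'
      have hq : ∀ z ∈ T, (A : ℤ) ∣ (z.2.1 : ℤ) ^ 2 * o.2.2 ^ 2 - o.2.1 ^ 2 * z.2.2 ^ 2 :=
        fun z hz => (cop hAB).1.dvd_of_dvd_mul_left ⟨o.1 ^ 2 * z.2.2 ^ 2 - z.1 ^ 2 * o.2.2 ^ 2, by
          linear_combination (o.2.2 : ℤ) ^ 2 * hEq z hz - (z.2.2 : ℤ) ^ 2 * hEq o ho⟩
      exact dvd_two_mul_minor (by exact_mod_cast hA.ne') (cop hAC).2.1
        (cop (hT z (hRT z hz)).2.2.1).2.1 (hq z (hRT z hz)) (hq z' (hRT z' hz'))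
        (congrArg (fun g => g.1) (hSc z (hR hz) z' (hR hz')))
    have dB : ∀ z ∈ R, ∀ z' ∈ R, (B : ℤ) ∣ 2 * (z.1 * z'.2.2 - z'.1 * z.2.2) := by
      intro z hz z' hz'
      have hq : ∀ z ∈ T, (B : ℤ) ∣ (z.1 : ℤ) ^ 2 * o.2.2 ^ 2 - o.1 ^ 2 * z.2.2 ^ 2 :=
        fun z hz => (cop hAB).1.symm.dvd_of_dvd_mul_left
          ⟨o.2.1 ^ 2 * z.2.2 ^ 2 - z.2.1 ^ 2 * o.2.2 ^ 2, by
          linear_combination (o.2.2 : ℤ) ^ 2 * hEq z hz - (z.2.2 : ℤ) ^ 2 * hEq o ho⟩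
      exact dvd_two_mul_minor (by exact_mod_cast hB.ne') (cop hBC).2.1
        (cop (hT z (hRT z hz)).2.2.1).2.2 (hq z (hRT z hz)) (hq z' (hRT z' hz'))
        (congrArg (fun g => g.2.1) (hSc z (hR hz) z' (hR hz')))
    have dC : ∀ z ∈ R, ∀ z' ∈ R, (C : ℤ) ∣ 2 * (z.1 * z'.2.1 - z'.1 * z.2.1) := by
      intro z hz z' hz'
      have hq : ∀ z ∈ T, (C : ℤ) ∣ (z.1 : ℤ) ^ 2 * o.2.1 ^ 2 - o.1 ^ 2 * z.2.1 ^ 2 :=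
        fun z hz => (cop hAC).1.symm.dvd_of_dvd_mul_left
          ⟨z.2.2 ^ 2 * o.2.1 ^ 2 - o.2.2 ^ 2 * z.2.1 ^ 2, by
          linear_combination (o.2.1 : ℤ) ^ 2 * hEq z hz - (z.2.1 : ℤ) ^ 2 * hEq o ho⟩
      exact dvd_two_mul_minor (by exact_mod_cast hC.ne') (cop hBC).2.2
        (cop (hT z (hRT z hz)).2.2.2.1).2.2 (hq z (hRT z hz)) (hq z' (hRT z' hz'))
        (congrArg (fun g => g.2.2) (hSc z (hR hz) z' (hR hz')))
    have eA : (A : ℤ) ∣ 2 * D := by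
      obtain ⟨i, hi⟩ := dA z₁ m₁ z₂ m₂
      obtain ⟨j, hj⟩ := dA z₀ m₀ z₂ m₂
      obtain ⟨k, hk⟩ := dA z₀ m₀ z₁ m₁
      exact ⟨z₀.1 * i - z₁.1 * j + z₂.1 * k, by
        linear_combination (z₀.1 : ℤ) * hi - (z₁.1 : ℤ) * hj + (z₂.1 : ℤ) * hk⟩
    have eB : (B : ℤ) ∣ 2 * D := by
      obtain ⟨i, hi⟩ := dB z₁ m₁ z₂ m₂
      obtain ⟨j, hj⟩ := dB z₀ m₀ z₂ m₂
      obtain ⟨k, hk⟩ := dB z₀ m₀ z₁ m₁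
      exact ⟨-z₀.2.1 * i + z₁.2.1 * j - z₂.2.1 * k, by
        linear_combination -(z₀.2.1 : ℤ) * hi + (z₁.2.1 : ℤ) * hj - (z₂.2.1 : ℤ) * hk⟩
    have eC : (C : ℤ) ∣ 2 * D := by
      obtain ⟨i, hi⟩ := dC z₁ m₁ z₂ m₂
      obtain ⟨j, hj⟩ := dC z₀ m₀ z₂ m₂
      obtain ⟨k, hk⟩ := dC z₀ m₀ z₁ m₁
      exact ⟨z₀.2.2 * i - z₁.2.2 * j + z₂.2.2 * k, by
        linear_combination (z₀.2.2 : ℤ) * hi - (z₁.2.2 : ℤ) * hj + (z₂.2.2 : ℤ) * hk⟩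
    push_cast
    exact ((cop hAC).1.mul_left (cop hBC).1).mul_dvd ((cop hAB).1.mul_dvd eA eB) eC
  have hle : (A * B * C : ℝ) ^ 2 ≤ 4 * (D : ℝ) ^ 2 := by
    have h1 := Int.natAbs_le_of_dvd_ne_zero hdvd (by simpa using hne)
    have h2 : ((A * B * C : ℕ) : ℤ) ≤ |2 * D| := by
      rw [Int.abs_eq_natAbs]; exact_mod_cast h1
    have h3 : ((A * B * C : ℕ) : ℝ) ≤ |2 * (D : ℝ)| := by exact_mod_cast h2
    push_cast at h3
    calc (A * B * C : ℝ) ^ 2 ≤ |2 * (D : ℝ)| ^ 2 := by gcongr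
      _ = _ := by rw [sq_abs]; ring
  have : (A * B * C : ℝ) ^ 3 ≤ 4 * ((A * B * C : ℝ) * D ^ 2) := by
    calc (A * B * C : ℝ) ^ 3 = (A * B * C : ℝ) * (A * B * C : ℝ) ^ 2 := by ring
      _ ≤ (A * B * C : ℝ) * (4 * (D : ℝ) ^ 2) := by gcongr
      _ = _ := by ring
  have h64 : 64 * M ^ 3 / (K : ℝ) ^ 6 = 4 * (16 * M ^ 3 / (K : ℝ) ^ 6) := by ring
  linarith

theorem card_le_of_conic_fiber {N d α β γ e y₁ y₂ y₃ : ℕ} {τ : ℝ} (hd : 0 < d) (hα : 0 < α)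
    (hβ : 0 < β) (hγ : 0 < γ) (he : 0 < e) (hy₁ : 0 < y₁) (hy₂ : 0 < y₂) (hy₃ : 0 < y₃)
    (hτ : ∀ n : ℕ, n ≠ 0 → n ≤ 2 * N → (n.divisors.card : ℝ) ≤ τ) (T : Finset (ℕ × ℕ × ℕ))
    (hT : ∀ z ∈ T, (0 < z.1 ∧ 0 < z.2.1 ∧ 0 < z.2.2) ∧
      y₁ * y₂ * y₃ ≤ z.1 * z.2.1 * z.2.2 ∧ ∃ U V W x s : ℕ, W ≤ 2 * N ∧ x ≤ N ∧ s ≤ 3 * N ∧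
        IsFactorization U V W x s d α β γ e y₁ y₂ y₃ z.1 z.2.1 z.2.2) :
    (T.card : ℝ) ≤ 12 * τ ^ 3 * N * (1 / (d * α * β * γ * e * y₁ * y₂ * y₃)) := by
  rcases T.eq_empty_or_nonempty with rfl | ⟨o, ho⟩
  · have hτ0 : 0 ≤ τ ∨ N = 0 := by
      rcases Nat.eq_zero_or_pos N with h | h
      · exact Or.inr h
      · exact Or.inl ((Nat.cast_nonneg _).trans (hτ 1 one_ne_zero (by omega)))
    rcases hτ0 with h | rfl
    · simp only [Finset.card_empty, Nat.cast_zero]; positivity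
    · simp
  obtain ⟨⟨ha, hb, hc⟩, hYX, U, V, W, x, s, hW, hx, hs, hf⟩ := hT o ho
  have hle : ∀ k : ℕ, k ≠ 0 → k ≤ W → (k.divisors.card : ℝ) ≤ τ := fun k h0 hk =>
    hτ k h0 (hk.trans hW)
  have hD : 0 < d * (α * β * γ) * e ^ 2 := by positivity
  have hu : α * y₁ ≤ γ * y₃ * o.2.2 ^ 2 := by
    rw [← hf.add_eq]
    exact (Nat.le_mul_of_pos_right _ (by positivity)).trans (Nat.le_add_right _ _)
  have hv : β * y₂ ≤ γ * y₃ * o.2.2 ^ 2 := by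
    rw [← hf.add_eq]
    exact (Nat.le_mul_of_pos_right _ (by positivity)).trans (Nat.le_add_left _ _)
  have hw : γ * y₃ ≤ γ * y₃ * o.2.2 ^ 2 := Nat.le_mul_of_pos_right _ (by positivity)
  have hWle : γ * y₃ * o.2.2 ^ 2 ≤ W := by
    rw [hf.sum]; exact Nat.le_mul_of_pos_left _ hD
  have hτA := hle _ (by positivity) (hu.trans hWle)
  have hτB := hle _ (by positivity) (hv.trans hWle)
  have hτC := hle _ (by positivity) (hw.trans hWle)
  have hτ0 : 0 ≤ τ := (Nat.cast_nonneg _).trans hτA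
  have key := card_conic_le (A := α * y₁) (B := β * y₂) (C := γ * y₃) (by positivity)
    (by positivity) (by positivity) (M := 2 * N / (d * (α * β * γ) * e ^ 2 : ℕ)) T
    (fun z hz => by
      obtain ⟨hz0, -, U, V, W, x, s, hW, -, -, hf⟩ := hT z hz
      refine ⟨hz0, hf.add_eq, hf.coprime₁₂, hf.coprime₁₃, hf.coprime₂₃, ?_⟩
      rw [le_div_iff₀' (by exact_mod_cast hD)]
      rw [hf.sum] at hW
      exact_mod_cast hW)
  refine key.trans ?_
  have hR : ∀ k : ℕ, 0 < k → (0 : ℝ) < k := fun k hk => by exact_mod_cast hk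
  have := hR d hd
  have := hR α hα
  have := hR β hβ
  have := hR γ hγ
  have := hR e he
  have := hR _ hy₁
  have := hR _ hy₂
  have := hR _ hy₃
  set P : ℝ := d * α * β * γ * e * y₁ * y₂ * y₃ with hP
  have hP0 : 0 < P := by positivity
  have hxN : (d : ℝ) ^ 3 * (y₁ * y₂ * y₃) ≤ N := by
    have := hf.cubic ▸ hx; exact_mod_cast this
  have hsN : ((α * β * γ : ℝ)) ^ 2 * e ^ 3 * (y₁ * y₂ * y₃) ≤ 3 * N := by
    have : (α * β * γ) ^ 2 * e ^ 3 * (y₁ * y₂ * y₃) ≤ 3 * N :=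
      (Nat.mul_le_mul_left _ hYX).trans (hf.square ▸ hs)
    exact_mod_cast this
  have hd1 : (1 : ℝ) ≤ d := by exact_mod_cast hd
  have he1 : (1 : ℝ) ≤ e := by exact_mod_cast he
  have hone : 1 ≤ 2 * N * (1 / P) := by
    rw [mul_one_div, one_le_div hP0]
    refine le_of_sq_le_sq ?_ (by positivity)
    calc P ^ 2
        = 1 * (1 * (d ^ 2 * (y₁ * y₂ * y₃)) * ((α * β * γ : ℝ) ^ 2 * e ^ 2 * (y₁ * y₂ * y₃))) := by
          rw [hP]; ring
      _ ≤ d * (e * (d ^ 2 * (y₁ * y₂ * y₃)) * ((α * β * γ : ℝ) ^ 2 * e ^ 2 * (y₁ * y₂ * y₃))) := by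
          gcongr
      _ = ((d : ℝ) ^ 3 * (y₁ * y₂ * y₃)) * ((α * β * γ : ℝ) ^ 2 * e ^ 3 * (y₁ * y₂ * y₃)) := by ring
      _ ≤ N * (3 * N) := by gcongr
      _ ≤ _ := by nlinarith [sq_nonneg (N : ℝ)]
  have hsqrt : √(2 * N / (d * (α * β * γ) * e ^ 2 : ℕ) /
      ((α * y₁ : ℕ) * (β * y₂ : ℕ) * (γ * y₃ : ℕ)))
      ≤ 2 * N * (1 / P) := by
    rw [mul_one_div]
    refine Real.sqrt_le_iff.2 ⟨by positivity, ?_⟩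
    push_cast
    rw [div_pow, div_div, div_le_div_iff₀ (by positivity) (by positivity)]
    have h1 : (d : ℝ) * (y₁ * y₂ * y₃) ≤ N := by
      refine le_trans ?_ hxN
      gcongr
      exact le_self_pow₀ hd1 (by norm_num)
    set Q : ℝ := (d : ℝ) * (α * β * γ) * e ^ 2 * (α * y₁ * (β * y₂) * (γ * y₃)) with hQ
    calc 2 * (N : ℝ) * P ^ 2 = 2 * N * (d * (y₁ * y₂ * y₃)) * Q := by rw [hP, hQ]; ring
      _ ≤ 2 * N * N * Q := by gcongr
      _ ≤ 2 * N * N * Q * 2 := le_mul_of_one_le_right (by positivity) one_le_two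
      _ = _ := by ring
  calc _ ≤ 2 * (τ * τ * τ) * (2 * (2 * N * (1 / P)) + 2 * N * (1 / P)) := by gcongr
    _ = _ := by ring

theorem card_le_of_linear_fiber {N d α β γ e a b c k₁ k₂ : ℕ} (hd : 0 < d) (hα : 0 < α)
    (hβ : 0 < β) (hγ : 0 < γ) (he : 0 < e) (ha : 0 < a) (hb : 0 < b) (hc : 0 < c)
    (T : Finset (ℕ × ℕ × ℕ))
    (hT : ∀ y ∈ T, ((2 ^ k₁ ≤ y.1 ∧ y.1 < 2 ^ (k₁ + 1)) ∧ 2 ^ k₂ ≤ y.2.1 ∧ y.2.1 < 2 ^ (k₂ + 1)) ∧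
      a * b * c ≤ y.1 * y.2.1 * y.2.2 ∧ ∃ U V W x s : ℕ, x ≤ N ∧ s ≤ 3 * N ∧
        IsFactorization U V W x s d α β γ e y.1 y.2.1 y.2.2 a b c) :
    (T.card : ℝ) ≤ 18 * N * (1 / (d * α * β * γ * e * a * b * c)) := by
  rcases T.eq_empty_or_nonempty with rfl | ⟨o, ho⟩
  · simp only [Finset.card_empty, Nat.cast_zero]; positivity
  obtain ⟨⟨⟨hk₁, -⟩, hk₂, -⟩, hXY, U, V, W, x, s, hx, hs, hf⟩ := hT o ho
  have key := card_linear_cell_le (p := α * a ^ 2) (q := β * b ^ 2) (r := γ * c ^ 2)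
    (by positivity) (by
      have := hf.coprime₁₃
      rw [mul_right_comm, mul_right_comm γ] at this
      exact this.coprime_mul_right.coprime_mul_right_right) k₁ k₂ T
    (fun y hy => by
      obtain ⟨h, -, U, V, W, x, s, -, -, hf⟩ := hT y hy
      refine ⟨?_, ?_, h⟩
      · linear_combination hf.add_eq
      · have := hf.coprime₁₂
        rw [mul_right_comm, mul_right_comm β] at this
        exact this.coprime_mul_left.coprime_mul_left_right) ho
  refine key.trans ?_
  have hR : ∀ k : ℕ, 0 < k → (0 : ℝ) < k := fun k hk => by exact_mod_cast hk
  have := hR d hd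
  have := hR α hα
  have := hR β hβ
  have := hR γ hγ
  have := hR e he
  have := hR _ ha
  have := hR _ hb
  have := hR _ hc
  set P : ℝ := d * α * β * γ * e * a * b * c with hP
  have hP0 : 0 < P := by positivity
  have hxN : (d : ℝ) ^ 3 * (o.1 * o.2.1 * o.2.2) ≤ N := by
    have := hf.cubic ▸ hx; exact_mod_cast this
  have hxN' : (d : ℝ) ^ 3 * (a * b * c) ≤ N := by
    have := (Nat.mul_le_mul_left (d ^ 3) hXY).trans (hf.cubic ▸ hx); exact_mod_cast this
  have hsN : ((α * β * γ : ℝ)) ^ 2 * e ^ 3 * (a * b * c) ≤ 3 * N := by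
    have := hf.square ▸ hs; exact_mod_cast this
  have hadd : (α * o.1 * a ^ 2 + β * o.2.1 * b ^ 2 : ℝ) = γ * o.2.2 * c ^ 2 := by
    exact_mod_cast hf.add_eq
  have hd1 : (1 : ℝ) ≤ d := by exact_mod_cast hd
  have he1 : (1 : ℝ) ≤ e := by exact_mod_cast he
  have hone : 1 ≤ 2 * N * (1 / P) := by
    rw [mul_one_div, one_le_div hP0]
    refine le_of_sq_le_sq ?_ (by positivity)
    calc P ^ 2 = 1 * (1 * (d ^ 2 * (a * b * c)) * ((α * β * γ : ℝ) ^ 2 * e ^ 2 * (a * b * c))) := by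
          rw [hP]; ring
      _ ≤ d * (e * (d ^ 2 * (a * b * c)) * ((α * β * γ : ℝ) ^ 2 * e ^ 2 * (a * b * c))) := by
          gcongr
      _ = ((d : ℝ) ^ 3 * (a * b * c)) * ((α * β * γ : ℝ) ^ 2 * e ^ 3 * (a * b * c)) := by ring
      _ ≤ N * (3 * N) := by gcongr
      _ ≤ _ := by nlinarith [sq_nonneg (N : ℝ)]
  have hcube : (o.1 * o.2.1 : ℝ) / (γ * c ^ 2 : ℕ) ≤ 2 * N * (1 / P) := by
    rw [mul_one_div, div_le_div_iff₀ (by positivity) hP0]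
    push_cast
    have hz1 : 0 < (o.1 : ℝ) := hR _ ((by positivity : 0 < 2 ^ k₁).trans_le hk₁)
    have hz2 : 0 < (o.2.1 : ℝ) := hR _ ((by positivity : 0 < 2 ^ k₂).trans_le hk₂)
    have h1 : (α * o.1 * a ^ 2 : ℝ) ≤ γ * o.2.2 * c ^ 2 := by
      rw [← hadd]; have : (0 : ℝ) ≤ β * o.2.1 * b ^ 2 := by positivity
      linarith
    have h2 : (β * o.2.1 * b ^ 2 : ℝ) ≤ γ * o.2.2 * c ^ 2 := by
      rw [← hadd]; have : (0 : ℝ) ≤ α * o.1 * a ^ 2 := by positivity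
      linarith
    have h12 := mul_le_mul h1 h2 (by positivity) (by positivity)
    refine le_of_pow_le_pow_left₀ three_ne_zero (by positivity) ?_
    set z : ℝ := o.1 * o.2.1 with hz
    set r : ℝ := γ * c ^ 2 with hr
    have hx0 : (0 : ℝ) ≤ z * o.2.2 := by positivity
    have h1 : z * o.2.2 ≤ (d : ℝ) ^ 3 * (z * o.2.2) := le_mul_of_one_le_left hx0 (one_le_pow₀ hd1)
    calc (z * P) ^ 3
        = z ^ 2 * (α * o.1 * a ^ 2 * (β * o.2.1 * b ^ 2)) *
          (d ^ 3 * γ * c ^ 2 * ((α * β * γ : ℝ) ^ 2 * e ^ 3 * (a * b * c))) := by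
          rw [hP, hz]; ring
      _ ≤ z ^ 2 * (γ * o.2.2 * c ^ 2 * (γ * o.2.2 * c ^ 2)) *
          (d ^ 3 * γ * c ^ 2 * (3 * N)) := by gcongr
      _ = (d : ℝ) ^ 3 * (z * o.2.2) * (z * o.2.2) * (3 * N) * r ^ 3 := by rw [hr]; ring
      _ ≤ N * N * (3 * N) * r ^ 3 := by
          gcongr
          exact h1.trans hxN
      _ ≤ 8 * (N * r) ^ 3 := by
          have : 0 ≤ ((N : ℝ) * r) ^ 3 := by positivity
          linarith
      _ = _ := by ring
  calc _ = 8 * ((o.1 * o.2.1 : ℝ) / (γ * c ^ 2 : ℕ)) + 1 := by ring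
    _ ≤ 8 * (2 * N * (1 / P)) + 2 * N * (1 / P) := by gcongr
    _ = _ := by ring

theorem sum_piFinset_one_div_prod (R : ℕ) :
    ∑ t ∈ Fintype.piFinset (fun _ : Fin 8 => Finset.Icc 1 R),
      1 / ((t 0 : ℝ) * t 1 * t 2 * t 3 * t 4 * t 5 * t 6 * t 7) =
    (∑ n ∈ Finset.Icc 1 R, (1 / n : ℝ)) ^ 8 := by
  rw [Finset.sum_pow']
  refine Finset.sum_congr rfl fun t _ => ?_
  rw [Finset.prod_div_distrib, Fin.prod_univ_eight, Fin.prod_univ_eight]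
  simp

theorem sum_Icc_one_div_le (R : ℕ) :
    ∑ n ∈ Finset.Icc 1 R, (1 / n : ℝ) ≤ 1 + Real.log R := by
  have := harmonic_le_one_add_log R
  rw [harmonic_eq_sum_Icc] at this
  push_cast at this
  simpa using this

theorem natLog_two_add_one_le {n : ℕ} (hn : 1 ≤ n) :
    ((Nat.log 2 n + 1 : ℕ) : ℝ) ≤ 2 * (1 + Real.log n) := by
  have h0 : (2 : ℝ) ^ Nat.log 2 n ≤ n := by exact_mod_cast Nat.pow_log_le_self 2 (by omega)
  have h1 : Nat.log 2 n * Real.log 2 ≤ Real.log n := by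
    rw [← Real.log_pow]; exact Real.log_le_log (by positivity) h0
  have h2 := Real.log_two_gt_d9
  have h3 : (0 : ℝ) ≤ Nat.log 2 n := by positivity
  push_cast
  nlinarith

/-- Positive solutions of `U * V * (U + V) = x * s ^ 2` in a box, up to a coprimality condition. -/
def positiveSolutions (N : ℕ) : Finset (ℕ × ℕ × ℕ × ℕ) :=
  {z ∈ Finset.Icc 1 (2 * N) ×ˢ Finset.Icc 1 (2 * N) ×ˢ Finset.Icc 1 N ×ˢ Finset.Icc 1 (3 * N) |
    z.1 + z.2.1 ≤ 2 * N ∧ z.1 * z.2.1 * (z.1 + z.2.1) = z.2.2.1 * z.2.2.2 ^ 2 ∧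
      (z.1.gcd z.2.1).Coprime (z.2.2.1.gcd z.2.2.2)}

/-- The solution of `U * V * (U + V) = x * s ^ 2` with given torsor coordinates. -/
def ofTorsor (d α β γ e y₁ y₂ y₃ a b c : ℕ) : ℕ × ℕ × ℕ × ℕ :=
  (d * (α * β * γ) * e ^ 2 * (α * y₁ * a ^ 2), d * (α * β * γ) * e ^ 2 * (β * y₂ * b ^ 2),
    d ^ 3 * (y₁ * y₂ * y₃), (α * β * γ) ^ 2 * e ^ 3 * (a * b * c))

theorem IsFactorization.eq_ofTorsor {U V W x s d α β γ e y₁ y₂ y₃ a b c : ℕ}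
    (h : IsFactorization U V W x s d α β γ e y₁ y₂ y₃ a b c) :
    (U, V, x, s) = ofTorsor d α β γ e y₁ y₂ y₃ a b c := by
  rw [ofTorsor, ← h.left, ← h.right, ← h.cubic, ← h.square]

theorem IsFactorization.le {U V W x s d α β γ e y₁ y₂ y₃ a b c : ℕ}
    (h : IsFactorization U V W x s d α β γ e y₁ y₂ y₃ a b c) (hx : 0 < x) (hs : 0 < s) :
    (∀ n ∈ [d, y₁, y₂, y₃], n ∈ Finset.Icc 1 x) ∧
      ∀ n ∈ [α, β, γ, e, a, b, c], n ∈ Finset.Icc 1 s := by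
  have key : ∀ {m n : ℕ}, 0 < m → n ∣ m → n ∈ Finset.Icc 1 m := fun hm hn =>
    Finset.mem_Icc.2 ⟨Nat.pos_of_dvd_of_pos hn hm, Nat.le_of_dvd hm hn⟩
  have hx' := h.cubic
  have hs' := h.square
  constructor
  · intro n hn
    refine key hx ?_
    rw [hx']
    simp only [List.mem_cons, List.not_mem_nil, or_false] at hn
    rcases hn with rfl | rfl | rfl | rfl
    · exact ⟨n ^ 2 * (y₁ * y₂ * y₃), by ring⟩
    · exact ⟨d ^ 3 * (y₂ * y₃), by ring⟩
    · exact ⟨d ^ 3 * (y₁ * y₃), by ring⟩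
    · exact ⟨d ^ 3 * (y₁ * y₂), by ring⟩
  · intro n hn
    refine key hs ?_
    rw [hs']
    simp only [List.mem_cons, List.not_mem_nil, or_false] at hn
    rcases hn with rfl | rfl | rfl | rfl | rfl | rfl | rfl
    · exact ⟨n * β ^ 2 * γ ^ 2 * e ^ 3 * (a * b * c), by ring⟩
    · exact ⟨α ^ 2 * n * γ ^ 2 * e ^ 3 * (a * b * c), by ring⟩
    · exact ⟨α ^ 2 * β ^ 2 * n * e ^ 3 * (a * b * c), by ring⟩
    · exact ⟨(α * β * γ) ^ 2 * n ^ 2 * (a * b * c), by ring⟩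
    · exact ⟨(α * β * γ) ^ 2 * e ^ 3 * (b * c), by ring⟩
    · exact ⟨(α * β * γ) ^ 2 * e ^ 3 * (a * c), by ring⟩
    · exact ⟨(α * β * γ) ^ 2 * e ^ 3 * (a * b), by ring⟩

open Classical in
/-- The coordinates `(a, b, c)` of small points whose other coordinates are `t`. -/
noncomputable def conicFiber (N : ℕ) (t : Fin 8 → ℕ) : Finset (ℕ × ℕ × ℕ) :=
  {z ∈ Finset.Icc 1 (3 * N) ×ˢ Finset.Icc 1 (3 * N) ×ˢ Finset.Icc 1 (3 * N) |
    t 5 * t 6 * t 7 ≤ z.1 * z.2.1 * z.2.2 ∧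
      ∃ U V W x s : ℕ, W ≤ 2 * N ∧ x ≤ N ∧ s ≤ 3 * N ∧
        IsFactorization U V W x s (t 0) (t 1) (t 2) (t 3) (t 4) (t 5) (t 6) (t 7) z.1 z.2.1 z.2.2}

open Classical in
/-- The coordinates `(y₁, y₂, y₃)` in a dyadic box of small points whose other coordinates
are `t`. -/
noncomputable def linearFiber (N : ℕ) (t : Fin 8 → ℕ) (k : ℕ × ℕ) : Finset (ℕ × ℕ × ℕ) :=
  {y ∈ Finset.Icc 1 (3 * N) ×ˢ Finset.Icc 1 (3 * N) ×ˢ Finset.Icc 1 (3 * N) |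
    ((2 ^ k.1 ≤ y.1 ∧ y.1 < 2 ^ (k.1 + 1)) ∧ 2 ^ k.2 ≤ y.2.1 ∧ y.2.1 < 2 ^ (k.2 + 1)) ∧
    t 5 * t 6 * t 7 ≤ y.1 * y.2.1 * y.2.2 ∧
      ∃ U V W x s : ℕ, x ≤ N ∧ s ≤ 3 * N ∧
        IsFactorization U V W x s (t 0) (t 1) (t 2) (t 3) (t 4) y.1 y.2.1 y.2.2 (t 5) (t 6) (t 7)}

theorem positiveSolutions_subset (N : ℕ) :
    positiveSolutions N ⊆
      ((Fintype.piFinset fun _ : Fin 8 => Finset.Icc 1 (3 * N)).biUnion fun t =>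
        (conicFiber N t).image fun z =>
          ofTorsor (t 0) (t 1) (t 2) (t 3) (t 4) (t 5) (t 6) (t 7) z.1 z.2.1 z.2.2) ∪
      (Fintype.piFinset fun _ : Fin 8 => Finset.Icc 1 (3 * N)).biUnion fun t =>
        (Finset.range (Nat.log 2 (3 * N) + 1) ×ˢ Finset.range (Nat.log 2 (3 * N) + 1)).biUnion
          fun k => (linearFiber N t k).image fun y =>
            ofTorsor (t 0) (t 1) (t 2) (t 3) (t 4) y.1 y.2.1 y.2.2 (t 5) (t 6) (t 7) := by
  classical
  rintro ⟨U, V, x, s⟩ h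
  simp only [positiveSolutions, Finset.mem_filter, Finset.mem_product, Finset.mem_Icc] at h
  obtain ⟨⟨⟨hU, -⟩, ⟨hV, -⟩, ⟨hx, hxN⟩, hs, hsN⟩, hW, heq, hg⟩ := h
  obtain ⟨d, α, β, γ, e, y₁, y₂, y₃, a, b, c, hf⟩ := exists_isFactorization hU hV hx rfl heq hg
  obtain ⟨h1, h2⟩ := hf.le hx hs
  replace h1 : ∀ n ∈ [d, y₁, y₂, y₃], n ∈ Finset.Icc 1 (3 * N) := fun n hn =>
    Finset.Icc_subset_Icc_right (by omega) (h1 n hn)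
  replace h2 : ∀ n ∈ [α, β, γ, e, a, b, c], n ∈ Finset.Icc 1 (3 * N) := fun n hn =>
    Finset.Icc_subset_Icc_right hsN (h2 n hn)
  simp only [List.forall_mem_cons, List.not_mem_nil, false_imp_iff, implies_true, and_true]
    at h1 h2
  obtain ⟨hd, hy₁, hy₂, hy₃⟩ := h1
  obtain ⟨hα, hβ, hγ, he, ha, hb, hc⟩ := h2
  rw [hf.eq_ofTorsor, Finset.mem_union]
  rcases le_total (y₁ * y₂ * y₃) (a * b * c) with hle | hle
  · left
    refine Finset.mem_biUnion.2 ⟨![d, α, β, γ, e, y₁, y₂, y₃], ?_, ?_⟩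
    · rw [Fintype.mem_piFinset]
      intro i
      fin_cases i <;> assumption
    · refine Finset.mem_image.2 ⟨(a, b, c), ?_, rfl⟩
      exact Finset.mem_filter.2 ⟨Finset.mk_mem_product ha (Finset.mk_mem_product hb hc), hle,
        U, V, _, x, s, hW, hxN, hsN, hf⟩
  · right
    refine Finset.mem_biUnion.2 ⟨![d, α, β, γ, e, a, b, c], ?_, ?_⟩
    · rw [Fintype.mem_piFinset]
      intro i
      fin_cases i <;> assumption
    have hlog : ∀ y ∈ Finset.Icc 1 (3 * N), Nat.log 2 y ∈ Finset.range (Nat.log 2 (3 * N) + 1) ∧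
        2 ^ Nat.log 2 y ≤ y ∧ y < 2 ^ (Nat.log 2 y + 1) := fun y hy => by
      rw [Finset.mem_Icc] at hy
      exact ⟨Finset.mem_range_succ_iff.2 (Nat.log_mono_right hy.2),
        Nat.pow_log_le_self 2 (by omega), Nat.lt_pow_succ_log_self one_lt_two y⟩
    obtain ⟨hk₁, hk₁'⟩ := hlog y₁ hy₁
    obtain ⟨hk₂, hk₂'⟩ := hlog y₂ hy₂
    refine Finset.mem_biUnion.2 ⟨(Nat.log 2 y₁, Nat.log 2 y₂), Finset.mk_mem_product hk₁ hk₂, ?_⟩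
    refine Finset.mem_image.2 ⟨(y₁, y₂, y₃), ?_, rfl⟩
    exact Finset.mem_filter.2 ⟨Finset.mk_mem_product hy₁ (Finset.mk_mem_product hy₂ hy₃),
      ⟨hk₁', hk₂'⟩, hle,
      U, V, _, x, s, hxN, hsN, hf⟩

theorem card_conicFiber_le {N : ℕ} {τ : ℝ}
    (hτ : ∀ n : ℕ, n ≠ 0 → n ≤ 2 * N → (n.divisors.card : ℝ) ≤ τ) {t : Fin 8 → ℕ}
    (ht : ∀ i, 0 < t i) :
    ((conicFiber N t).card : ℝ) ≤
      12 * τ ^ 3 * N * (1 / (t 0 * t 1 * t 2 * t 3 * t 4 * t 5 * t 6 * t 7)) := by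
  classical
  refine card_le_of_conic_fiber (ht 0) (ht 1) (ht 2) (ht 3) (ht 4) (ht 5) (ht 6) (ht 7) hτ _
    fun z hz => ?_
  replace hz := Finset.mem_filter.1 hz
  simp only [Finset.mem_product, Finset.mem_Icc] at hz
  exact ⟨⟨hz.1.1.1, hz.1.2.1.1, hz.1.2.2.1⟩, hz.2⟩

theorem card_linearFiber_le (N : ℕ) {t : Fin 8 → ℕ} (ht : ∀ i, 0 < t i) (k : ℕ × ℕ) :
    ((linearFiber N t k).card : ℝ) ≤
      18 * N * (1 / (t 0 * t 1 * t 2 * t 3 * t 4 * t 5 * t 6 * t 7)) := by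
  classical
  refine card_le_of_linear_fiber (k₁ := k.1) (k₂ := k.2) (ht 0) (ht 1) (ht 2) (ht 3) (ht 4) (ht 5)
    (ht 6) (ht 7) _ fun y hy => ?_
  exact (Finset.mem_filter.1 hy).2

theorem card_positiveSolutions_le {N : ℕ} (hN : 1 ≤ N) {τ : ℝ}
    (hτ : ∀ n : ℕ, n ≠ 0 → n ≤ 2 * N → (n.divisors.card : ℝ) ≤ τ) :
    ((positiveSolutions N).card : ℝ) ≤
      (12 * τ ^ 3 + 72) * N * (1 + Real.log (3 * N : ℕ)) ^ 10 := by
  set L := Nat.log 2 (3 * N) + 1 with hL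
  set H : ℝ := 1 + Real.log (3 * N : ℕ) with hH
  have hH1 : 1 ≤ H := by
    have : 0 ≤ Real.log (3 * N : ℕ) := Real.log_natCast_nonneg _
    linarith
  have hLH : (L : ℝ) ≤ 2 * H := natLog_two_add_one_le (by omega)
  have hτ0 : 0 ≤ τ := (Nat.cast_nonneg _).trans (hτ 1 one_ne_zero (by omega))
  have hpos : ∀ t ∈ Fintype.piFinset fun _ : Fin 8 => Finset.Icc 1 (3 * N), ∀ i, 0 < t i :=
    fun t ht i => (Finset.mem_Icc.1 (Fintype.mem_piFinset.1 ht i)).1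
  have hnat : (positiveSolutions N).card ≤
      ∑ t ∈ Fintype.piFinset (fun _ : Fin 8 => Finset.Icc 1 (3 * N)), (conicFiber N t).card +
      ∑ t ∈ Fintype.piFinset (fun _ : Fin 8 => Finset.Icc 1 (3 * N)),
        ∑ k ∈ Finset.range L ×ˢ Finset.range L, (linearFiber N t k).card :=
    (Finset.card_le_card (positiveSolutions_subset N)).trans <| (Finset.card_union_le _ _).trans <|
      add_le_add
        (Finset.card_biUnion_le.trans (Finset.sum_le_sum fun _ _ => Finset.card_image_le))
        (Finset.card_biUnion_le.trans (Finset.sum_le_sum fun _ _ =>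
          Finset.card_biUnion_le.trans (Finset.sum_le_sum fun _ _ => Finset.card_image_le)))
  have hsum : ∑ t ∈ Fintype.piFinset (fun _ : Fin 8 => Finset.Icc 1 (3 * N)),
      1 / ((t 0 : ℝ) * t 1 * t 2 * t 3 * t 4 * t 5 * t 6 * t 7) ≤ H ^ 8 := by
    rw [sum_piFinset_one_div_prod]
    exact pow_le_pow_left₀ (Finset.sum_nonneg fun _ _ => by positivity) (sum_Icc_one_div_le _) 8
  calc ((positiveSolutions N).card : ℝ)
      ≤ ∑ t ∈ Fintype.piFinset (fun _ : Fin 8 => Finset.Icc 1 (3 * N)),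
          ((conicFiber N t).card : ℝ) +
        ∑ t ∈ Fintype.piFinset (fun _ : Fin 8 => Finset.Icc 1 (3 * N)),
          ∑ k ∈ Finset.range L ×ˢ Finset.range L, ((linearFiber N t k).card : ℝ) := by
        exact_mod_cast hnat
    _ ≤ ∑ t ∈ Fintype.piFinset (fun _ : Fin 8 => Finset.Icc 1 (3 * N)),
          12 * τ ^ 3 * N * (1 / (t 0 * t 1 * t 2 * t 3 * t 4 * t 5 * t 6 * t 7)) +
        ∑ t ∈ Fintype.piFinset (fun _ : Fin 8 => Finset.Icc 1 (3 * N)),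
          ∑ k ∈ Finset.range L ×ˢ Finset.range L,
            18 * N * (1 / ((t 0 : ℝ) * t 1 * t 2 * t 3 * t 4 * t 5 * t 6 * t 7)) :=
      add_le_add (Finset.sum_le_sum fun t ht => card_conicFiber_le hτ (hpos t ht))
        (Finset.sum_le_sum fun t ht => Finset.sum_le_sum fun k _ =>
          card_linearFiber_le N (hpos t ht) k)
    _ = (12 * τ ^ 3 + 18 * L ^ 2) * N *
        ∑ t ∈ Fintype.piFinset (fun _ : Fin 8 => Finset.Icc 1 (3 * N)),
          1 / ((t 0 : ℝ) * t 1 * t 2 * t 3 * t 4 * t 5 * t 6 * t 7) := by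
        simp only [Finset.sum_const, Finset.card_product, Finset.card_range, nsmul_eq_mul,
          ← Finset.mul_sum]
        push_cast
        ring
    _ ≤ (12 * τ ^ 3 * H ^ 2 + 18 * (2 * H) ^ 2) * N * H ^ 8 := by
        have : 12 * τ ^ 3 ≤ 12 * τ ^ 3 * H ^ 2 :=
          le_mul_of_one_le_right (by positivity) (one_le_pow₀ hH1)
        gcongr
    _ = _ := by ring

theorem exists_card_positiveSolutions_le {ε : ℝ} (hε : 0 < ε) :
    ∃ C : ℝ, 0 ≤ C ∧ ∀ N : ℕ, 1 ≤ N →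
      ((positiveSolutions N).card : ℝ) ≤ C * (N : ℝ) ^ (1 + ε) := by
  obtain ⟨C₁, hC₁, h₁⟩ := exists_card_divisors_le (ε := ε / 6) (by positivity)
  obtain ⟨C₂, hC₂, h₂⟩ := exists_one_add_log_pow_le 10 (ε := ε / 2) (by positivity)
  refine ⟨84 * (C₁ * 3 ^ (ε / 6)) ^ 3 * (C₂ * 3 ^ (ε / 2)), by positivity, fun N hN => ?_⟩
  have hN' : (1 : ℝ) ≤ N := by exact_mod_cast hN
  have hN0 : (0 : ℝ) ≤ N := by positivity
  set τ : ℝ := C₁ * 3 ^ (ε / 6) * (N : ℝ) ^ (ε / 6) with hτ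
  have hτ1 : 1 ≤ τ :=
    one_le_mul_of_one_le_of_one_le (one_le_mul_of_one_le_of_one_le hC₁
      (Real.one_le_rpow (by norm_num) (by positivity))) (Real.one_le_rpow hN' (by positivity))
  have key := card_positiveSolutions_le hN (τ := τ) fun n hn hnN => by
    refine (h₁ n hn).trans ?_
    rw [hτ, mul_assoc, ← Real.mul_rpow (by norm_num) hN0]
    gcongr
    have : (n : ℝ) ≤ 2 * N := by exact_mod_cast hnN
    linarith
  have hlog : (1 + Real.log (3 * N : ℕ)) ^ 10 ≤ C₂ * 3 ^ (ε / 2) * (N : ℝ) ^ (ε / 2) := by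
    rw [mul_assoc, ← Real.mul_rpow (by norm_num) hN0]
    have := h₂ (3 * N : ℕ) (by exact_mod_cast (by omega : 1 ≤ 3 * N))
    exact_mod_cast this
  have hτ3 : 1 ≤ τ ^ 3 := one_le_pow₀ hτ1
  have hpow : (N : ℝ) ^ (1 + ε) = ((N : ℝ) ^ (ε / 6)) ^ 3 * N * (N : ℝ) ^ (ε / 2) := by
    have h0 : (0 : ℝ) < N := by positivity
    rw [← Real.rpow_natCast, ← Real.rpow_mul hN0, Real.rpow_add h0, Real.rpow_one,
      mul_right_comm, ← Real.rpow_add h0, mul_comm]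
    congr 2
    push_cast
    ring
  calc ((positiveSolutions N).card : ℝ)
      ≤ (12 * τ ^ 3 + 72) * N * (1 + Real.log (3 * N : ℕ)) ^ 10 := key
    _ ≤ (84 * τ ^ 3) * N * (C₂ * 3 ^ (ε / 2) * (N : ℝ) ^ (ε / 2)) := by
        gcongr
        linarith
    _ = _ := by rw [hpow, hτ]; ring

/-- Up to sign, the pairs of integers whose entries and sum have absolute values `U`, `V`, `U + V`
in some order with the sum not third. -/
def orientedPair (U V : ℕ) : Fin 3 → ℤ × ℤ :=
  ![(U, V), (U, -(U + V)), (-(U + V), U)]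

theorem exists_eq_orientedPair_of_pos {a b : ℤ} (ha : 0 < a) (hb : b ≠ 0) (hab : a + b ≠ 0) :
    ∃ (U V : ℕ) (i : Fin 3) (u : ℤˣ), 0 < U ∧ 0 < V ∧ U + V ≤ a.natAbs + b.natAbs ∧
      a = u * (orientedPair U V i).1 ∧ b = u * (orientedPair U V i).2 ∧
      U * V * (U + V) = (a * b * (a + b)).natAbs := by
  rcases lt_or_gt_of_ne hb with hb | hb
  · rcases lt_or_gt_of_ne hab with hab | hab
    · refine ⟨a.natAbs, (a + b).natAbs, 1, 1, by omega, by omega, by omega, ?_, ?_, ?_⟩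
      · simp only [orientedPair, Matrix.cons_val, Units.val_one]; omega
      · simp only [orientedPair, Matrix.cons_val, Units.val_one]; omega
      · have : a.natAbs + (a + b).natAbs = b.natAbs := by omega
        rw [this, Int.natAbs_mul, Int.natAbs_mul]; ring
    · refine ⟨b.natAbs, (a + b).natAbs, 2, -1, by omega, by omega, by omega, ?_, ?_, ?_⟩
      · simp only [orientedPair, Matrix.cons_val, Units.val_one, Units.val_neg]; omega
      · simp only [orientedPair, Matrix.cons_val, Units.val_one, Units.val_neg]; omega
      · have : b.natAbs + (a + b).natAbs = a.natAbs := by omega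
        rw [this, Int.natAbs_mul, Int.natAbs_mul]; ring
  · refine ⟨a.natAbs, b.natAbs, 0, 1, by omega, by omega, le_rfl, ?_, ?_, ?_⟩
    · simp only [orientedPair, Matrix.cons_val, Units.val_one]; omega
    · simp only [orientedPair, Matrix.cons_val, Units.val_one]; omega
    · have : a.natAbs + b.natAbs = (a + b).natAbs := by omega
      rw [this, Int.natAbs_mul, Int.natAbs_mul]

theorem exists_eq_orientedPair {a b : ℤ} (ha : a ≠ 0) (hb : b ≠ 0) (hab : a + b ≠ 0) :
    ∃ (U V : ℕ) (i : Fin 3) (u : ℤˣ), 0 < U ∧ 0 < V ∧ U + V ≤ a.natAbs + b.natAbs ∧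
      a = u * (orientedPair U V i).1 ∧ b = u * (orientedPair U V i).2 ∧
      U * V * (U + V) = (a * b * (a + b)).natAbs := by
  rcases lt_or_gt_of_ne ha with ha | ha
  · obtain ⟨U, V, i, u, hU, hV, hle, h1, h2, h3⟩ :=
      exists_eq_orientedPair_of_pos (neg_pos.2 ha) (neg_ne_zero.2 hb) (by omega : -a + -b ≠ 0)
    refine ⟨U, V, i, -u, hU, hV, by simpa using hle, ?_, ?_, ?_⟩
    · rw [Units.val_neg, neg_mul, ← h1, neg_neg]
    · rw [Units.val_neg, neg_mul, ← h2, neg_neg]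
    · rw [h3, ← Int.natAbs_neg]; congr 1; ring
  · exact exists_eq_orientedPair_of_pos ha hb hab

theorem dvd_orientedPair {k : ℤ} {U V : ℕ} (hU : k ∣ U) (hV : k ∣ V) (i : Fin 3) :
    k ∣ (orientedPair U V i).1 ∧ k ∣ (orientedPair U V i).2 := by
  have := (dvd_add hU hV).neg_right
  fin_cases i
  · exact ⟨hU, hV⟩
  · exact ⟨hU, this⟩
  · exact ⟨this, hU⟩

/-- The integral point of the cubic surface attached to a positive solution of
`U * V * (U + V) = x * s ^ 2`, an ordering and signs. -/
def surfacePoint (p : (ℕ × ℕ × ℕ × ℕ) × Fin 3 × ℤˣ × ℤˣ × ℤˣ) : Fin 4 → ℤ :=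
  let q := orientedPair p.1.1 p.1.2.1 p.2.1
  ![p.2.2.1 * q.1, p.2.2.1 * q.2, p.2.2.2.2 * p.1.2.2.2 - p.2.2.1 * q.1 - p.2.2.1 * q.2,
    p.2.2.2.1 * p.1.2.2.1]

theorem Int.exists_units_mul_natAbs (n : ℤ) : ∃ u : ℤˣ, n = u * n.natAbs := by
  rcases Int.natAbs_eq n with h | h
  · exact ⟨1, by simpa using h⟩
  · exact ⟨-1, by simpa using h⟩

theorem mem_image_surfacePoint {N : ℕ} {x : Fin 4 → ℤ}
    (hg : Finset.gcd Finset.univ (fun i => (x i).natAbs) = 1)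
    (heq : x 0 * x 1 * (x 0 + x 1) + x 3 * (x 0 + x 1 + x 2) ^ 2 = 0)
    (hN : ∀ i, (x i).natAbs ≤ N) (hne : x 3 * (x 0 + x 1 + x 2) ≠ 0) :
    x ∈ (positiveSolutions N ×ˢ Finset.univ).image surfacePoint := by
  obtain ⟨h3, hs⟩ := mul_ne_zero_iff.1 hne
  have hcube : x 0 * x 1 * (x 0 + x 1) = -(x 3 * (x 0 + x 1 + x 2) ^ 2) :=
    eq_neg_of_add_eq_zero_left heq
  have hprod : x 0 * x 1 * (x 0 + x 1) ≠ 0 := by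
    rw [hcube]; exact neg_ne_zero.2 (mul_ne_zero h3 (pow_ne_zero 2 hs))
  obtain ⟨h01, hab⟩ := mul_ne_zero_iff.1 hprod
  obtain ⟨h0, h1⟩ := mul_ne_zero_iff.1 h01
  obtain ⟨U, V, i, u, hU, hV, hle, hx0, hx1, hUV⟩ := exists_eq_orientedPair h0 h1 hab
  obtain ⟨v, hv⟩ := Int.exists_units_mul_natAbs (x 3)
  obtain ⟨w, hw⟩ := Int.exists_units_mul_natAbs (x 0 + x 1 + x 2)
  have hN0 := hN 0
  have hN1 := hN 1
  have hN2 := hN 2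
  have hN3 := hN 3
  refine Finset.mem_image.2 ⟨((U, V, (x 3).natAbs, (x 0 + x 1 + x 2).natAbs), i, u, v, w), ?_, ?_⟩
  · refine Finset.mk_mem_product (Finset.mem_filter.2 ⟨?_, hle.trans (by omega), ?_, ?_⟩)
      (Finset.mem_univ _)
    · simp only [Finset.mem_product, Finset.mem_Icc]
      omega
    · rw [hUV, hcube, Int.natAbs_neg, Int.natAbs_mul, Int.natAbs_pow]
    · rw [Nat.coprime_iff_gcd_eq_one, ← Nat.dvd_one, ← hg]
      set k := (U.gcd V).gcd ((x 3).natAbs.gcd (x 0 + x 1 + x 2).natAbs)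
      have hkU : (k : ℤ) ∣ U :=
        Int.natCast_dvd_natCast.2 ((Nat.gcd_dvd_left _ _).trans (Nat.gcd_dvd_left _ _))
      have hkV : (k : ℤ) ∣ V :=
        Int.natCast_dvd_natCast.2 ((Nat.gcd_dvd_left _ _).trans (Nat.gcd_dvd_right _ _))
      have hk3 : (k : ℤ) ∣ x 3 :=
        Int.natCast_dvd.2 ((Nat.gcd_dvd_right _ _).trans (Nat.gcd_dvd_left _ _))
      have hks : (k : ℤ) ∣ x 0 + x 1 + x 2 :=
        Int.natCast_dvd.2 ((Nat.gcd_dvd_right _ _).trans (Nat.gcd_dvd_right _ _))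
      have hk0 : (k : ℤ) ∣ x 0 := hx0 ▸ (dvd_orientedPair hkU hkV i).1.mul_left _
      have hk1 : (k : ℤ) ∣ x 1 := hx1 ▸ (dvd_orientedPair hkU hkV i).2.mul_left _
      have hk2 : (k : ℤ) ∣ x 2 := (dvd_add_right (dvd_add hk0 hk1)).1 hks
      refine Finset.dvd_gcd fun j _ => Int.natCast_dvd.1 ?_
      fin_cases j <;> assumption
  · ext j
    fin_cases j
    · exact hx0.symm
    · exact hx1.symm
    · simp only [surfacePoint, ← hx0, ← hx1, ← hw]
      simp only [Fin.reduceFinMk, Matrix.cons_val]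
      ring
    · exact hv.symm

theorem stmt_14 (ε : ℝ) (hε : 0 < ε) :
    ∃ C : ℝ, ∀ B : ℝ, 1 ≤ B →
      (Nat.card {x : Fin 4 → ℤ //
          Finset.gcd Finset.univ (fun i => (x i).natAbs) = 1 ∧
          x 0 * x 1 * (x 0 + x 1) + x 3 * (x 0 + x 1 + x 2) ^ 2 = 0 ∧
          (∀ i, |(x i : ℝ)| ≤ B) ∧
          x 3 * (x 0 + x 1 + x 2) ≠ 0} : ℝ)
        ≤ C * B ^ ((1 : ℝ) + ε) := by
  obtain ⟨C, hC, h⟩ := exists_card_positiveSolutions_le hε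
  refine ⟨24 * C, fun B hB => ?_⟩
  have hN : 1 ≤ ⌊B⌋₊ := (Nat.one_le_floor_iff B).2 hB
  set S : Set (Fin 4 → ℤ) := {x | Finset.gcd Finset.univ (fun i => (x i).natAbs) = 1 ∧
    x 0 * x 1 * (x 0 + x 1) + x 3 * (x 0 + x 1 + x 2) ^ 2 = 0 ∧ (∀ i, |(x i : ℝ)| ≤ B) ∧
    x 3 * (x 0 + x 1 + x 2) ≠ 0} with hS
  have hsub : S ⊆ ((positiveSolutions ⌊B⌋₊ ×ˢ Finset.univ).image surfacePoint : Finset _) := by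
    rintro x ⟨hg, heq, hle, hne⟩
    refine mem_image_surfacePoint hg heq (fun i => Nat.le_floor ?_) hne
    rw [Nat.cast_natAbs, Int.cast_abs]
    exact hle i
  have hcard : Nat.card S ≤ (positiveSolutions ⌊B⌋₊).card * 24 := by
    rw [Nat.card_coe_set_eq]
    refine (Set.ncard_le_ncard hsub (Finset.finite_toSet _)).trans ?_
    rw [Set.ncard_coe_finset]
    refine Finset.card_image_le.trans ?_
    rw [Finset.card_product]
    rfl
  calc (Nat.card S : ℝ) ≤ (positiveSolutions ⌊B⌋₊).card * 24 := by exact_mod_cast hcard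
    _ ≤ C * (⌊B⌋₊ : ℝ) ^ (1 + ε) * 24 := by gcongr; exact h _ hN
    _ ≤ C * B ^ (1 + ε) * 24 := by gcongr; exact Nat.floor_le (by linarith)
    _ = _ := by ring
end
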